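/- Fix α ∈ [0,κ] and T > 0. Let ρ ∈ L¹(ℝ,ℂ) ∩ L^∞(ℝ,ℂ) with ρ(−ξ) = conj(ρ(ξ)) for a.e. ξ, and let μ̂₀ : ℝ → ℂ be measurable with ∫_ℝ (1+|ξ|^κ)|μ̂₀(ξ)| dξ < ∞. Assume: there exist σ > 0 and L₀ ≥ 1 such that for all L ≥ L₀, ∫_{|ξ|≥L}|ρ(ξ)|dξ ≤ L^{−σ} and ∫_{|ξ|≥L}|ξ|^κ|μ̂₀(ξ)|dξ ≤ L^{−σ}, and ess sup_ξ |ξ|^κ|μ̂₀(ξ)| < ∞ (no further moment condition on μ̂₀ is assumed). Then there exist τ₀ > 0, ε₀ ∈ (0,1) and C > 0 such that for every 0 < τ < τ₀, every 0 < ε < ε₀, every solution ψ̂ of the twisted Duhamel equation on [0,T], and every integer n ≥ 0 with nτ ≤ T, the exponential-integrator iterates ψ̂ⁿ satisfy ∫_ℝ |ψ̂(nτ,ξ) − ψ̂ⁿ(ξ)| dξ ≤ C τ ε^{1 + (κ−1)α/κ} ( 1 + (τ/ε^{α/(κ−1)})^{((κ−1)/κ)²} log(1/ε) ) + C τ ε^{2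 − 2α/κ} log(1/ε) · B_κ(ε,τ), where B_κ(ε,τ) := 1 if κ ≥ 3 and B₂(ε,τ) := (log(1/ε) + log(1/τ))² if κ = 2. -/

import Mathlib

open MeasureTheory Real
open scoped ENNReal NNReal

/-- The dispersion symbol `P(y) = Σ_{0 ≤ 2j < κ} d_{κ−2j} y^{κ−2j}`. -/
noncomputable def P (κ : ℕ) (d : ℕ → ℝ) (y : ℝ) : ℝ :=
  ∑ j ∈ Finset.range ((κ + 1) / 2), d (κ - 2 * j) * y ^ (κ - 2 * j)

/-- A solution on `[0,T]` of the twisted Duhamel equation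
`ψ̂(z,ξ) = μ̂₀(ξ) + ∫₀^z ∫ e^{isε^α(P(ξ) − P(ξ−ξ₁/ε))} ρ(ξ₁) ψ̂(s,ξ−ξ₁/ε) dξ₁ ds`:
a measurable `ψ̂` with `sup_{0≤z≤T} ∫(1+|ξ|^κ)|ψ̂(z,ξ)|dξ < ∞` satisfying the
identity for every `z ∈ [0,T]` and almost every `ξ`. -/
def IsDuhamelSolution (κ : ℕ) (d : ℕ → ℝ) (ε α T : ℝ) (ρ μ₀ : ℝ → ℂ)
    (ψ : ℝ → ℝ → ℂ) : Prop :=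
  Measurable (Function.uncurry ψ) ∧
  (∃ M : ℝ, ∀ z ∈ Set.Icc (0:ℝ) T,
      (∫⁻ ξ : ℝ, ENNReal.ofReal ((1 + |ξ| ^ κ) * ‖ψ z ξ‖)) ≤ ENNReal.ofReal M) ∧
  ∀ z ∈ Set.Icc (0:ℝ) T, ∀ᵐ ξ : ℝ, ψ z ξ = μ₀ ξ +
    ∫ s in (0:ℝ)..z, ∫ ξ₁ : ℝ,
      Complex.exp (Complex.I *
          Complex.ofReal (s * ε ^ α * (P κ d ξ - P κ d (ξ - ξ₁ / ε)))) *
        ρ ξ₁ * ψ s (ξ - ξ₁ / ε)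

/-- The first-order exponential integrator in twisted Fourier variables:
`ψ̂⁰ = μ̂₀`,
`ψ̂^{n+1}(ξ) = ψ̂ⁿ(ξ) + (∫_{nτ}^{(n+1)τ} e^{isε^αP(ξ)} ds) ⋅
  ∫ ρ(ξ₁) e^{−inτε^αP(ξ−ξ₁/ε)} ψ̂ⁿ(ξ−ξ₁/ε) dξ₁`. -/
noncomputable def psiIter (κ : ℕ) (d : ℕ → ℝ) (ρ μ₀ : ℝ → ℂ) (ε α τ : ℝ) :
    ℕ → ℝ → ℂ
  | 0 => μ₀
  | n + 1 => fun ξ =>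
      psiIter κ d ρ μ₀ ε α τ n ξ +
        (∫ s in ((n : ℝ) * τ)..(((n : ℝ) + 1) * τ),
            Complex.exp (Complex.I * Complex.ofReal (s * ε ^ α * P κ d ξ))) *
          ∫ ξ₁ : ℝ, ρ ξ₁ *
            Complex.exp (-Complex.I *
              Complex.ofReal ((n : ℝ) * τ * ε ^ α * P κ d (ξ - ξ₁ / ε))) *
            psiIter κ d ρ μ₀ ε α τ n (ξ - ξ₁ / ε)

/-- Sum over the integers of the nonnegative part of a real function. -/
noncomputable def zs (f : ℤ → ℝ) : ℝ≥0∞ := ∑' k, ENNReal.ofReal (f k)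

/-- The bracket `1 + |k|` of an integer. -/
noncomputable def jb (k : ℤ) : ℝ := 1 + |(k : ℝ)|

lemma one_le_jb (k : ℤ) : 1 ≤ jb k := by
  unfold jb; linarith [abs_nonneg (k : ℝ)]

lemma jb_pos (k : ℤ) : 0 < jb k := lt_of_lt_of_le one_pos (one_le_jb k)

lemma jb_neg (k : ℤ) : jb (-k) = jb k := by simp [jb]

lemma jb_sub_comm (k l : ℤ) : jb (k - l) = jb (l - k) := by
  rw [← jb_neg]; congr 1; ring

lemma jb_add_le (k l : ℤ) : jb (k + l) ≤ jb k + jb l := by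
  have := abs_add_le (k : ℝ) l
  unfold jb; push_cast; linarith

lemma jb_le_add_sub (k l : ℤ) : jb l ≤ jb k + jb (k - l) := by
  have := jb_add_le k (l - k)
  rw [jb_sub_comm l k] at this
  simpa using this

lemma jb_le_mul_sub (k l : ℤ) : jb k ≤ jb l * jb (k - l) := by
  have h := abs_add_le (l : ℝ) (k - l)
  simp only [jb]; push_cast
  have h2 : |(k:ℝ)| ≤ |(l:ℝ)| + |(k:ℝ) - l| := by simpa using h
  nlinarith [mul_nonneg (abs_nonneg (l:ℝ)) (abs_nonneg ((k:ℝ) - l))]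

lemma zs_mono {f g : ℤ → ℝ} (h : ∀ k, f k ≤ g k) : zs f ≤ zs g :=
  ENNReal.tsum_le_tsum fun k => ENNReal.ofReal_le_ofReal (h k)

lemma zs_mul {f : ℤ → ℝ} {c : ℝ} (hc : 0 ≤ c) :
    zs (fun k => c * f k) = ENNReal.ofReal c * zs f := by
  unfold zs
  rw [← ENNReal.tsum_mul_left]
  simp_rw [ENNReal.ofReal_mul hc]

lemma zs_le_mul {f g : ℤ → ℝ} {c a : ℝ} (hc : 0 ≤ c) (h : ∀ k, f k ≤ c * g k)
    (hg : zs g ≤ ENNReal.ofReal a) : zs f ≤ ENNReal.ofReal (c * a) := by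
  refine (zs_mono h).trans ?_
  rw [zs_mul hc, ENNReal.ofReal_mul hc]
  gcongr

lemma zs_le_add {f g h : ℤ → ℝ} {a b : ℝ} (ha : 0 ≤ a) (hb : 0 ≤ b)
    (hf : ∀ k, f k ≤ g k + h k)
    (hg : zs g ≤ ENNReal.ofReal a) (hh : zs h ≤ ENNReal.ofReal b) :
    zs f ≤ ENNReal.ofReal (a + b) := by
  rw [ENNReal.ofReal_add ha hb]
  refine le_trans ?_ (add_le_add hg hh)
  unfold zs
  rw [← ENNReal.tsum_add]
  exact ENNReal.tsum_le_tsum fun k =>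
    (ENNReal.ofReal_le_ofReal (hf k)).trans ENNReal.ofReal_add_le

lemma zs_sum_le {ι : Type*} (S : Finset ι) {f : ℤ → ℝ} {g : ι → ℤ → ℝ} {a : ℝ}
    (hg0 : ∀ c k, 0 ≤ g c k) (hf : ∀ k, f k ≤ ∑ c ∈ S, g c k)
    (hg : ∀ c ∈ S, zs (g c) ≤ ENNReal.ofReal a) :
    zs f ≤ ENNReal.ofReal (S.card * a) := by
  calc zs f ≤ ∑' k, ∑ c ∈ S, ENNReal.ofReal (g c k) := by
        refine ENNReal.tsum_le_tsum fun k => ?_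
        rw [← ENNReal.ofReal_sum_of_nonneg fun c _ => hg0 c k]
        exact ENNReal.ofReal_le_ofReal (hf k)
    _ = ∑ c ∈ S, zs (g c) := by
        rw [Summable.tsum_finsetSum fun _ _ => ENNReal.summable]; rfl
    _ ≤ ∑ c ∈ S, ENNReal.ofReal a := Finset.sum_le_sum hg
    _ = ENNReal.ofReal (S.card * a) := by
        rw [Finset.sum_const, nsmul_eq_mul, ENNReal.ofReal_mul (by positivity)]
        simp

lemma zs_shift (f : ℤ → ℝ) (p : ℤ) : zs (fun k => f (k + p)) = zs f :=
  (Equiv.addRight p).tsum_eq (fun k => ENNReal.ofReal (f k))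

lemma zs_reflect (f : ℤ → ℝ) : zs (fun k => f (-k)) = zs f :=
  (Equiv.neg ℤ).tsum_eq (fun k => ENNReal.ofReal (f k))

lemma rpow_step {x s : ℝ} (hx : 2 ≤ x) (hs : 0 < s) (hs1 : s ≤ 1) :
    s * x ^ (-(1 + s)) ≤ (x - 1) ^ (-s) - x ^ (-s) := by
  have hx0 : 0 < x := by linarith
  have hx1 : 0 < x - 1 := by linarith
  have h1 : (1 + (-(1 / x))) ^ s ≤ 1 + s * (-(1 / x)) := by
    refine rpow_one_add_le_one_add_mul_self ?_ hs.le hs1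
    have : 1 / x ≤ 1 := by rw [div_le_one hx0]; linarith
    linarith
  have h2 : (x - 1) ^ s = x ^ s * (1 + (-(1 / x))) ^ s := by
    rw [← mul_rpow hx0.le]
    · congr 1; field_simp; ring
    · have : 1 / x ≤ 1 := by rw [div_le_one hx0]; linarith
      linarith
  have hxs : 0 < x ^ s := rpow_pos_of_pos hx0 s
  have hys : 0 < (x - 1) ^ s := rpow_pos_of_pos hx1 s
  rw [rpow_neg hx1.le, rpow_neg hx0.le, rpow_neg hx0.le, rpow_add hx0, rpow_one]
  have h3 : (x - 1) ^ s ≤ x ^ s * (1 - s / x) := by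
    have e : s * (-(1 / x)) = -(s / x) := by ring
    rw [h2]; gcongr; linarith
  have h4 : (x^s)⁻¹ * (1 + s / x) ≤ ((x - 1) ^ s)⁻¹ := by
    rw [le_inv_comm₀ (by positivity) hys]
    refine h3.trans ?_
    rw [mul_inv, inv_inv]
    gcongr
    rw [le_inv_comm₀ _ (by positivity), ← one_div, le_div_iff₀]
    · nlinarith [sq_nonneg (s / x)]
    · have : s / x < 1 := by rw [div_lt_one hx0]; linarith
      linarith
    · have : s / x < 1 := by rw [div_lt_one hx0]; linarith
      linarith
  have h5 : s * (x * x ^ s)⁻¹ = (x^s)⁻¹ * (s / x) := by field_simp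
  rw [h5]; linarith

lemma sum_rpow_tail {s : ℝ} (hs : 0 < s) (hs1 : s ≤ 1) (N : ℕ) :
    s * ∑ n ∈ Finset.range N, ((n : ℝ) + 2) ^ (-(1 + s)) ≤ 1 - ((N : ℝ) + 1) ^ (-s) := by
  induction N with
  | zero => simp
  | succ N ih =>
    rw [Finset.sum_range_succ, mul_add]
    have := rpow_step (x := (N : ℝ) + 2) (by linarith [Nat.cast_nonneg (α := ℝ) N]) hs hs1
    have e : (N : ℝ) + 2 - 1 = N + 1 := by ring
    rw [e] at this
    have e2 : ((N + 1 : ℕ) : ℝ) + 1 = N + 2 := by push_cast; ring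
    rw [e2]
    linarith

lemma sum_rpow_tail_le {s : ℝ} (hs : 0 < s) (hs1 : s ≤ 1) (N : ℕ) :
    ∑ n ∈ Finset.range N, ((n : ℝ) + 2) ^ (-(1 + s)) ≤ 1 / s := by
  rw [le_div_iff₀' hs]
  have := sum_rpow_tail hs hs1 N
  have h2 : (0 : ℝ) ≤ ((N : ℝ) + 1) ^ (-s) := by positivity
  linarith

lemma zs_jb_le {s : ℝ} (hs : 0 < s) (hs1 : s ≤ 1) (p : ℤ) :
    zs (fun k => jb (k - p) ^ (-(1 + s))) ≤ ENNReal.ofReal (3 / s) := by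
  have h0 : zs (fun k => jb (k - p) ^ (-(1 + s))) = zs (fun k => jb k ^ (-(1 + s))) :=
    zs_shift (fun k => jb k ^ (-(1 + s))) (-p)
  rw [h0]
  unfold zs
  rw [tsum_of_add_one_of_neg_add_one ENNReal.summable ENNReal.summable]
  have key : ∑' n : ℕ, ENNReal.ofReal (((n : ℝ) + 2) ^ (-(1 + s))) ≤ ENNReal.ofReal (1 / s) := by
    refine ENNReal.tsum_le_of_sum_range_le fun N => ?_
    rw [← ENNReal.ofReal_sum_of_nonneg fun _ _ => by positivity]
    exact ENNReal.ofReal_le_ofReal (sum_rpow_tail_le hs hs1 N)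
  have e1 : ∀ n : ℕ, jb ((n : ℤ) + 1) = (n : ℝ) + 2 := fun n => by
    simp only [jb]; push_cast; rw [abs_of_nonneg (by positivity)]; ring
  have e2 : ∀ n : ℕ, jb (-((n : ℤ) + 1)) = (n : ℝ) + 2 := fun n => by rw [jb_neg, e1]
  have e3 : jb 0 = 1 := by simp [jb]
  simp_rw [e1, e2, e3]
  simp only [one_rpow]
  have hs' : 1 ≤ 1 / s := by rw [le_div_iff₀ hs]; linarith
  calc _ ≤ ENNReal.ofReal (1 / s) + ENNReal.ofReal (1/s) + ENNReal.ofReal (1/s) := by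
        gcongr
    _ = ENNReal.ofReal (3 / s) := by
        rw [← ENNReal.ofReal_add (by positivity) (by positivity),
          ← ENNReal.ofReal_add (by positivity) (by positivity)]
        congr 1; ring

lemma rpow_neg_mul_le {X Y a b t : ℝ} (hX : 1 ≤ X) (hY : 1 ≤ Y) (ha : 0 ≤ a) (hb : 0 ≤ b)
    (ht : t ≤ a + b) : X ^ (-a) * Y ^ (-b) ≤ X ^ (-t) + Y ^ (-t) := by
  have hX0 : 0 < X := by linarith
  have hY0 : 0 < Y := by linarith
  rcases le_total X Y with h | h
  · have h1 : Y ^ (-b) ≤ X ^ (-b) := rpow_le_rpow_of_nonpos hX0 h (by linarith)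
    have h2 : X ^ (-a) * X ^ (-b) = X ^ (-(a + b)) := by rw [← rpow_add hX0]; ring_nf
    have h3 : X ^ (-(a + b)) ≤ X ^ (-t) := rpow_le_rpow_of_exponent_le hX (by linarith)
    have h4 : 0 ≤ Y ^ (-t) := by positivity
    have h5 : X ^ (-a) * Y ^ (-b) ≤ X ^ (-a) * X ^ (-b) := by gcongr
    linarith
  · have h1 : X ^ (-a) ≤ Y ^ (-a) := rpow_le_rpow_of_nonpos hY0 h (by linarith)
    have h2 : Y ^ (-a) * Y ^ (-b) = Y ^ (-(a + b)) := by rw [← rpow_add hY0]; ring_nf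
    have h3 : Y ^ (-(a + b)) ≤ Y ^ (-t) := rpow_le_rpow_of_exponent_le hY (by linarith)
    have h4 : 0 ≤ X ^ (-t) := by positivity
    have h5 : X ^ (-a) * Y ^ (-b) ≤ Y ^ (-a) * Y ^ (-b) := by gcongr
    linarith

lemma zs_jb_mul_jb_le {s a b : ℝ} (hs : 0 < s) (hs1 : s ≤ 1) (ha : 0 ≤ a) (hb : 0 ≤ b)
    (hab : 1 + s ≤ a + b) (p q : ℤ) :
    zs (fun k => jb (k - p) ^ (-a) * jb (k - q) ^ (-b)) ≤ ENNReal.ofReal (6 / s) := by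
  have : 6 / s = 3 / s + 3 / s := by ring
  rw [this]
  exact zs_le_add (by positivity) (by positivity)
    (fun k => rpow_neg_mul_le (one_le_jb _) (one_le_jb _) ha hb hab)
    (zs_jb_le hs hs1 p) (zs_jb_le hs hs1 q)

lemma zs_convolution_le {s γ : ℝ} (hs : 0 < s) (hsγ : s ≤ γ) (hγ : γ < 1) (l : ℤ) :
    zs (fun j => jb j ^ (-γ) * jb (j - l) ^ (-(1:ℝ))) ≤
      ENNReal.ofReal (12 / s * jb l ^ (-γ + s)) := by
  have key : zs (fun j => jb (j - 0) ^ (-s) * jb (j - l) ^ (-(1:ℝ)) +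
      jb (j - 0) ^ (-γ) * jb (j - l) ^ (-(1 - γ + s))) ≤ ENNReal.ofReal (6 / s + 6 / s) :=
    zs_le_add (by positivity) (by positivity) (fun _ => le_rfl)
      (zs_jb_mul_jb_le hs (by linarith) hs.le zero_le_one (by linarith) 0 l)
      (zs_jb_mul_jb_le hs (by linarith) (by linarith) (by linarith) (by linarith) 0 l)
  have e : 12 / s * jb l ^ (-γ + s) = jb l ^ (-γ + s) * (6 / s + 6 / s) := by ring
  rw [e]
  refine zs_le_mul (by have := jb_pos l; positivity) (fun j => ?_) key
  have hl := jb_pos l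
  have hj := jb_pos j
  have hjl := jb_pos (j - l)
  have h1 : jb l ^ (γ - s) ≤ jb j ^ (γ - s) + jb (j - l) ^ (γ - s) :=
    (rpow_le_rpow hl.le (jb_le_add_sub j l) (by linarith)).trans
      (Real.rpow_add_le_add_rpow hj.le hjl.le (by linarith) (by linarith))
  have h2 : jb l ^ (-γ + s) * jb l ^ (γ - s) = 1 := by
    rw [← rpow_add hl]; simp
  simp only [sub_zero]
  have h3 : jb j ^ (-s) = jb j ^ (-γ) * jb j ^ (γ - s) := by rw [← rpow_add hj]; ring_nf
  have h4 : jb (j - l) ^ (-(1 - γ + s)) = jb (j - l) ^ (-(1:ℝ)) * jb (j - l) ^ (γ - s) := by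
    rw [← rpow_add hjl]; ring_nf
  rw [h3, h4]
  calc jb j ^ (-γ) * jb (j - l) ^ (-(1:ℝ))
      = jb j ^ (-γ) * jb (j - l) ^ (-(1:ℝ)) * (jb l ^ (-γ + s) * jb l ^ (γ - s)) := by
        rw [h2, mul_one]
    _ ≤ jb j ^ (-γ) * jb (j - l) ^ (-(1:ℝ)) *
        (jb l ^ (-γ + s) * (jb j ^ (γ - s) + jb (j - l) ^ (γ - s))) := by gcongr
    _ = _ := by ring

/-- The truncation weight `min 1 (L / ⟨k⟩)`. -/
noncomputable def pw (L : ℕ) (k : ℤ) : ℝ := min 1 (L / jb k)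

/-- One-sided resonance weight: inverse distance to the next multiple of `L` below. -/
noncomputable def dwp (L : ℕ) (k : ℤ) : ℝ := 1 / (1 + ((k % (L : ℤ) : ℤ) : ℝ))

/-- The resonance weight, comparable to the inverse distance to `Lℤ`. -/
noncomputable def dw (L : ℕ) (k : ℤ) : ℝ := dwp L k + dwp L (-k)

lemma pw_le_one (L : ℕ) (k : ℤ) : pw L k ≤ 1 := min_le_left _ _

lemma pw_nonneg (L : ℕ) (k : ℤ) : 0 ≤ pw L k :=
  le_min zero_le_one (div_nonneg (Nat.cast_nonneg _) (jb_pos k).le)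

lemma pw_neg (L : ℕ) (k : ℤ) : pw L (-k) = pw L k := by simp [pw, jb_neg]

lemma pw_eq_one {L : ℕ} {k : ℤ} (h : jb k ≤ L) : pw L k = 1 :=
  min_eq_left (by rw [le_div_iff₀ (jb_pos k)]; linarith)

lemma pw_le_rpow {L : ℕ} (hL : 1 ≤ L) {t : ℝ} (ht : 0 ≤ t) (ht1 : t ≤ 1) (k : ℤ) :
    pw L k ≤ (L : ℝ) ^ t * jb k ^ (-t) := by
  have hL' : (1 : ℝ) ≤ L := by exact_mod_cast hL
  have hk := jb_pos k
  rw [rpow_neg hk.le, ← div_eq_mul_inv, ← div_rpow (by linarith) hk.le]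
  rcases le_total 1 ((L : ℝ) / jb k) with h | h
  · exact (min_le_left _ _).trans (one_le_rpow h ht)
  · refine (min_le_right _ _).trans ?_
    nth_rewrite 1 [← rpow_one ((L : ℝ) / jb k)]
    exact rpow_le_rpow_of_exponent_ge (by positivity) h ht1

lemma emod_cast_nonneg {L : ℕ} (hL : 1 ≤ L) (k : ℤ) : (0 : ℝ) ≤ ((k % (L : ℤ) : ℤ) : ℝ) := by
  exact_mod_cast Int.emod_nonneg k (by omega)

lemma dwp_nonneg {L : ℕ} (hL : 1 ≤ L) (k : ℤ) : 0 ≤ dwp L k := by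
  have := emod_cast_nonneg hL k
  unfold dwp; positivity

lemma dw_nonneg {L : ℕ} (hL : 1 ≤ L) (k : ℤ) : 0 ≤ dw L k :=
  add_nonneg (dwp_nonneg hL k) (dwp_nonneg hL _)

lemma dw_neg (L : ℕ) (k : ℤ) : dw L (-k) = dw L k := by
  simp [dw, add_comm]

lemma dw_sub_comm (L : ℕ) (k l : ℤ) : dw L (k - l) = dw L (l - k) := by
  rw [← dw_neg]; congr 1; ring

lemma dw_sub_emod (L : ℕ) (i r : ℤ) : dw L (i - r % L) = dw L (i - r) := by
  unfold dw dwp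
  rw [Int.sub_emod_emod]
  have : -(i - r % L) = r % L - i := by ring
  rw [this, Int.emod_sub_emod]
  have : -(i - r) = r - i := by ring
  rw [this]

lemma dwp_le_sum {L : ℕ} (hL : 1 ≤ L) {k : ℤ} (hk : |k| ≤ 3 * L) :
    dwp L k ≤ ∑ c ∈ Finset.Icc (-4 : ℤ) 4, jb (k - L * c) ^ (-(1:ℝ)) := by
  have hL0 : (0 : ℤ) < L := by exact_mod_cast hL
  have h := abs_le.1 hk
  have hmem : k / L ∈ Finset.Icc (-4 : ℤ) 4 := by
    rw [Finset.mem_Icc]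
    constructor
    · rw [Int.le_ediv_iff_mul_le hL0]; linarith
    · have := (Int.ediv_lt_iff_lt_mul hL0 (a := k) (b := 5)).2 (by linarith)
      omega
  refine le_trans (le_of_eq ?_) (Finset.single_le_sum (f := fun c => jb (k - L * c) ^ (-(1:ℝ)))
    (fun c _ => rpow_nonneg (jb_pos _).le _) hmem)
  have e : k - L * (k / L) = k % L := (Int.emod_def k L).symm
  simp only [e]
  rw [rpow_neg_one, dwp, one_div, jb, abs_of_nonneg (emod_cast_nonneg hL k)]

lemma dw_le_sum {L : ℕ} (hL : 1 ≤ L) {k : ℤ} (hk : |k| ≤ 3 * L) :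
    dw L k ≤ 2 * ∑ c ∈ Finset.Icc (-4 : ℤ) 4, jb (k - L * c) ^ (-(1:ℝ)) := by
  have h1 := dwp_le_sum hL hk
  have h2 := dwp_le_sum hL (k := -k) (by rwa [abs_neg])
  have h3 : ∑ c ∈ Finset.Icc (-4 : ℤ) 4, jb (-k - L * c) ^ (-(1:ℝ)) =
      ∑ c ∈ Finset.Icc (-4 : ℤ) 4, jb (k - L * c) ^ (-(1:ℝ)) := by
    refine Finset.sum_nbij' (fun c => -c) (fun c => -c) ?_ ?_ ?_ ?_ ?_
    · intro c hc; rw [Finset.mem_Icc] at hc ⊢; omega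
    · intro c hc; rw [Finset.mem_Icc] at hc ⊢; omega
    · intro c _; ring
    · intro c _; ring
    · intro c _
      rw [← jb_neg]; congr 2; ring
  rw [h3] at h2
  unfold dw; linarith

lemma sum_inv_le {s : ℝ} (hs : 0 < s) (hs1 : s ≤ 1) (L : ℕ) :
    ∑ r ∈ Finset.range L, 1 / (1 + (r : ℝ)) ≤ 2 / s * (L : ℝ) ^ s := by
  have h1 : ∑ r ∈ Finset.range L, (1 + (r : ℝ)) ^ (-(1 + s)) ≤ 2 / s := by
    rcases L with _ | N
    · simp; positivity
    · rw [Finset.sum_range_succ']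
      have h := sum_rpow_tail_le hs hs1 N
      have h' : (1 : ℝ) ≤ 1 / s := by rw [le_div_iff₀ hs]; linarith
      have e : ∑ k ∈ Finset.range N, (1 + ((k + 1 : ℕ) : ℝ)) ^ (-(1 + s)) =
          ∑ n ∈ Finset.range N, ((n : ℝ) + 2) ^ (-(1 + s)) := by
        refine Finset.sum_congr rfl fun k _ => ?_
        congr 1; push_cast; ring
      rw [e]
      have e2 : (1 + ((0 : ℕ) : ℝ)) ^ (-(1 + s)) = 1 := by simp
      rw [e2]
      have : 2 / s = 1 / s + 1 / s := by ring
      linarith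
  calc ∑ r ∈ Finset.range L, 1 / (1 + (r : ℝ))
      ≤ ∑ r ∈ Finset.range L, (L : ℝ) ^ s * (1 + (r : ℝ)) ^ (-(1 + s)) := by
        refine Finset.sum_le_sum fun r hr => ?_
        have hr' : 1 + (r : ℝ) ≤ L := by
          have := Finset.mem_range.1 hr
          have h2 : 1 + r ≤ L := by omega
          exact_mod_cast h2
        have hpos : (0:ℝ) < 1 + r := by positivity
        have e : 1 / (1 + (r : ℝ)) = (1 + (r : ℝ)) ^ s * (1 + (r : ℝ)) ^ (-(1 + s)) := by
          rw [← rpow_add hpos, one_div, ← rpow_neg_one]; congr 1; ring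
        rw [e]
        gcongr
    _ = (L : ℝ) ^ s * ∑ r ∈ Finset.range L, (1 + (r : ℝ)) ^ (-(1 + s)) := by
        rw [Finset.mul_sum]
    _ ≤ (L : ℝ) ^ s * (2 / s) := by gcongr
    _ = _ := by ring

lemma zs_eq_divMod {L : ℕ} (hL : 1 ≤ L) (f : ℤ → ℝ) :
    zs f = ∑ r ∈ Finset.range L, zs (fun k => f (k * L + r)) := by
  have : NeZero L := ⟨by omega⟩
  unfold zs
  rw [← (Int.divModEquiv L).symm.tsum_eq, ENNReal.tsum_prod', ENNReal.tsum_comm, tsum_fintype,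
    ← Fin.sum_univ_eq_sum_range (fun r => ∑' k : ℤ, ENNReal.ofReal (f (k * L + r)))]
  refine Finset.sum_congr rfl fun r _ => tsum_congr fun k => ?_
  congr 2

/-- Scaled comparison of brackets along a residue class. -/
lemma jb_high_ge {L : ℕ} {k ρ : ℤ} (hρ : 0 ≤ ρ) (hρL : ρ < L)
    (h : (L : ℝ) < jb (k * L + ρ)) : (L : ℝ) / 3 * jb k ≤ jb (k * L + ρ) := by
  have h1 : (L : ℝ) * |(k : ℝ)| ≤ |((k * L + ρ : ℤ) : ℝ)| + L := by
    have h2 : |(k : ℝ) * L| ≤ |(k : ℝ) * L + ρ| + |(ρ : ℝ)| := by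
      have := abs_sub ((k : ℝ) * L + ρ) ρ
      simpa using this
    have h3 : |(ρ : ℝ)| ≤ L := by
      rw [abs_of_nonneg (by exact_mod_cast hρ)]; exact_mod_cast hρL.le
    rw [abs_mul, abs_of_nonneg (Nat.cast_nonneg L : (0:ℝ) ≤ L)] at h2
    push_cast; linarith
  unfold jb at *
  linarith

lemma pw_le_of_scaled {L : ℕ} (hL : 1 ≤ L) {k ρ : ℤ} (hρ : |ρ| ≤ L) :
    pw L (k * L + ρ) ≤ 3 * jb k ^ (-(1:ℝ)) := by
  have hL' : (1 : ℝ) ≤ L := by exact_mod_cast hL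
  have hk := jb_pos k
  rw [rpow_neg_one, ← div_eq_mul_inv, le_div_iff₀ hk]
  by_cases hk1 : |(k : ℝ)| ≤ 2
  · have := pw_le_one L (k * L + ρ)
    have := pw_nonneg L (k * L + ρ)
    have h3 : jb k ≤ 3 := by unfold jb; linarith
    nlinarith
  · push Not at hk1
    have h1 : (L : ℝ) * |(k : ℝ)| ≤ |((k * L + ρ : ℤ) : ℝ)| + L := by
      have h2 : |(k : ℝ) * L| ≤ |(k : ℝ) * L + ρ| + |(ρ : ℝ)| := by
        have := abs_sub ((k : ℝ) * L + ρ) ρ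
        simpa using this
      have h3 : |(ρ : ℝ)| ≤ L := by exact_mod_cast hρ
      rw [abs_mul, abs_of_nonneg (Nat.cast_nonneg L : (0:ℝ) ≤ L)] at h2
      push_cast; linarith
    have hj := jb_pos (k * L + ρ)
    calc pw L (k * L + ρ) * jb k ≤ L / jb (k * L + ρ) * jb k := by
          gcongr; exact min_le_right _ _
      _ ≤ 3 := by
          rw [div_mul_eq_mul_div, div_le_iff₀ hj]
          unfold jb
          nlinarith

/-- The weight summed in the high-frequency lemmas. -/
lemma zs_high_dwp {L : ℕ} (hL : 1 ≤ L) {s γ : ℝ} (hs : 0 < s) (hs1 : s ≤ 1)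
    (hγ : 1 / 2 ≤ γ) (hγ1 : γ < 1) (q r : ℤ) :
    zs (fun i => if (L : ℝ) < jb i then jb i ^ (-γ) * pw L (i - q) * dwp L (i - r) else 0) ≤
      ENNReal.ofReal (216 / s * (L : ℝ) ^ (-γ + s)) := by
  have hL' : (1 : ℝ) ≤ L := by exact_mod_cast hL
  have hL0 : (0 : ℝ) < L := by linarith
  have hLz : (0 : ℤ) < L := by exact_mod_cast hL
  rw [← zs_shift _ r, zs_eq_divMod hL]
  have key : ∀ ρ ∈ Finset.range L,
      zs (fun k => (fun i => if (L : ℝ) < jb (i + r) then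
        jb (i + r) ^ (-γ) * pw L (i + r - q) * dwp L (i + r - r) else 0) (k * L + ρ)) ≤
      ENNReal.ofReal (1 / (1 + (ρ : ℝ)) * (108 * (L : ℝ) ^ (-γ))) := by
    intro ρ hρ
    have hρL : ρ < L := Finset.mem_range.1 hρ
    set r' : ℤ := ((ρ : ℤ) + r) / L with hr'
    set ρ' : ℤ := ((ρ : ℤ) + r) % L with hρ'
    have hsum : (ρ : ℤ) + r = r' * L + ρ' := by
      rw [hr', hρ', mul_comm]; exact (Int.mul_ediv_add_emod _ _).symm
    have hρ'0 : 0 ≤ ρ' := Int.emod_nonneg _ hLz.ne'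
    have hρ'L : ρ' < L := Int.emod_lt_of_pos _ hLz
    set q' : ℤ := q / L
    set σ : ℤ := q % L
    have hq : q = q' * L + σ := by
      rw [mul_comm]; exact (Int.mul_ediv_add_emod _ _).symm
    have hσ0 : 0 ≤ σ := Int.emod_nonneg _ hLz.ne'
    have hσL : σ < L := Int.emod_lt_of_pos _ hLz
    have e1 : 1 / (1 + (ρ : ℝ)) * (108 * (L : ℝ) ^ (-γ)) =
      (1 / (1 + (ρ : ℝ)) * (9 * (L : ℝ) ^ (-γ))) * 12 := by ring
    rw [e1]
    have h12 : (6 : ℝ) / (1 / 2) = 12 := by norm_num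
    refine zs_le_mul (by positivity) (fun k => ?_)
      (h12 ▸ zs_jb_mul_jb_le (s := 1/2) (a := γ) (b := 1) (by norm_num) (by norm_num)
        (by linarith) zero_le_one (by linarith) (-r') (q' - r'))
    have e2 : k * (L : ℤ) + ρ + r = (k - -r') * L + ρ' := by linarith
    have e3 : k * (L : ℤ) + ρ + r - q = (k - (q' - r')) * L + (ρ' - σ) := by linarith
    have e4 : k * (L : ℤ) + ρ + r - r = ρ + k * L := by ring
    have hd : dwp L (k * (L : ℤ) + ρ + r - r) = 1 / (1 + (ρ : ℝ)) := by
      rw [e4, dwp, Int.add_mul_emod_self_right, Int.emod_eq_of_lt (by omega) (by omega)]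
      simp
    have hk0 := jb_pos (k - -r')
    have hk1 := jb_pos (k - (q' - r'))
    simp only
    split_ifs with h
    · rw [hd]
      have hp : pw L (k * (L : ℤ) + ρ + r - q) ≤ 3 * jb (k - (q' - r')) ^ (-(1:ℝ)) := by
        rw [e3]
        exact pw_le_of_scaled hL (by rw [abs_le]; omega)
      have hj : jb (k * (L : ℤ) + ρ + r) ^ (-γ) ≤ 3 * (L : ℝ) ^ (-γ) * jb (k - -r') ^ (-γ) := by
        have h1 : (L : ℝ) / 3 * jb (k - -r') ≤ jb (k * (L : ℤ) + ρ + r) := by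
          rw [e2] at h ⊢; exact jb_high_ge hρ'0 hρ'L h
        refine (rpow_le_rpow_of_nonpos (by positivity) h1 (by linarith)).trans ?_
        rw [mul_rpow (by positivity) hk0.le, div_rpow (by linarith) (by norm_num)]
        gcongr
        rw [div_le_iff₀ (by positivity), mul_comm (3:ℝ), mul_assoc]
        refine le_mul_of_one_le_right (by positivity) ?_
        have : (3:ℝ) ^ (-(1:ℝ)) ≤ 3 ^ (-γ) :=
          rpow_le_rpow_of_exponent_le (by norm_num) (by linarith)
        rw [rpow_neg_one] at this
        linarith
      have := pw_nonneg L (k * (L : ℤ) + ρ + r - q)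
      calc _ ≤ (3 * (L : ℝ) ^ (-γ) * jb (k - -r') ^ (-γ)) * (3 * jb (k - (q' - r')) ^ (-(1:ℝ))) *
            (1 / (1 + (ρ : ℝ))) := by gcongr
        _ = _ := by ring
    · positivity
  refine (Finset.sum_le_sum key).trans ?_
  rw [← ENNReal.ofReal_sum_of_nonneg fun _ _ => by positivity]
  refine ENNReal.ofReal_le_ofReal ?_
  rw [← Finset.sum_mul, rpow_add hL0]
  have := sum_inv_le hs hs1 L
  calc _ ≤ 2 / s * (L : ℝ) ^ s * (108 * (L : ℝ) ^ (-γ)) := by gcongr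
    _ = _ := by ring

lemma zs_high_dw {L : ℕ} (hL : 1 ≤ L) {s γ : ℝ} (hs : 0 < s) (hs1 : s ≤ 1)
    (hγ : 1 / 2 ≤ γ) (hγ1 : γ < 1) (q r : ℤ) :
    zs (fun i => if (L : ℝ) < jb i then jb i ^ (-γ) * pw L (i - q) * dw L (i - r) else 0) ≤
      ENNReal.ofReal (432 / s * (L : ℝ) ^ (-γ + s)) := by
  have e : 432 / s * (L : ℝ) ^ (-γ + s) = 216 / s * (L : ℝ) ^ (-γ + s) +
    216 / s * (L : ℝ) ^ (-γ + s) := by ring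
  rw [e]
  have h1 := zs_high_dwp hL hs hs1 hγ hγ1 q r
  have h2 := zs_high_dwp hL hs hs1 hγ hγ1 (-q) (-r)
  rw [← zs_reflect] at h2
  refine zs_le_add (by positivity) (by positivity) (fun i => ?_) h1 h2
  simp only [jb_neg]
  split_ifs with h
  · have e1 : pw L (-i - -q) = pw L (i - q) := by rw [← pw_neg]; congr 1; ring
    have e2 : -i - -r = -(i - r) := by ring
    rw [e1, e2, dw]
    exact le_of_eq (by ring)
  · simp

/-- Size weight of the defect `φ(A - B) - φ(A)` on the frequency cells `i`, `j`. -/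
noncomputable def inn (L : ℕ) (i j : ℤ) : ℝ :=
  if jb j ≤ L then jb j / L * pw L i else pw L i + pw L (i - j)

/-- The saturating weight `min 1 (⟨l⟩ / L)`. -/
noncomputable def mw (L : ℕ) (l : ℤ) : ℝ := min 1 (jb l / L)

/-- Double sum over the integers of the nonnegative part of a real function. -/
noncomputable def zs2 (F : ℤ → ℤ → ℝ) : ℝ≥0∞ := ∑' j, zs (F j)

lemma mw_nonneg (L : ℕ) (l : ℤ) : 0 ≤ mw L l :=
  le_min zero_le_one (div_nonneg (jb_pos l).le (Nat.cast_nonneg _))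

lemma inn_nonneg (L : ℕ) (i j : ℤ) : 0 ≤ inn L i j := by
  unfold inn
  have := pw_nonneg L i
  have := pw_nonneg L (i - j)
  have := jb_pos j
  split_ifs <;> positivity

lemma zs2_mono {F G : ℤ → ℤ → ℝ} (h : ∀ j i, F j i ≤ G j i) : zs2 F ≤ zs2 G :=
  ENNReal.tsum_le_tsum fun j => zs_mono (h j)

lemma zs2_swap (F : ℤ → ℤ → ℝ) : zs2 F = zs2 fun i j => F j i := ENNReal.tsum_comm

lemma zs2_le_mul {F G : ℤ → ℤ → ℝ} {c a : ℝ} (hc : 0 ≤ c) (h : ∀ j i, F j i ≤ c * G j i)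
    (hG : zs2 G ≤ ENNReal.ofReal a) : zs2 F ≤ ENNReal.ofReal (c * a) := by
  refine (zs2_mono h).trans ?_
  unfold zs2 at *
  simp_rw [zs_mul hc]
  rw [ENNReal.tsum_mul_left, ENNReal.ofReal_mul hc]
  gcongr

lemma zs2_le_add {F G H : ℤ → ℤ → ℝ} {a b : ℝ} (ha : 0 ≤ a) (hb : 0 ≤ b)
    (hf : ∀ j i, F j i ≤ G j i + H j i)
    (hg : zs2 G ≤ ENNReal.ofReal a) (hh : zs2 H ≤ ENNReal.ofReal b) :
    zs2 F ≤ ENNReal.ofReal (a + b) := by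
  rw [ENNReal.ofReal_add ha hb]
  refine le_trans ?_ (add_le_add hg hh)
  unfold zs2 zs
  rw [← ENNReal.tsum_add]
  refine ENNReal.tsum_le_tsum fun j => ?_
  rw [← ENNReal.tsum_add]
  exact ENNReal.tsum_le_tsum fun i =>
    (ENNReal.ofReal_le_ofReal (hf j i)).trans ENNReal.ofReal_add_le

lemma zs2_sum_le {ι : Type*} (S : Finset ι) {F : ℤ → ℤ → ℝ} {G : ι → ℤ → ℤ → ℝ} {a : ℝ}
    (hG0 : ∀ c j i, 0 ≤ G c j i) (hf : ∀ j i, F j i ≤ ∑ c ∈ S, G c j i)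
    (hg : ∀ c ∈ S, zs2 (G c) ≤ ENNReal.ofReal a) :
    zs2 F ≤ ENNReal.ofReal (S.card * a) := by
  calc zs2 F ≤ ∑' j, ∑ c ∈ S, zs (G c j) := by
        refine ENNReal.tsum_le_tsum fun j => ?_
        calc zs (F j) ≤ ∑' k, ∑ c ∈ S, ENNReal.ofReal (G c j k) := by
              refine ENNReal.tsum_le_tsum fun k => ?_
              rw [← ENNReal.ofReal_sum_of_nonneg fun c _ => hG0 c j k]
              exact ENNReal.ofReal_le_ofReal (hf j k)
          _ = ∑ c ∈ S, zs (G c j) := by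
              rw [Summable.tsum_finsetSum fun _ _ => ENNReal.summable]; rfl
    _ = ∑ c ∈ S, zs2 (G c) := by
        rw [Summable.tsum_finsetSum fun _ _ => ENNReal.summable]; rfl
    _ ≤ ∑ c ∈ S, ENNReal.ofReal a := Finset.sum_le_sum hg
    _ = ENNReal.ofReal (S.card * a) := by
        rw [Finset.sum_const, nsmul_eq_mul, ENNReal.ofReal_mul (by positivity)]
        simp

lemma tsum_le_of_zs {F : ℤ → ℝ≥0∞} {g : ℤ → ℝ} {c a : ℝ} (hc : 0 ≤ c)
    (h : ∀ j, F j ≤ ENNReal.ofReal (c * g j)) (hg : zs g ≤ ENNReal.ofReal a) :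
    ∑' j, F j ≤ ENNReal.ofReal (c * a) := by
  refine (ENNReal.tsum_le_tsum h).trans ?_
  have := zs_mul (f := g) hc
  unfold zs at this
  rw [this, ENNReal.ofReal_mul hc]
  gcongr
  exact hg

lemma zs2_le_of_inner {F : ℤ → ℤ → ℝ} {g : ℤ → ℝ} {c a : ℝ} (hc : 0 ≤ c)
    (h : ∀ j, zs (F j) ≤ ENNReal.ofReal (c * g j)) (hg : zs g ≤ ENNReal.ofReal a) :
    zs2 F ≤ ENNReal.ofReal (c * a) :=
  tsum_le_of_zs hc h hg

lemma card_shifts : ((Finset.Icc (-4 : ℤ) 4).card : ℝ) = 9 := by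
  have : (Finset.Icc (-4 : ℤ) 4).card = 9 := by decide
  rw [this]; norm_num

/-- Parameters of the weighted sums: `γ` is the decay rate of the cell measure and
`s` the room left for logarithmic sums. -/
structure Params (γ s : ℝ) : Prop where
  half_le : 1 / 2 ≤ γ
  lt_one : γ < 1
  s_pos : 0 < s
  s_le : s ≤ 1 / 4
  gap : γ ≤ 1 / 2 + s

section
variable {γ s : ℝ} (h : Params γ s) {L : ℕ} (hL : 1 ≤ L)
include h hL

lemma zs_pw_dw (q r : ℤ) :
    zs (fun i => jb i ^ (-γ) * (pw L (i - q) * dw L (i - r))) ≤ ENNReal.ofReal 1944 := by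
  have hL' : (1 : ℝ) ≤ L := by exact_mod_cast hL
  have hLz : (0 : ℤ) < L := by exact_mod_cast hL
  have hγ := h.half_le
  have e : (1944 : ℝ) = 1728 + 216 := by norm_num
  rw [e]
  have hhigh : zs (fun i => if (L : ℝ) < jb i then
      jb i ^ (-γ) * pw L (i - q) * dw L (i - r) else 0) ≤ ENNReal.ofReal 1728 := by
    refine (zs_high_dw hL (s := 1/4) (by norm_num) (by norm_num) hγ h.lt_one q r).trans
      (ENNReal.ofReal_le_ofReal ?_)
    have : (L : ℝ) ^ (-γ + 1 / 4) ≤ 1 := rpow_le_one_of_one_le_of_nonpos hL' (by linarith)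
    linarith
  have hlow : zs (fun i => if jb i ≤ (L : ℝ) then
      jb i ^ (-γ) * pw L (i - q) * dw L (i - r) else 0) ≤ ENNReal.ofReal 216 := by
    have hc : (216 : ℝ) = (Finset.Icc (-4 : ℤ) 4).card * (2 * 12) := by
      rw [card_shifts]; norm_num
    rw [hc]
    refine zs_sum_le (Finset.Icc (-4 : ℤ) 4)
      (g := fun c i => 2 * (jb (i - 0) ^ (-γ) * jb (i - (r % L + L * c)) ^ (-(1:ℝ))))
      (fun c k => by have := jb_pos (k - 0); have := jb_pos (k - (r % L + L * c)); positivity)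
      (fun i => ?_) (fun c _ => ?_)
    · have hi := jb_pos i
      simp only [sub_zero]
      split_ifs with hl
      · have hil : |i| ≤ L := by
          have : |(i : ℝ)| ≤ L := by unfold jb at hl; linarith
          exact_mod_cast this
        have hr0 : 0 ≤ r % L := Int.emod_nonneg _ hLz.ne'
        have hrL : r % L < L := Int.emod_lt_of_pos _ hLz
        have hd := dw_le_sum hL (k := i - r % L) (by
          rw [abs_le] at hil ⊢; omega)
        rw [dw_sub_emod] at hd
        have hp := pw_le_one L (i - q)
        have hp0 := pw_nonneg L (i - q)
        have hd0 := dw_nonneg hL (i - r)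
        calc jb i ^ (-γ) * pw L (i - q) * dw L (i - r)
            ≤ jb i ^ (-γ) * 1 *
              (2 * ∑ c ∈ Finset.Icc (-4 : ℤ) 4, jb (i - r % L - L * c) ^ (-(1:ℝ))) := by gcongr
          _ = _ := by
              rw [mul_one, Finset.mul_sum, Finset.mul_sum]
              refine Finset.sum_congr rfl fun c _ => ?_
              rw [sub_sub]; ring
      · refine Finset.sum_nonneg fun c _ => ?_
        have := jb_pos (i - (r % L + L * c)); positivity
    · refine zs_le_mul (by norm_num) (fun _ => le_rfl) ?_
      have h12 : (6 : ℝ) / (1 / 2) = 12 := by norm_num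
      rw [← h12]
      exact zs_jb_mul_jb_le (by norm_num) (by norm_num) (by linarith) zero_le_one (by linarith) _ _
  refine zs_le_add (by norm_num) (by norm_num) (fun i => ?_) hhigh hlow
  rw [← mul_assoc]
  by_cases hl : jb i ≤ L
  · simp [hl, not_lt.2 hl]
  · simp [hl, not_le.1 hl]

lemma zs_inn_dw (l r : ℤ) :
    zs (fun i => jb i ^ (-γ) * (inn L i l * dw L (i - r))) ≤ ENNReal.ofReal (3888 * mw L l) := by
  have hL' : (1 : ℝ) ≤ L := by exact_mod_cast hL
  have hl0 := jb_pos l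
  have h0 := zs_pw_dw h hL 0 r
  have hl := zs_pw_dw h hL l r
  simp only [sub_zero] at h0
  unfold inn mw
  split_ifs with hc
  · have hm : min 1 (jb l / L) = jb l / L := min_eq_right (by rw [div_le_one (by linarith)]; exact hc)
    rw [hm]
    refine (zs_le_mul (c := jb l / L) (by positivity) (fun i => ?_) h0).trans
      (ENNReal.ofReal_le_ofReal ?_)
    · exact le_of_eq (by ring)
    · have : 0 ≤ jb l / L := by positivity
      linarith
  · have hm : min 1 (jb l / L) = 1 := min_eq_left (by rw [one_le_div (by linarith)]; linarith)
    rw [hm]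
    have e : (3888 : ℝ) * 1 = 1944 + 1944 := by norm_num
    rw [e]
    exact zs_le_add (by norm_num) (by norm_num) (fun i => le_of_eq (by ring)) h0 hl

lemma zs_pw (q : ℤ) :
    zs (fun i => jb i ^ (-γ) * pw L (i - q)) ≤ ENNReal.ofReal (6 / s * (L : ℝ) ^ (1 - γ + s)) := by
  obtain ⟨h1, h2, h3, h4, h5⟩ := h
  have e : 6 / s * (L : ℝ) ^ (1 - γ + s) = (L : ℝ) ^ (1 - γ + s) * (6 / s) := by ring
  rw [e]
  refine zs_le_mul (by positivity) (fun i => ?_)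
    (zs_jb_mul_jb_le h3 (by linarith) (a := γ) (b := 1 - γ + s) (by linarith) (by linarith)
      (by linarith) 0 q)
  have := pw_le_rpow hL (t := 1 - γ + s) (by linarith) (by linarith) (i - q)
  have hi := jb_pos i
  simp only [sub_zero]
  calc _ ≤ jb i ^ (-γ) * ((L : ℝ) ^ (1 - γ + s) * jb (i - q) ^ (-(1 - γ + s))) := by gcongr
    _ = _ := by ring

lemma mw_le_rpow (l : ℤ) :
    mw L l ≤ (L : ℝ) ^ (2 * s - 2 * γ) * jb l ^ (2 * γ - 2 * s) := by
  obtain ⟨h1, h2, h3, h4, h5⟩ := h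
  have hL' : (1 : ℝ) ≤ L := by exact_mod_cast hL
  have hL0 : (0 : ℝ) < L := by linarith
  have hl := jb_pos l
  have e : (L : ℝ) ^ (2 * s - 2 * γ) * jb l ^ (2 * γ - 2 * s) = (jb l / L) ^ (2 * γ - 2 * s) := by
    rw [div_rpow hl.le hL0.le, div_eq_inv_mul, ← rpow_neg hL0.le]; ring_nf
  rw [e]
  rcases le_total 1 (jb l / L) with hc | hc
  · exact (min_le_left _ _).trans (one_le_rpow hc (by linarith))
  · refine (min_le_right _ _).trans ?_
    nth_rewrite 1 [← rpow_one (jb l / L)]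
    exact rpow_le_rpow_of_exponent_ge (by positivity) hc (by linarith)

lemma zs_mw_jb (n : ℤ) :
    zs (fun l => jb l ^ (-γ) * jb l ^ (-γ + s) * (mw L l * jb (l - n) ^ (-(1:ℝ)))) ≤
      ENNReal.ofReal (6 / s * (L : ℝ) ^ (2 * s - 2 * γ)) := by
  have hm := mw_le_rpow h hL
  obtain ⟨h1, h2, h3, h4, h5⟩ := h
  have e : 6 / s * (L : ℝ) ^ (2 * s - 2 * γ) = (L : ℝ) ^ (2 * s - 2 * γ) * (6 / s) := by ring
  rw [e]
  refine zs_le_mul (by positivity) (fun l => ?_)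
    (zs_jb_mul_jb_le h3 (by linarith) (a := s) (b := 1) h3.le zero_le_one (by linarith) 0 n)
  have hl := jb_pos l
  have hln := jb_pos (l - n)
  simp only [sub_zero]
  calc _ ≤ jb l ^ (-γ) * jb l ^ (-γ + s) *
        ((L : ℝ) ^ (2 * s - 2 * γ) * jb l ^ (2 * γ - 2 * s) * jb (l - n) ^ (-(1:ℝ))) := by
        gcongr; exact hm l
    _ = (L : ℝ) ^ (2 * s - 2 * γ) *
        ((jb l ^ (-γ) * jb l ^ (-γ + s) * jb l ^ (2 * γ - 2 * s)) * jb (l - n) ^ (-(1:ℝ))) := by ring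
    _ = _ := by
        rw [← rpow_add hl, ← rpow_add hl]; ring_nf

lemma zs_low_low (c : ℤ) :
    zs2 (fun j i => if jb j ≤ (L : ℝ) then
      jb j ^ (-γ) * (jb i ^ (-γ) * jb (i - (j + L * c)) ^ (-(1:ℝ))) else 0) ≤
      ENNReal.ofReal (12 / s * (6 / s * (L : ℝ) ^ (1 - 2 * γ + 2 * s))) := by
  obtain ⟨h1, h2, h3, h4, h5⟩ := h
  have hL' : (1 : ℝ) ≤ L := by exact_mod_cast hL
  refine zs2_le_of_inner (by positivity)
    (g := fun j => if jb j ≤ (L : ℝ) then jb j ^ (-γ) * jb (j + L * c) ^ (-γ + s) else 0)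
    (fun j => ?_) ?_
  · have hj := jb_pos j
    split_ifs with hc
    · have e : 12 / s * (jb j ^ (-γ) * jb (j + L * c) ^ (-γ + s)) =
        jb j ^ (-γ) * (12 / s * jb (j + L * c) ^ (-γ + s)) := by ring
      rw [e]
      exact zs_le_mul (by positivity) (fun _ => le_rfl)
        (zs_convolution_le h3 (by linarith) h2 (j + L * c))
    · simp [zs]
  · have e : 6 / s * (L : ℝ) ^ (1 - 2 * γ + 2 * s) =
      (L : ℝ) ^ (1 - 2 * γ + 2 * s) * (6 / s) := by ring
    rw [e]
    refine zs_le_mul (by positivity) (fun j => ?_)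
      (zs_jb_mul_jb_le h3 (by linarith) (a := γ + (1 - 2 * γ + 2 * s)) (b := γ - s)
        (by linarith) (by linarith) (by linarith) 0 (-(L * c)))
    have hj := jb_pos j
    have hjc := jb_pos (j + L * c)
    simp only [sub_zero, sub_neg_eq_add]
    split_ifs with hc
    · have e1 : jb j ^ (-(γ + (1 - 2 * γ + 2 * s))) =
        jb j ^ (-γ) * jb j ^ (-(1 - 2 * γ + 2 * s)) := by rw [← rpow_add hj]; ring_nf
      have e2 : -(γ - s) = -γ + s := by ring
      rw [e1, e2]
      have h6 : 1 ≤ (L : ℝ) ^ (1 - 2 * γ + 2 * s) * jb j ^ (-(1 - 2 * γ + 2 * s)) := by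
        rw [rpow_neg hj.le, ← div_eq_mul_inv, one_le_div (by positivity)]
        exact rpow_le_rpow hj.le hc (by linarith)
      calc jb j ^ (-γ) * jb (j + L * c) ^ (-γ + s)
          ≤ ((L : ℝ) ^ (1 - 2 * γ + 2 * s) * jb j ^ (-(1 - 2 * γ + 2 * s))) *
            (jb j ^ (-γ) * jb (j + L * c) ^ (-γ + s)) :=
            le_mul_of_one_le_left (by positivity) h6
        _ = _ := by ring
    · positivity

lemma zs2_pw_high (q : ℤ → ℤ) :
    zs2 (fun j i => if (L : ℝ) < jb i then
      jb j ^ (-γ) * pw L j * (jb i ^ (-γ) * pw L (i - q j) * dw L (i - j)) else 0) ≤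
      ENNReal.ofReal (432 / s * (L : ℝ) ^ (-γ + s) * (6 / s * (L : ℝ) ^ (1 - γ + s))) := by
  have h0 := zs_pw h hL 0
  obtain ⟨h1, h2, h3, h4, h5⟩ := h
  simp only [sub_zero] at h0
  refine zs2_le_of_inner (by positivity) (fun j => ?_) h0
  have hj := jb_pos j
  have hp := pw_nonneg L j
  rw [mul_comm (432 / s * (L : ℝ) ^ (-γ + s))]
  refine zs_le_mul (by positivity) (fun i => ?_)
    (zs_high_dw hL h3 (by linarith) h1 h2 (q j) j)
  split_ifs <;> simp

/-- The resonant double sum. -/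
lemma zs2_resonant :
    zs2 (fun j i => jb i ^ (-γ) * (jb j ^ (-γ) * (jb j)⁻¹ * (inn L i j * dw L (i - j)))) ≤
      ENNReal.ofReal (11664 / s ^ 2 * (L : ℝ) ^ (2 * s - 2 * γ)) := by
  have hL' : (1 : ℝ) ≤ L := by exact_mod_cast hL
  have hL0 : (0 : ℝ) < L := by linarith
  have hA := zs2_pw_high h hL (fun _ => 0)
  have hB := zs2_pw_high h hL (fun j => j)
  have hLL : zs2 (fun j i => if jb j ≤ (L : ℝ) then (if jb i ≤ (L : ℝ) then
      jb j ^ (-γ) * (jb i ^ (-γ) * dw L (i - j)) else 0) else 0) ≤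
      ENNReal.ofReal ((Finset.Icc (-4 : ℤ) 4).card *
        (2 * (12 / s * (6 / s * (L : ℝ) ^ (1 - 2 * γ + 2 * s))))) := by
    refine zs2_sum_le (Finset.Icc (-4 : ℤ) 4)
      (G := fun c j i => 2 * if jb j ≤ (L : ℝ) then
        jb j ^ (-γ) * (jb i ^ (-γ) * jb (i - (j + L * c)) ^ (-(1:ℝ))) else 0)
      (fun c j i => ?_) (fun j i => ?_)
      (fun c _ => zs2_le_mul (by norm_num) (fun _ _ => le_rfl) (zs_low_low h hL c))
    · have := jb_pos i
      have := jb_pos j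
      have := jb_pos (i - (j + L * c))
      split_ifs <;> positivity
    · have hi := jb_pos i
      have hj := jb_pos j
      split_ifs with h1 h2
      · have hi' : |i| ≤ L := by
          have : |(i : ℝ)| ≤ L := by unfold jb at h2; linarith
          exact_mod_cast this
        have hj' : |j| ≤ L := by
          have : |(j : ℝ)| ≤ L := by unfold jb at h1; linarith
          exact_mod_cast this
        have hd := dw_le_sum hL (k := i - j) (by
          rw [abs_le] at hi' hj' ⊢; omega)
        calc jb j ^ (-γ) * (jb i ^ (-γ) * dw L (i - j)) ≤
            jb j ^ (-γ) * (jb i ^ (-γ) *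
              (2 * ∑ c ∈ Finset.Icc (-4 : ℤ) 4, jb (i - j - L * c) ^ (-(1:ℝ)))) := by gcongr
          _ = _ := by
              simp only [Finset.mul_sum]
              refine Finset.sum_congr rfl fun c _ => ?_
              rw [sub_sub]; ring
      · refine Finset.sum_nonneg fun c _ => ?_
        have := jb_pos (i - (j + L * c)); positivity
      · simp
  obtain ⟨h1, h2, h3, h4, h5⟩ := h
  have eA : 432 / s * (L : ℝ) ^ (-γ + s) * (6 / s * (L : ℝ) ^ (1 - γ + s)) =
      2592 / s ^ 2 * (L : ℝ) ^ (1 - 2 * γ + 2 * s) := by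
    have : (L : ℝ) ^ (1 - 2 * γ + 2 * s) = (L : ℝ) ^ (-γ + s) * (L : ℝ) ^ (1 - γ + s) := by
      rw [← rpow_add hL0]; ring_nf
    rw [this]; field_simp; ring
  rw [eA] at hA hB
  have eL : ((Finset.Icc (-4 : ℤ) 4).card : ℝ) *
      (2 * (12 / s * (6 / s * (L : ℝ) ^ (1 - 2 * γ + 2 * s)))) =
      1296 / s ^ 2 * (L : ℝ) ^ (1 - 2 * γ + 2 * s) := by
    rw [card_shifts]; field_simp; norm_num
  rw [eL] at hLL
  have hA' := hA
  rw [zs2_swap] at hA'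
  set X := (L : ℝ) ^ (1 - 2 * γ + 2 * s) with hX
  have hX0 : 0 ≤ X := by positivity
  have eX : 11664 / s ^ 2 * (L : ℝ) ^ (2 * s - 2 * γ) =
      1 / L * (1296 / s ^ 2 * X + (2592 / s ^ 2 * X + (2592 / s ^ 2 * X +
        (2 * (2592 / s ^ 2 * X))))) := by
    have : (L : ℝ) ^ (2 * s - 2 * γ) = 1 / L * X := by
      rw [hX, one_div, ← rpow_neg_one, ← rpow_add hL0]; ring_nf
    rw [this]; ring
  rw [eX]
  have hA2 := zs2_le_mul (c := 2) (by norm_num) (fun _ _ => le_rfl) hA'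
  have step1 := zs2_le_add (by positivity) (by positivity) (fun _ _ => le_rfl) hB hA2
  have step2 := zs2_le_add (by positivity) (by positivity) (fun _ _ => le_rfl) hA step1
  have step3 := zs2_le_add (by positivity) (by positivity) (fun _ _ => le_rfl) hLL step2
  refine zs2_le_mul (by positivity) (fun j i => ?_) step3
  have hi := jb_pos i
  have hj := jb_pos j
  have hd := dw_nonneg hL (i - j)
  have hpi := pw_nonneg L i
  have hpj := pw_nonneg L j
  have hpij := pw_nonneg L (i - j)
  have hdc : dw L (j - i) = dw L (i - j) := dw_sub_comm L j i
  have hg1 : 0 ≤ jb i ^ (-γ) := by positivity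
  have hg2 : 0 ≤ jb j ^ (-γ) := by positivity
  simp only [sub_zero, hdc]
  unfold inn
  by_cases cj : jb j ≤ L
  · have ej : (jb j)⁻¹ * (jb j / L * pw L i * dw L (i - j)) = 1 / L * (pw L i * dw L (i - j)) := by
      field_simp
    rw [if_pos cj, if_pos cj]
    have e0 : jb i ^ (-γ) * (jb j ^ (-γ) * (jb j)⁻¹ * (jb j / L * pw L i * dw L (i - j))) =
      1 / L * (jb j ^ (-γ) * (jb i ^ (-γ) * (pw L i * dw L (i - j)))) := by
      rw [mul_assoc (jb j ^ (-γ)), ej]; ring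
    rw [e0]
    refine mul_le_mul_of_nonneg_left ?_ (by positivity)
    rw [if_neg (not_lt.2 cj)]
    by_cases ci : jb i ≤ L
    · rw [if_pos ci, if_neg (not_lt.2 ci), if_neg (not_lt.2 ci), pw_eq_one ci]
      simp
    · push Not at ci
      rw [if_neg (not_le.2 ci), if_pos ci, if_pos ci, pw_eq_one cj]
      have : 0 ≤ jb j ^ (-γ) * 1 * (jb i ^ (-γ) * pw L (i - j) * dw L (i - j)) := by positivity
      linarith
  · rw [if_neg cj, if_neg cj]
    push Not at cj
    have epj : (jb j)⁻¹ = 1 / L * pw L j := by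
      rw [pw, min_eq_right]
      · field_simp
      · rw [div_le_one hj]; exact cj.le
    rw [epj]
    have e0 : jb i ^ (-γ) * (jb j ^ (-γ) * (1 / L * pw L j) *
        ((pw L i + pw L (i - j)) * dw L (i - j))) =
      1 / L * (jb i ^ (-γ) * pw L i * (jb j ^ (-γ) * pw L j * dw L (i - j)) +
        jb j ^ (-γ) * pw L j * (jb i ^ (-γ) * pw L (i - j) * dw L (i - j))) := by ring
    rw [e0]
    refine mul_le_mul_of_nonneg_left ?_ (by positivity)
    rw [if_pos cj]
    by_cases ci : jb i ≤ L
    · rw [if_neg (not_lt.2 ci), if_neg (not_lt.2 ci), pw_eq_one ci]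
      have : jb j ^ (-γ) * pw L j * (jb i ^ (-γ) * pw L (i - j) * dw L (i - j)) ≤
        jb j ^ (-γ) * pw L j * (jb i ^ (-γ) * 1 * dw L (i - j)) := by
        gcongr; exact pw_le_one _ _
      linarith
    · push Not at ci
      rw [if_pos ci, if_pos ci]
      have : 0 ≤ jb i ^ (-γ) * pw L i * (jb j ^ (-γ) * pw L j * dw L (i - j)) := by positivity
      have : 0 ≤ jb j ^ (-γ) * pw L j * (jb i ^ (-γ) * pw L i * dw L (i - j)) := by positivity
      linarith
end

section
variable {γ s : ℝ} (h : Params γ s) {L : ℕ} (hL : 1 ≤ L)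
include h

lemma zs_jb_inv (l : ℤ) : zs (fun j => jb j ^ (-γ) * (jb (j - l))⁻¹) ≤ ENNReal.ofReal 12 := by
  obtain ⟨h1, h2, h3, h4, h5⟩ := h
  have h12 : (6 : ℝ) / (1 / 2) = 12 := by norm_num
  have := zs_jb_mul_jb_le (s := 1/2) (a := γ) (b := 1) (by norm_num) (by norm_num)
    (by linarith) zero_le_one (by linarith) 0 l
  rw [h12] at this
  simpa [rpow_neg_one] using this

lemma zs_jb_inv_decay (l : ℤ) : zs (fun j => jb j ^ (-γ) * (jb (j - l))⁻¹) ≤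
    ENNReal.ofReal (12 / s * jb l ^ (-γ + s)) := by
  obtain ⟨h1, h2, h3, h4, h5⟩ := h
  simpa [rpow_neg_one] using zs_convolution_le h3 (by linarith) h2 l

include hL

lemma zs2_source_outer (l : ℤ) :
    zs2 (fun j i => jb i ^ (-γ) * (jb j ^ (-γ) * ((jb (j - l))⁻¹ *
      (inn L i l * dw L (i - l))))) ≤ ENNReal.ofReal (46656 * (jb l / L)) := by
  have hm := mw_nonneg L l
  have : zs2 (fun j i => jb i ^ (-γ) * (jb j ^ (-γ) * ((jb (j - l))⁻¹ *
      (inn L i l * dw L (i - l))))) ≤ ENNReal.ofReal (3888 * mw L l * 12) := by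
    refine zs2_le_of_inner (by positivity) (fun j => ?_) (zs_jb_inv h l)
    have := jb_pos j
    have := jb_pos (j - l)
    rw [mul_comm (3888 * mw L l)]
    exact zs_le_mul (by positivity) (fun i => le_of_eq (by ring)) (zs_inn_dw h hL l l)
  refine this.trans (ENNReal.ofReal_le_ofReal ?_)
  have : mw L l ≤ jb l / L := min_le_right _ _
  linarith

lemma zs2_source_inner (l : ℤ) :
    zs2 (fun j i => jb i ^ (-γ) * (jb j ^ (-γ) * ((jb (j - l))⁻¹ *
      (inn L i j * dw L (i - j))))) ≤
      ENNReal.ofReal (jb l * (11664 / s ^ 2 * (L : ℝ) ^ (2 * s - 2 * γ))) := by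
  refine zs2_le_mul (jb_pos l).le (fun j i => ?_) (zs2_resonant h hL)
  have h1 := jb_pos j
  have h2 := jb_pos i
  have h3 := jb_pos l
  have h4 := jb_pos (j - l)
  have h5 := inn_nonneg L i j
  have h6 := dw_nonneg hL (i - j)
  have h7 : (jb (j - l))⁻¹ ≤ jb l * (jb j)⁻¹ := by
    rw [← div_eq_mul_inv, inv_le_comm₀ h4 (by positivity), inv_div, div_le_iff₀ h3, mul_comm]
    exact jb_le_mul_sub j l
  calc _ ≤ jb i ^ (-γ) * (jb j ^ (-γ) * (jb l * (jb j)⁻¹ *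
      (inn L i j * dw L (i - j)))) := by gcongr
    _ = _ := by ring

lemma zs2_near (l : ℤ) :
    zs2 (fun j i => jb i ^ (-γ) * (jb j ^ (-γ) * ((jb (j - l))⁻¹ *
      (pw L (i - j) * dw L (i - l))))) ≤ ENNReal.ofReal (1944 * 12) := by
  refine zs2_le_of_inner (by norm_num) (fun j => ?_) (zs_jb_inv h l)
  have := jb_pos j
  have := jb_pos (j - l)
  rw [mul_comm (1944 : ℝ)]
  exact zs_le_mul (by positivity) (fun i => le_of_eq (by ring)) (zs_pw_dw h hL j l)

lemma zs3_outer (n : ℤ) (r : ℤ → ℤ) :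
    ∑' l, zs2 (fun j i => jb i ^ (-γ) * (jb j ^ (-γ) * (jb l ^ (-γ) *
      ((jb (j - l))⁻¹ * (jb (l - n))⁻¹ * (inn L i l * dw L (i - r l)))))) ≤
      ENNReal.ofReal (3888 * (12 / s) * (6 / s * (L : ℝ) ^ (2 * s - 2 * γ))) := by
  have hs := h.s_pos
  refine tsum_le_of_zs (by positivity) (fun l => ?_) (zs_mw_jb h hL n)
  have hl := jb_pos l
  have hln := jb_pos (l - n)
  have hm := mw_nonneg L l
  have e : 3888 * (12 / s) * (jb l ^ (-γ) * jb l ^ (-γ + s) * (mw L l * jb (l - n) ^ (-(1:ℝ)))) =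
    3888 * mw L l * (jb l ^ (-γ) * (jb (l - n))⁻¹) * (12 / s * jb l ^ (-γ + s)) := by
    rw [rpow_neg_one]; ring
  rw [e]
  refine zs2_le_of_inner (by positivity) (fun j => ?_) (zs_jb_inv_decay h l)
  have hj := jb_pos j
  have hjl := jb_pos (j - l)
  have e2 : 3888 * mw L l * (jb l ^ (-γ) * (jb (l - n))⁻¹) * (jb j ^ (-γ) * (jb (j - l))⁻¹) =
    jb l ^ (-γ) * (jb (l - n))⁻¹ * (jb j ^ (-γ) * (jb (j - l))⁻¹) * (3888 * mw L l) := by ring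
  rw [e2]
  exact zs_le_mul (by positivity) (fun i => le_of_eq (by ring)) (zs_inn_dw h hL l (r l))

lemma zs3_inner (n : ℤ) (r : ℤ → ℤ) :
    ∑' l, zs2 (fun j i => jb i ^ (-γ) * (jb j ^ (-γ) * (jb l ^ (-γ) *
      ((jb (j - l))⁻¹ * (jb (j - n))⁻¹ * (inn L i j * dw L (i - r j)))))) ≤
      ENNReal.ofReal (3888 * (12 / s) * (6 / s * (L : ℝ) ^ (2 * s - 2 * γ))) := by
  refine le_trans (le_of_eq ?_) (zs3_outer h hL n r)
  unfold zs2
  rw [ENNReal.tsum_comm]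
  refine tsum_congr fun j => tsum_congr fun l => congrArg zs (funext fun i => ?_)
  simp only [jb_sub_comm j l]; ring
end

lemma P_neg (κ : ℕ) (d : ℕ → ℝ) (y : ℝ) : P κ d (-y) = (-1) ^ κ * P κ d y := by
  unfold P
  rw [Finset.mul_sum]
  refine Finset.sum_congr rfl fun j hj => ?_
  have hj' := Finset.mem_range.1 hj
  have e : (-1 : ℝ) ^ κ = (-1) ^ (κ - 2 * j) := by
    conv_lhs => rw [show κ = (κ - 2 * j) + 2 * j by omega]
    rw [pow_add, pow_mul]; simp
  rw [neg_pow, e]; ring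

/-- Size of the lower-order coefficients of the symbol. -/
noncomputable def lowerCoeff (κ : ℕ) (d : ℕ → ℝ) : ℝ :=
  ∑ j ∈ Finset.range ((κ + 1) / 2 - 1), |d (κ - 2 * (j + 1))|

lemma lowerCoeff_nonneg (κ : ℕ) (d : ℕ → ℝ) : 0 ≤ lowerCoeff κ d :=
  Finset.sum_nonneg fun _ _ => abs_nonneg _

lemma P_eq {κ : ℕ} (hκ : 2 ≤ κ) {d : ℕ → ℝ} (hd : d κ = 1) (y : ℝ) :
    P κ d y = y ^ κ + ∑ j ∈ Finset.range ((κ + 1) / 2 - 1),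
      d (κ - 2 * (j + 1)) * y ^ (κ - 2 * (j + 1)) := by
  unfold P
  have e : (κ + 1) / 2 = ((κ + 1) / 2 - 1) + 1 := by omega
  rw [e, Finset.sum_range_succ']
  simp [hd]; ring

lemma P_sub_ge {κ : ℕ} (hκ : 2 ≤ κ) {d : ℕ → ℝ} (hd : d κ = 1) {x y : ℝ}
    (hx : 2 * lowerCoeff κ d + 1 ≤ x) (hxy : x ≤ y) :
    (y ^ κ - x ^ κ) / 2 ≤ P κ d y - P κ d x := by
  have hD := lowerCoeff_nonneg κ d
  have hx1 : 1 ≤ x := by linarith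
  have hx0 : 0 < x := by linarith
  have hpow : x ^ κ ≤ y ^ κ := pow_le_pow_left₀ hx0.le hxy κ
  have hterm : ∀ j ∈ Finset.range ((κ + 1) / 2 - 1),
      -(|d (κ - 2 * (j + 1))| * ((y ^ κ - x ^ κ) / x)) ≤
      d (κ - 2 * (j + 1)) * (y ^ (κ - 2 * (j + 1)) - x ^ (κ - 2 * (j + 1))) := by
    intro j hj
    have hj' := Finset.mem_range.1 hj
    set m := κ - 2 * (j + 1) with hm
    have hκm : κ = (κ - m) + m := by omega
    have h1 : 0 ≤ y ^ m - x ^ m := sub_nonneg.2 (pow_le_pow_left₀ hx0.le hxy m)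
    have h2 : y ^ m - x ^ m ≤ (y ^ κ - x ^ κ) / x := by
      rw [le_div_iff₀ hx0]
      have h3 : x ≤ x ^ (κ - m) := le_self_pow₀ hx1 (by omega)
      have h4 : x ^ (κ - m) ≤ y ^ (κ - m) := pow_le_pow_left₀ hx0.le hxy _
      have h5 : y ^ κ = y ^ (κ - m) * y ^ m := by rw [← pow_add, ← hκm]
      have h6 : x ^ κ = x ^ (κ - m) * x ^ m := by rw [← pow_add, ← hκm]
      have h7 : 0 ≤ y ^ m := by have : 0 ≤ y := by linarith
                                positivity
      rw [h5, h6]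
      nlinarith
    have h3 := neg_abs_le (d m)
    have h4 := abs_nonneg (d m)
    nlinarith [mul_le_mul_of_nonneg_left h2 h4]
  rw [P_eq hκ hd, P_eq hκ hd]
  have hs := Finset.sum_le_sum hterm
  rw [Finset.sum_neg_distrib, ← Finset.sum_mul] at hs
  simp_rw [mul_sub] at hs
  rw [Finset.sum_sub_distrib] at hs
  have h8 : lowerCoeff κ d * ((y ^ κ - x ^ κ) / x) ≤ (y ^ κ - x ^ κ) / 2 := by
    rw [mul_div_assoc', div_le_div_iff₀ hx0 two_pos]
    nlinarith
  unfold lowerCoeff at h8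
  linarith

lemma abs_P_sub_pow_le {κ : ℕ} (hκ : 2 ≤ κ) {d : ℕ → ℝ} (hd : d κ = 1) {y : ℝ}
    (hy : 2 * lowerCoeff κ d + 1 ≤ y) : |P κ d y - y ^ κ| ≤ y ^ κ / 2 := by
  have hD := lowerCoeff_nonneg κ d
  have hy1 : 1 ≤ y := by linarith
  have hy0 : 0 < y := by linarith
  rw [P_eq hκ hd, add_sub_cancel_left]
  refine (Finset.abs_sum_le_sum_abs _ _).trans ?_
  have hterm : ∀ j ∈ Finset.range ((κ + 1) / 2 - 1),
      |d (κ - 2 * (j + 1)) * y ^ (κ - 2 * (j + 1))| ≤ |d (κ - 2 * (j + 1))| * (y ^ κ / y) := by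
    intro j hj
    have hj' := Finset.mem_range.1 hj
    rw [abs_mul, abs_of_nonneg (by positivity : 0 ≤ y ^ (κ - 2 * (j + 1)))]
    gcongr
    rw [le_div_iff₀ hy0, ← pow_succ]
    exact pow_le_pow_right₀ hy1 (by omega)
  refine (Finset.sum_le_sum hterm).trans ?_
  rw [← Finset.sum_mul]
  change lowerCoeff κ d * (y ^ κ / y) ≤ _
  rw [mul_div_assoc', div_le_div_iff₀ hy0 two_pos]
  have : 0 ≤ y ^ κ := by positivity
  nlinarith

lemma abs_P_le (κ : ℕ) (d : ℕ → ℝ) (y : ℝ) :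
    |P κ d y| ≤ (∑ j ∈ Finset.range ((κ + 1) / 2), |d (κ - 2 * j)|) * (1 + |y| ^ κ) := by
  unfold P
  refine (Finset.abs_sum_le_sum_abs _ _).trans ?_
  rw [Finset.sum_mul]
  refine Finset.sum_le_sum fun j _ => ?_
  rw [abs_mul, abs_pow]
  gcongr
  have hy := abs_nonneg y
  rcases le_total |y| 1 with h | h
  · have := pow_le_one₀ (n := κ - 2 * j) hy h
    have : 0 ≤ |y| ^ κ := by positivity
    linarith
  · have := pow_le_pow_right₀ h (show κ - 2 * j ≤ κ by omega)
    linarith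

lemma continuous_P (κ : ℕ) (d : ℕ → ℝ) : Continuous (P κ d) := by
  unfold P; fun_prop

lemma volume_branch_le {κ : ℕ} (hκ : 2 ≤ κ) {d : ℕ → ℝ} (hd : d κ = 1) {γ : ℝ}
    (hγ0 : 0 ≤ γ) (hγ : γ ≤ 1 - 1 / (κ : ℝ)) {b : ℝ} (hb : 0 < b) (k : ℤ) :
    volume {y : ℝ | 2 * lowerCoeff κ d + 1 < y ∧ (k : ℝ) ≤ b * P κ d y ∧ b * P κ d y ≤ k + 1} ≤
      ENNReal.ofReal (6 * b ^ (-(1 / (κ : ℝ))) * jb k ^ (-γ)) := by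
  have hD := lowerCoeff_nonneg κ d
  have hκ0 : (0 : ℝ) < κ := by positivity
  have hκ1 : 1 / (κ : ℝ) ≤ 1 := by
    rw [div_le_one hκ0]; exact_mod_cast (by omega : 1 ≤ κ)
  have hκp : 0 < 1 / (κ : ℝ) := by positivity
  set S := {y : ℝ | 2 * lowerCoeff κ d + 1 < y ∧ (k : ℝ) ≤ b * P κ d y ∧ b * P κ d y ≤ k + 1}
  have hpow : ∀ y ∈ S, 1 < y ∧ y ^ κ / 2 ≤ P κ d y ∧ P κ d y ≤ 3 / 2 * y ^ κ := by
    rintro y ⟨hy, -, -⟩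
    have h := abs_le.1 (abs_P_sub_pow_le hκ hd hy.le)
    exact ⟨by linarith, by linarith, by linarith⟩
  rcases lt_trichotomy k 0 with hk | hk | hk
  · have : S = ∅ := by
      refine Set.eq_empty_of_forall_notMem fun y hy => ?_
      obtain ⟨h1, h2, -⟩ := hpow y hy
      have h3 : (k : ℝ) + 1 ≤ 0 := by exact_mod_cast hk
      have h4 : 0 < P κ d y := lt_of_lt_of_le (by positivity) h2
      have := hy.2.2
      have : 0 < b * P κ d y := by positivity
      linarith
    rw [this]; simp
  · subst hk
    have hsub : S ⊆ Set.Icc 0 (2 * b ^ (-(1 / (κ : ℝ)))) := by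
      intro y hy
      obtain ⟨h1, h2, -⟩ := hpow y hy
      have h3 := hy.2.2
      have hy0 : 0 < y := by linarith
      refine ⟨hy0.le, ?_⟩
      have h4 : y ^ κ ≤ 2 / b := by
        rw [le_div_iff₀ hb]
        have : b * (y ^ κ / 2) ≤ b * P κ d y := by gcongr
        simp at h3
        nlinarith
      have h5 : y = (y ^ κ) ^ (1 / (κ : ℝ)) := by
        rw [one_div, Real.pow_rpow_inv_natCast hy0.le (by omega)]
      rw [h5]
      refine (rpow_le_rpow (by positivity) h4 hκp.le).trans ?_
      rw [div_rpow (by norm_num) hb.le, rpow_neg hb.le, ← div_eq_mul_inv]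
      gcongr
      calc (2:ℝ) ^ (1 / (κ : ℝ)) ≤ 2 ^ (1 : ℝ) :=
            rpow_le_rpow_of_exponent_le (by norm_num) hκ1
        _ = 2 := rpow_one 2
    refine (measure_mono hsub).trans ?_
    rw [Real.volume_Icc]
    refine ENNReal.ofReal_le_ofReal ?_
    have : jb 0 = 1 := by simp [jb]
    rw [this, one_rpow]
    have : 0 < b ^ (-(1 / (κ : ℝ))) := by positivity
    linarith
  · refine (Real.volume_le_diam S).trans (Metric.ediam_le fun x hx y hy => ?_)
    rw [edist_dist]
    refine ENNReal.ofReal_le_ofReal ?_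
    wlog hxy : x ≤ y generalizing x y
    · rw [dist_comm]; exact this y hy x hx (le_of_not_ge hxy)
    rw [dist_comm, Real.dist_eq, abs_of_nonneg (by linarith)]
    obtain ⟨h1, -, h3⟩ := hpow x hx
    have hx0 : 0 < x := by linarith
    have hjb : jb k = k + 1 := by
      unfold jb; rw [abs_of_pos (by exact_mod_cast hk)]; ring
    have hk1 : (1 : ℝ) ≤ k := by exact_mod_cast hk
    have hjp := jb_pos k
    have h4 : jb k / (3 * b) ≤ x ^ κ := by
      rw [div_le_iff₀ (by positivity), hjb]
      have h5 := hx.2.1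
      have : b * P κ d x ≤ b * (3 / 2 * x ^ κ) := by gcongr
      linarith
    have h6 : (jb k / (3 * b)) ^ (1 - 1 / (κ : ℝ)) ≤ x ^ (κ - 1) := by
      have e : x ^ (κ - 1) = (x ^ κ) ^ (1 - 1 / (κ : ℝ)) := by
        rw [← rpow_natCast, ← rpow_natCast, ← rpow_mul hx0.le, Nat.cast_sub (by omega)]
        congr 1; field_simp; push_cast; ring
      rw [e]
      exact rpow_le_rpow (by positivity) h4 (by linarith)
    have h7 : x ^ (κ - 1) * (y - x) ≤ 2 / b := by
      have h8 := P_sub_ge hκ hd hx.1.le hxy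
      have h9 : x ^ (κ - 1) * (y - x) ≤ y ^ κ - x ^ κ := by
        have e1 : y ^ κ = y ^ (κ - 1) * y := by rw [← pow_succ]; congr 1; omega
        have e2 : x ^ κ = x ^ (κ - 1) * x := by rw [← pow_succ]; congr 1; omega
        have : x ^ (κ - 1) ≤ y ^ (κ - 1) := pow_le_pow_left₀ hx0.le hxy _
        rw [e1, e2]; nlinarith
      rw [le_div_iff₀ hb]
      have := hx.2.1
      have := hy.2.2
      nlinarith
    have hq : 0 < (jb k / (3 * b)) ^ (1 - 1 / (κ : ℝ)) := by positivity
    have h8 : y - x ≤ 2 / b / (jb k / (3 * b)) ^ (1 - 1 / (κ : ℝ)) := by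
      rw [le_div_iff₀ hq, mul_comm]
      refine le_trans ?_ h7
      gcongr
    refine h8.trans ?_
    have e1 : (jb k / (3 * b)) ^ (1 - 1 / (κ : ℝ)) =
        jb k ^ (1 - 1 / (κ : ℝ)) / (3 ^ (1 - 1 / (κ : ℝ)) * (b * b ^ (-(1 / (κ : ℝ))))) := by
      rw [div_rpow hjp.le (by positivity), mul_rpow (by norm_num) hb.le]
      congr 2
      rw [sub_eq_add_neg, rpow_add hb, rpow_one]
    have hbp : 0 < b ^ (-(1 / (κ : ℝ))) := by positivity
    rw [e1]
    have e2 : 2 / b / (jb k ^ (1 - 1 / (κ : ℝ)) /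
        (3 ^ (1 - 1 / (κ : ℝ)) * (b * b ^ (-(1 / (κ : ℝ)))))) =
        2 * 3 ^ (1 - 1 / (κ : ℝ)) * b ^ (-(1 / (κ : ℝ))) * jb k ^ (-(1 - 1 / (κ : ℝ))) := by
      rw [rpow_neg hjp.le]; field_simp
    rw [e2]
    have h9 : (3:ℝ) ^ (1 - 1 / (κ : ℝ)) ≤ 3 := by
      calc (3:ℝ) ^ (1 - 1 / (κ : ℝ)) ≤ 3 ^ (1 : ℝ) :=
            rpow_le_rpow_of_exponent_le (by norm_num) (by linarith)
        _ = 3 := rpow_one 3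
    have h10 : jb k ^ (-(1 - 1 / (κ : ℝ))) ≤ jb k ^ (-γ) :=
      rpow_le_rpow_of_exponent_le (one_le_jb k) (by linarith)
    calc _ ≤ 2 * 3 * b ^ (-(1 / (κ : ℝ))) * jb k ^ (-γ) := by gcongr
      _ = _ := by ring

/-- Measure of the level cells of the scaled symbol. -/
lemma exists_volume_cell_le {κ : ℕ} (hκ : 2 ≤ κ) {d : ℕ → ℝ} (hd : d κ = 1) {γ : ℝ}
    (hγ0 : 0 ≤ γ) (hγ : γ ≤ 1 - 1 / (κ : ℝ)) :
    ∃ C : ℝ, 0 < C ∧ ∀ b : ℝ, 0 < b → b ≤ 1 → ∀ k : ℤ,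
      volume {y : ℝ | ⌊b * P κ d y⌋ = k} ≤
        ENNReal.ofReal (C * b ^ (-(1 / (κ : ℝ))) * jb k ^ (-γ)) := by
  have hD := lowerCoeff_nonneg κ d
  set Y := 2 * lowerCoeff κ d + 1 with hY
  set M := (∑ j ∈ Finset.range ((κ + 1) / 2), |d (κ - 2 * j)|) * (1 + Y ^ κ) with hM
  have hκ0 : (0 : ℝ) < κ := by positivity
  have hκp : 0 < 1 / (κ : ℝ) := by positivity
  have hY1 : 1 ≤ Y := by linarith
  have hM0 : 0 ≤ M := mul_nonneg (Finset.sum_nonneg fun _ _ => abs_nonneg _) (by positivity)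
  have hγ1 : γ ≤ 1 := by linarith
  refine ⟨2 * Y * (M + 2) + 6 + 12, by positivity, fun b hb hb1 k => ?_⟩
  have hjk := jb_pos k
  have hB : 1 ≤ b ^ (-(1 / (κ : ℝ))) :=
    one_le_rpow_of_pos_of_le_one_of_nonpos hb hb1 (by linarith)
  set B := b ^ (-(1 / (κ : ℝ)))
  set G := jb k ^ (-γ) with hG
  have hG0 : 0 < G := by positivity
  set S₁ := {y : ℝ | -Y ≤ y ∧ y ≤ Y ∧ ⌊b * P κ d y⌋ = k}
  set S₂ := {y : ℝ | Y < y ∧ (k : ℝ) ≤ b * P κ d y ∧ b * P κ d y ≤ k + 1}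
  set S₃ := {y : ℝ | y < -Y ∧ ⌊b * P κ d y⌋ = k}
  have hcover : {y : ℝ | ⌊b * P κ d y⌋ = k} ⊆ (S₁ ∪ S₂) ∪ S₃ := by
    intro y hy
    simp only [Set.mem_ofPred_eq] at hy
    by_cases h1 : y < -Y
    · exact Or.inr ⟨h1, hy⟩
    · by_cases h2 : Y < y
      · refine Or.inl (Or.inr ⟨h2, ?_, ?_⟩)
        · rw [← hy]; exact Int.floor_le _
        · rw [← hy]; exact (Int.lt_floor_add_one _).le
      · exact Or.inl (Or.inl ⟨not_lt.1 h1, not_lt.1 h2, hy⟩)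
  have h1 : volume S₁ ≤ ENNReal.ofReal (2 * Y * (M + 2) * B * G) := by
    by_cases hne : S₁.Nonempty
    · obtain ⟨y, hy1, hy2, hy3⟩ := hne
      have hP : |b * P κ d y| ≤ M := by
        rw [abs_mul, abs_of_pos hb]
        have h := abs_P_le κ d y
        have h' : |y| ≤ Y := abs_le.2 ⟨hy1, hy2⟩
        have h'' : (∑ j ∈ Finset.range ((κ + 1) / 2), |d (κ - 2 * j)|) * (1 + |y| ^ κ) ≤ M := by
          rw [hM]; gcongr
        nlinarith [abs_nonneg (P κ d y)]
      have hk : jb k ≤ M + 2 := by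
        have h3 := Int.floor_le (b * P κ d y)
        have h4 := Int.lt_floor_add_one (b * P κ d y)
        rw [hy3] at h3 h4
        have h5 := abs_le.1 hP
        have : |(k : ℝ)| ≤ M + 1 := abs_le.2 ⟨by linarith, by linarith⟩
        unfold jb; linarith
      have hsub : S₁ ⊆ Set.Icc (-Y) Y := fun z hz => ⟨hz.1, hz.2.1⟩
      refine (measure_mono hsub).trans ?_
      rw [Real.volume_Icc]
      refine ENNReal.ofReal_le_ofReal ?_
      have h6 : 1 ≤ (M + 2) * G := by
        have h7 : jb k ^ (-(1:ℝ)) ≤ G := rpow_le_rpow_of_exponent_le (one_le_jb k) (by linarith)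
        rw [rpow_neg_one] at h7
        calc (1:ℝ) = jb k * (jb k)⁻¹ := by field_simp
          _ ≤ (M + 2) * G := by gcongr
      have h8 : 1 ≤ B * ((M + 2) * G) := one_le_mul_of_one_le_of_one_le hB h6
      nlinarith
    · rw [Set.not_nonempty_iff_eq_empty.1 hne]; simp
  have h2 : volume S₂ ≤ ENNReal.ofReal (6 * B * G) := volume_branch_le hκ hd hγ0 hγ hb k
  have h3 : volume S₃ ≤ ENNReal.ofReal (12 * B * G) := by
    have hrefl : volume S₃ = volume ((fun y : ℝ => -y) ⁻¹' S₃) :=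
      (Measure.measure_preimage_neg volume S₃).symm
    rw [hrefl]
    rcases Nat.even_or_odd κ with he | ho
    · have hsub : (fun y : ℝ => -y) ⁻¹' S₃ ⊆ S₂ := by
        rintro y ⟨hy1, hy2⟩
        rw [P_neg, he.neg_one_pow, one_mul] at hy2
        refine ⟨by linarith, ?_, ?_⟩
        · rw [← hy2]; exact Int.floor_le _
        · rw [← hy2]; exact (Int.lt_floor_add_one _).le
      refine ((measure_mono hsub).trans h2).trans (ENNReal.ofReal_le_ofReal ?_)
      have : 0 < B * G := by positivity
      linarith
    · have hsub : (fun y : ℝ => -y) ⁻¹' S₃ ⊆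
          {y : ℝ | Y < y ∧ ((-k - 1 : ℤ) : ℝ) ≤ b * P κ d y ∧
            b * P κ d y ≤ ((-k - 1 : ℤ) : ℝ) + 1} := by
        rintro y ⟨hy1, hy2⟩
        have h4 := Int.floor_le (b * P κ d (-y))
        have h5 := Int.lt_floor_add_one (b * P κ d (-y))
        rw [hy2, P_neg, ho.neg_one_pow] at h4 h5
        push_cast
        exact ⟨by linarith, by linarith, by linarith⟩
      refine ((measure_mono hsub).trans (volume_branch_le hκ hd hγ0 hγ hb (-k - 1))).trans
        (ENNReal.ofReal_le_ofReal ?_)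
      have h6 : jb k / 2 ≤ jb (-k - 1) := by
        have h7 := jb_add_le (-k - 1) 1
        rw [show (-k - 1 + 1 : ℤ) = -k by ring, jb_neg] at h7
        have h8 : jb 1 = 2 := by simp [jb]; norm_num
        have h9 := one_le_jb (-k - 1)
        have h10 : |(k:ℝ)| ≤ |((-k - 1 : ℤ) : ℝ)| + 1 := by
          have := abs_sub (((-k - 1 : ℤ) : ℝ)) (-1)
          push_cast at this ⊢
          rw [show -(k:ℝ) - 1 - -1 = -k by ring, abs_neg, abs_neg, abs_one] at this
          exact this
        have h11 := abs_nonneg ((-k - 1 : ℤ) : ℝ)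
        unfold jb; linarith
      have h7 : jb (-k - 1) ^ (-γ) ≤ 2 * G := by
        refine (rpow_le_rpow_of_nonpos (by positivity) h6 (by linarith)).trans ?_
        rw [div_rpow hjk.le (by norm_num), ← hG, div_le_iff₀ (by positivity), mul_comm (2:ℝ),
          mul_assoc]
        refine le_mul_of_one_le_right hG0.le ?_
        have : (2:ℝ) ^ (-(1:ℝ)) ≤ 2 ^ (-γ) :=
          rpow_le_rpow_of_exponent_le (by norm_num) (by linarith)
        rw [rpow_neg_one] at this
        linarith
      calc 6 * B * jb (-k - 1) ^ (-γ) ≤ 6 * B * (2 * G) := by gcongr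
        _ = _ := by ring
  refine (measure_mono hcover).trans ((measure_union_le _ _).trans
    ((add_le_add (measure_union_le _ _) le_rfl).trans ((add_le_add (add_le_add h1 h2) h3).trans ?_)))
  rw [← ENNReal.ofReal_add (by positivity) (by positivity),
    ← ENNReal.ofReal_add (by positivity) (by positivity)]
  exact ENNReal.ofReal_le_ofReal (le_of_eq (by ring))

/-- The unimodular exponential `e^{it}`. -/
noncomputable def ex (t : ℝ) : ℂ := Complex.exp (Complex.I * (t : ℂ))

lemma ex_zero : ex 0 = 1 := by simp [ex]

lemma ex_add (s t : ℝ) : ex (s + t) = ex s * ex t := by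
  unfold ex; rw [← Complex.exp_add]; congr 1; push_cast; ring

lemma norm_ex (t : ℝ) : ‖ex t‖ = 1 := by
  unfold ex; rw [mul_comm]; exact Complex.norm_exp_ofReal_mul_I t

@[fun_prop]
lemma continuous_ex : Continuous ex := by unfold ex; fun_prop

lemma hasDerivAt_ex (t s : ℝ) :
    HasDerivAt (fun s : ℝ => ex (s * t)) (Complex.I * t * ex (s * t)) s := by
  have h1 : HasDerivAt (fun s : ℝ => ((s : ℝ) : ℂ)) 1 s := Complex.ofRealCLM.hasDerivAt
  have h2 : HasDerivAt (fun s : ℝ => Complex.I * ((s * t : ℝ) : ℂ)) (Complex.I * t) s := by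
    have := (h1.mul_const (t : ℂ)).const_mul Complex.I
    simpa using this
  have := h2.cexp
  unfold ex
  convert this using 1
  ring

/-- The oscillatory integral `∫_u^v e^{ist} ds`. -/
noncomputable def osc (u v t : ℝ) : ℂ := ∫ s in u..v, ex (s * t)

lemma norm_osc_le_abs (u v t : ℝ) : ‖osc u v t‖ ≤ |v - u| := by
  have := intervalIntegral.norm_integral_le_of_norm_le_const (C := 1) (a := u) (b := v)
    (f := fun s => ex (s * t)) (fun s _ => (norm_ex _).le)
  unfold osc; simpa using this

lemma integral_deriv_ex (u v t : ℝ) : Complex.I * t * osc u v t = ex (v * t) - ex (u * t) := by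
  have hc : Continuous fun s : ℝ => Complex.I * t * ex (s * t) := by fun_prop
  rw [osc, ← intervalIntegral.integral_const_mul]
  exact intervalIntegral.integral_eq_sub_of_hasDerivAt (fun s _ => hasDerivAt_ex t s)
    (hc.intervalIntegrable _ _)

lemma norm_osc_mul_le (u v t : ℝ) : |t| * ‖osc u v t‖ ≤ 2 := by
  have h := congrArg norm (integral_deriv_ex u v t)
  rw [norm_mul, norm_mul, Complex.norm_I, Complex.norm_real, one_mul, Real.norm_eq_abs] at h
  rw [h]
  refine (norm_sub_le _ _).trans ?_
  rw [norm_ex, norm_ex]; norm_num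

lemma osc_shift (a u v t : ℝ) : osc (a + u) (a + v) t = ex (a * t) * osc u v t := by
  unfold osc
  rw [← intervalIntegral.integral_comp_add_left, ← intervalIntegral.integral_const_mul]
  refine intervalIntegral.integral_congr fun s _ => ?_
  simp only [add_mul, ex_add]

lemma hasDerivAt_osc_left (b t r : ℝ) :
    HasDerivAt (fun r => osc r b t) (-ex (r * t)) r := by
  have hc : Continuous fun s : ℝ => ex (s * t) := by fun_prop
  exact intervalIntegral.integral_hasDerivAt_left (hc.intervalIntegrable _ _)
    (hc.stronglyMeasurableAtFilter _ _) hc.continuousAt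

lemma continuous_osc_left (b t : ℝ) : Continuous (fun r => osc r b t) :=
  continuous_iff_continuousAt.2 fun r => (hasDerivAt_osc_left b t r).continuousAt

/-- A `C¹` path on the whole line with total size at most `V` on `[0, T]`. -/
structure IsPath (T V : ℝ) (u u' : ℝ → ℂ) : Prop where
  deriv : ∀ s, HasDerivAt u (u' s) s
  cont : Continuous u'
  bound : ‖u 0‖ + ∫ s in (0:ℝ)..T, ‖u' s‖ ≤ V

namespace IsPath
variable {T V : ℝ} {u u' : ℝ → ℂ} (hu : IsPath T V u u')
include hu

lemma continuous : Continuous u :=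
  continuous_iff_continuousAt.2 fun s => (hu.deriv s).continuousAt

lemma integral_eq (a b : ℝ) : ∫ s in a..b, u' s = u b - u a :=
  intervalIntegral.integral_eq_sub_of_hasDerivAt (fun s _ => hu.deriv s)
    (hu.cont.intervalIntegrable _ _)

lemma integral_norm_le_of_le {a b : ℝ} (ha : 0 ≤ a) (hab : a ≤ b) (hb : b ≤ T) :
    ∫ s in a..b, ‖u' s‖ ≤ ∫ s in (0:ℝ)..T, ‖u' s‖ :=
  intervalIntegral.integral_mono_interval ha hab hb
    (Filter.Eventually.of_forall fun _ => norm_nonneg _)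
    (hu.cont.norm.intervalIntegrable _ _)

lemma norm_add_le {a b : ℝ} (ha : 0 ≤ a) (hab : a ≤ b) (hb : b ≤ T) :
    ‖u a‖ + ∫ s in a..b, ‖u' s‖ ≤ V := by
  have h1 : ‖u a‖ ≤ ‖u 0‖ + ∫ s in (0:ℝ)..a, ‖u' s‖ := by
    have h2 := hu.integral_eq 0 a
    have h3 : u a = u 0 + ∫ s in (0:ℝ)..a, u' s := by rw [h2]; ring
    rw [h3]
    refine (_root_.norm_add_le _ _).trans ?_
    gcongr
    exact intervalIntegral.norm_integral_le_integral_norm ha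
  have h4 := intervalIntegral.integral_add_adjacent_intervals
    (hu.cont.norm.intervalIntegrable (μ := volume) 0 a)
    (hu.cont.norm.intervalIntegrable (μ := volume) a b)
  have h5 := hu.integral_norm_le_of_le le_rfl (ha.trans hab) hb
  have := hu.bound
  linarith

lemma norm_le {r : ℝ} (hr : 0 ≤ r) (hrT : r ≤ T) : ‖u r‖ ≤ V := by
  simpa using hu.norm_add_le hr le_rfl hrT

lemma nonneg (hT : 0 ≤ T) : 0 ≤ V := (norm_nonneg _).trans (hu.norm_le le_rfl hT)

/-- Integration by parts against an oscillating exponential. -/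
lemma integral_ex_mul (a b t : ℝ) :
    ∫ s in a..b, ex (s * t) * u s = osc a b t * u a + ∫ r in a..b, osc r b t * u' r := by
  have hcu := hu.continuous
  have hc := hu.cont
  have ho := continuous_osc_left b t
  have h1 : ∫ r in a..b, (-ex (r * t) * u r + osc r b t * u' r) =
      osc b b t * u b - osc a b t * u a :=
    intervalIntegral.integral_eq_sub_of_hasDerivAt
      (fun r _ => (hasDerivAt_osc_left b t r).mul (hu.deriv r))
      (Continuous.intervalIntegrable (by fun_prop) _ _)
  rw [intervalIntegral.integral_add (Continuous.intervalIntegrable (by fun_prop) _ _)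
    (Continuous.intervalIntegrable (by fun_prop) _ _)] at h1
  have h2 : osc b b t = 0 := by simp [osc]
  simp only [neg_mul, intervalIntegral.integral_neg] at h1
  rw [h2, zero_mul, zero_sub] at h1
  linear_combination -h1

lemma integral_ex_mul' (a b t : ℝ) :
    Complex.I * t * ∫ s in a..b, ex (s * t) * u s =
      ex (b * t) * u b - ex (a * t) * u a - ∫ s in a..b, ex (s * t) * u' s := by
  have hcu := hu.continuous
  have hc := hu.cont
  have h1 : ∫ r in a..b, (Complex.I * t * ex (r * t) * u r + ex (r * t) * u' r) =
      ex (b * t) * u b - ex (a * t) * u a :=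
    intervalIntegral.integral_eq_sub_of_hasDerivAt
      (fun r _ => (hasDerivAt_ex t r).mul (hu.deriv r))
      (Continuous.intervalIntegrable (by fun_prop) _ _)
  rw [intervalIntegral.integral_add (Continuous.intervalIntegrable (by fun_prop) _ _)
    (Continuous.intervalIntegrable (by fun_prop) _ _)] at h1
  simp only [mul_assoc (Complex.I * t), intervalIntegral.integral_const_mul] at h1
  linear_combination h1

lemma norm_integral_ex_mul_le {a b t ω : ℝ} (ha : 0 ≤ a) (hab : a ≤ b) (hb : b ≤ T)
    (hω : ∀ r, a ≤ r → r ≤ b → ‖osc r b t‖ ≤ ω) :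
    ‖∫ s in a..b, ex (s * t) * u s‖ ≤ ω * V := by
  have hc := hu.cont
  have ho := continuous_osc_left b t
  rw [hu.integral_ex_mul]
  have hω0 : 0 ≤ ω := (norm_nonneg _).trans (hω a le_rfl hab)
  have h1 : ‖∫ r in a..b, osc r b t * u' r‖ ≤ ω * ∫ r in a..b, ‖u' r‖ := by
    rw [← intervalIntegral.integral_const_mul]
    refine (intervalIntegral.norm_integral_le_integral_norm hab).trans ?_
    refine intervalIntegral.integral_mono_on hab
      (Continuous.intervalIntegrable (by fun_prop) _ _)
      (Continuous.intervalIntegrable (by fun_prop) _ _) fun r hr => ?_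
    rw [norm_mul]
    exact mul_le_mul_of_nonneg_right (hω r hr.1 hr.2) (norm_nonneg _)
  refine (_root_.norm_add_le _ _).trans ?_
  rw [norm_mul]
  have h2 := hω a le_rfl hab
  have h3 := hu.norm_add_le ha hab hb
  have h4 := norm_nonneg (u a)
  nlinarith

end IsPath

/-- Exponential sum `Σ_{m<n} e^{imτt}`. -/
noncomputable def expSum (τ : ℝ) (n : ℕ) (t : ℝ) : ℂ := ∑ m ∈ Finset.range n, ex (m * τ * t)

lemma norm_abel_le {z u : ℕ → ℂ} {D : ℝ} {n : ℕ}
    (hD : ∀ m ≤ n, ‖∑ i ∈ Finset.range m, z i‖ ≤ D) :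
    ‖∑ m ∈ Finset.range n, z m * u m‖ ≤
      D * (‖u n‖ + ∑ m ∈ Finset.range n, ‖u (m + 1) - u m‖) := by
  have key : ∀ k ≤ n, ‖∑ m ∈ Finset.range k, z m * u m - (∑ i ∈ Finset.range k, z i) * u k‖ ≤
      D * ∑ m ∈ Finset.range k, ‖u (m + 1) - u m‖ := by
    intro k
    induction k with
    | zero => intro _; simp
    | succ k ih =>
      intro hk
      have h1 := ih (by omega)
      have h2 := hD (k + 1) hk
      have e : ∑ m ∈ Finset.range (k + 1), z m * u m -
          (∑ i ∈ Finset.range (k + 1), z i) * u (k + 1) =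
          (∑ m ∈ Finset.range k, z m * u m - (∑ i ∈ Finset.range k, z i) * u k) -
          (∑ i ∈ Finset.range (k + 1), z i) * (u (k + 1) - u k) := by
        rw [Finset.sum_range_succ, Finset.sum_range_succ z]; ring
      rw [e, Finset.sum_range_succ (fun m => ‖u (m + 1) - u m‖), mul_add]
      refine (norm_sub_le _ _).trans (add_le_add h1 ?_)
      rw [norm_mul]
      exact mul_le_mul_of_nonneg_right h2 (norm_nonneg _)
  have h1 := key n le_rfl
  have h2 := norm_add_le (∑ m ∈ Finset.range n, z m * u m - (∑ i ∈ Finset.range n, z i) * u n)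
    ((∑ i ∈ Finset.range n, z i) * u n)
  rw [sub_add_cancel, norm_mul] at h2
  have h3 := mul_le_mul_of_nonneg_right (hD n le_rfl) (norm_nonneg (u n))
  linarith

lemma norm_abel_le_two {z u : ℕ → ℂ} {D V : ℝ} {n : ℕ}
    (hD : ∀ m ≤ n, ‖∑ i ∈ Finset.range m, z i‖ ≤ D) (h1 : ‖u n‖ ≤ V)
    (h2 : ∑ m ∈ Finset.range n, ‖u (m + 1) - u m‖ ≤ V) :
    ‖∑ m ∈ Finset.range n, z m * u m‖ ≤ 2 * D * V := by
  refine (norm_abel_le hD).trans ?_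
  have hD0 : 0 ≤ D := (norm_nonneg _).trans (hD n le_rfl)
  nlinarith

/-- Variation of the samples of a primitive. -/
lemma sum_norm_integral_le {f : ℝ → ℂ} (hf : Continuous f) {τ : ℝ} (hτ : 0 ≤ τ) (n : ℕ) :
    ∑ m ∈ Finset.range n, ‖(∫ s in (0:ℝ)..((m + 1 : ℕ) : ℝ) * τ, f s) -
      ∫ s in (0:ℝ)..(m : ℝ) * τ, f s‖ ≤ ∫ s in (0:ℝ)..(n : ℝ) * τ, ‖f s‖ := by
  have h1 := intervalIntegral.sum_integral_adjacent_intervals (μ := volume) (n := n)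
    (f := fun s => ‖f s‖) (a := fun m : ℕ => (m : ℝ) * τ)
    (fun k _ => hf.norm.intervalIntegrable _ _)
  simp only [Nat.cast_zero, zero_mul] at h1
  rw [← h1]
  refine Finset.sum_le_sum fun m _ => ?_
  rw [intervalIntegral.integral_interval_sub_left (hf.intervalIntegrable _ _)
    (hf.intervalIntegrable _ _)]
  refine intervalIntegral.norm_integral_le_integral_norm ?_
  push_cast; nlinarith

namespace IsPath
variable {T V : ℝ} {u u' : ℝ → ℂ} (hu : IsPath T V u u')
include hu

lemma sum_norm_sub_le {τ : ℝ} (hτ : 0 ≤ τ) {n : ℕ} (hn : (n : ℝ) * τ ≤ T) :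
    ∑ m ∈ Finset.range n, ‖u (((m + 1 : ℕ) : ℝ) * τ) - u ((m : ℝ) * τ)‖ ≤ V := by
  have h := sum_norm_integral_le hu.cont hτ n
  simp_rw [hu.integral_eq] at h
  simp only [sub_sub_sub_cancel_right] at h
  have hn0 : 0 ≤ (n : ℝ) * τ := by positivity
  have h2 := hu.norm_add_le le_rfl hn0 hn
  have := norm_nonneg (u 0)
  linarith

lemma norm_sum_ex_mul_le {τ D x : ℝ} (hτ : 0 ≤ τ) {n : ℕ} (hn : (n : ℝ) * τ ≤ T)
    (hD : ∀ m ≤ n, ‖expSum τ m x‖ ≤ D) :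
    ‖∑ m ∈ Finset.range n, ex (m * τ * x) * u (m * τ)‖ ≤ 2 * D * V :=
  norm_abel_le_two (u := fun m : ℕ => u (m * τ)) hD (hu.norm_le (by positivity) hn)
    (hu.sum_norm_sub_le hτ hn)

/-- Abel summation of sampled primitives. -/
lemma norm_sum_ex_mul_integral_le {τ D x θ : ℝ} (hτ : 0 ≤ τ) {n : ℕ}
    (hn : (n : ℝ) * τ ≤ T) (hD : ∀ m ≤ n, ‖expSum τ m x‖ ≤ D) {M : ℝ}
    (hM : ∀ r, 0 ≤ r → r ≤ T → ‖u r‖ ≤ M) :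
    ‖∑ m ∈ Finset.range n, ex (m * τ * x) * ∫ s in (0:ℝ)..(m : ℝ) * τ, ex (s * θ) * u s‖ ≤
      2 * D * (T * M) := by
  have hc := hu.continuous
  have hn0 : 0 ≤ (n : ℝ) * τ := by positivity
  have hM0 : 0 ≤ M := (norm_nonneg _).trans (hM 0 le_rfl (hn0.trans hn))
  have hI : ∫ s in (0:ℝ)..(n : ℝ) * τ, ‖ex (s * θ) * u s‖ ≤ T * M := by
    have h1 : ∫ s in (0:ℝ)..(n : ℝ) * τ, ‖ex (s * θ) * u s‖ ≤ ∫ s in (0:ℝ)..(n : ℝ) * τ, M := by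
      refine intervalIntegral.integral_mono_on hn0
        (Continuous.intervalIntegrable (by fun_prop) _ _) (by simp) fun r hr => ?_
      rw [norm_mul, norm_ex, one_mul]
      exact hM r hr.1 (hr.2.trans hn)
    rw [intervalIntegral.integral_const, smul_eq_mul, sub_zero] at h1
    nlinarith
  refine norm_abel_le_two (u := fun m : ℕ => ∫ s in (0:ℝ)..(m : ℝ) * τ, ex (s * θ) * u s) hD
    ((intervalIntegral.norm_integral_le_integral_norm hn0).trans hI) ?_
  exact (sum_norm_integral_le (f := fun s => ex (s * θ) * u s) (by fun_prop) hτ n).trans hI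

lemma norm_sum_ex_mul_integral_le_decay {τ D₁ D₂ x θ : ℝ} (hτ : 0 ≤ τ) (hT : 0 ≤ T) {n : ℕ}
    (hn : (n : ℝ) * τ ≤ T) (hD₁ : ∀ m ≤ n, ‖expSum τ m x‖ ≤ D₁)
    (hD₂ : ∀ m ≤ n, ‖expSum τ m (x + θ)‖ ≤ D₂) :
    ‖∑ m ∈ Finset.range n, ex (m * τ * x) * ∫ s in (0:ℝ)..(m : ℝ) * τ, ex (s * θ) * u s‖ ≤
      (4 * T + 6) * (1 + |θ|)⁻¹ * (D₁ + D₂) * V := by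
  have hV := hu.nonneg hT
  have hD₁0 : 0 ≤ D₁ := (norm_nonneg _).trans (hD₁ n le_rfl)
  have hD₂0 : 0 ≤ D₂ := (norm_nonneg _).trans (hD₂ n le_rfl)
  have hθ := abs_nonneg θ
  have e : (4 * T + 6) * (1 + |θ|)⁻¹ * (D₁ + D₂) * V =
      ((4 * T + 6) * ((D₁ + D₂) * V)) / (1 + |θ|) := by field_simp
  rw [e, le_div_iff₀ (by positivity)]
  have hDV1 : 0 ≤ D₁ * V := by positivity
  have hDV2 : 0 ≤ D₂ * V := by positivity
  rcases le_total |θ| 1 with h | h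
  · have h1 := hu.norm_sum_ex_mul_integral_le (θ := θ) hτ hn hD₁
      (M := V) (fun r h0 h1 => hu.norm_le h0 h1)
    set S := ‖∑ m ∈ Finset.range n, ex (m * τ * x) *
      ∫ s in (0:ℝ)..(m : ℝ) * τ, ex (s * θ) * u s‖
    have hS : 0 ≤ S := norm_nonneg _
    have : S * (1 + |θ|) ≤ S * 2 := by gcongr; linarith
    nlinarith [mul_nonneg hT hDV2]
  · have hc := hu.cont
    have e1 : Complex.I * θ * ∑ m ∈ Finset.range n, ex (m * τ * x) *
        ∫ s in (0:ℝ)..(m : ℝ) * τ, ex (s * θ) * u s =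
        ∑ m ∈ Finset.range n, ex (m * τ * (x + θ)) * u (m * τ) - expSum τ n x * u 0 -
        ∑ m ∈ Finset.range n, ex (m * τ * x) *
          ∫ s in (0:ℝ)..(m : ℝ) * τ, ex (s * θ) * u' s := by
      rw [expSum, Finset.mul_sum, Finset.sum_mul, ← Finset.sum_sub_distrib,
        ← Finset.sum_sub_distrib]
      refine Finset.sum_congr rfl fun m _ => ?_
      have := hu.integral_ex_mul' 0 (m * τ) θ
      rw [zero_mul, ex_zero] at this
      rw [mul_add, ex_add]
      linear_combination ex (m * τ * x) * this
    have hn0 : 0 ≤ (n : ℝ) * τ := by positivity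
    have hI : ∫ s in (0:ℝ)..(n : ℝ) * τ, ‖ex (s * θ) * u' s‖ ≤ V := by
      simp_rw [norm_mul, norm_ex, one_mul]
      have h1 := hu.norm_add_le le_rfl hn0 hn
      have := norm_nonneg (u 0)
      linarith
    have b1 := hu.norm_sum_ex_mul_le hτ hn hD₂
    have b2 : ‖expSum τ n x * u 0‖ ≤ D₁ * V := by
      rw [norm_mul]
      have h1 := hD₁ n le_rfl
      have h2 := hu.norm_le le_rfl hT
      gcongr
    have b3 : ‖∑ m ∈ Finset.range n, ex (m * τ * x) *
        ∫ s in (0:ℝ)..(m : ℝ) * τ, ex (s * θ) * u' s‖ ≤ 2 * D₁ * V := by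
      refine norm_abel_le_two
        (u := fun m : ℕ => ∫ s in (0:ℝ)..(m : ℝ) * τ, ex (s * θ) * u' s) hD₁
        ((intervalIntegral.norm_integral_le_integral_norm hn0).trans hI) ?_
      exact (sum_norm_integral_le (f := fun s => ex (s * θ) * u' s) (by fun_prop) hτ n).trans hI
    have h2 := congrArg norm e1
    rw [norm_mul, norm_mul, Complex.norm_I, one_mul, Complex.norm_real, Real.norm_eq_abs] at h2
    set S := ‖∑ m ∈ Finset.range n, ex (m * τ * x) *
      ∫ s in (0:ℝ)..(m : ℝ) * τ, ex (s * θ) * u s‖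
    have h3 : |θ| * S ≤ 2 * D₂ * V + D₁ * V + 2 * D₁ * V := by
      rw [h2]
      exact (norm_sub_le _ _).trans (add_le_add ((norm_sub_le _ _).trans (add_le_add b1 b2)) b3)
    have hS : 0 ≤ S := norm_nonneg _
    nlinarith [mul_nonneg hT hDV2, mul_nonneg hT hDV1]

end IsPath

lemma norm_ex_sub_one (t : ℝ) : ‖ex t - 1‖ = 2 * |sin (t / 2)| := by
  have := Complex.norm_exp_I_mul_ofReal_sub_one t
  rw [ex, this, norm_mul, Real.norm_eq_abs, Real.norm_eq_abs, abs_of_pos (by norm_num : (0:ℝ) < 2)]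

lemma ex_int_mul_two_pi (k : ℤ) : ex (k * (2 * π)) = 1 := by
  unfold ex
  rw [Complex.exp_eq_one_iff]
  exact ⟨k, by push_cast; ring⟩

lemma expSum_mul (τ : ℝ) (n : ℕ) (t : ℝ) :
    expSum τ n t * (ex (τ * t) - 1) = ex (n * τ * t) - 1 := by
  have e : ∀ m : ℕ, ex (m * τ * t) = ex (τ * t) ^ m := by
    intro m
    unfold ex
    rw [← Complex.exp_nat_mul]; congr 1; push_cast; ring
  simp only [expSum, e]
  exact geom_sum_mul _ _

lemma norm_expSum_le (τ : ℝ) (n : ℕ) (t : ℝ) : ‖expSum τ n t‖ ≤ n := by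
  refine (norm_sum_le _ _).trans ?_
  simp [norm_ex]

/-- Compatibility of the frequency cell width `h`, the step size `τ` and the number `L` of
cells per period `2π/τ`. -/
structure Grid (τ h : ℝ) (L : ℕ) : Prop where
  pos : 0 < τ
  period : τ * h * L = 2 * π
  one_le : 1 ≤ h
  six_le : 6 ≤ L

/-- The index of the frequency cell containing `t`. -/
noncomputable def cell (h t : ℝ) : ℤ := ⌊t / h⌋

lemma cell_zero (h : ℝ) : cell h 0 = 0 := by simp [cell]

lemma measurable_cell (h : ℝ) : Measurable (cell h) :=
  Int.measurable_floor.comp (measurable_id.div_const h)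

lemma exists_grid {τ : ℝ} (hτ : 0 < τ) (h1 : τ ≤ 1) :
    ∃ h, ∃ L : ℕ, Grid τ h L ∧ h ≤ 2 := by
  have hπ := Real.pi_gt_three
  have h6 : (6:ℝ) ≤ 2 * π / τ := by rw [le_div_iff₀ hτ]; nlinarith
  have hL6 : 6 ≤ ⌊2 * π / τ⌋₊ := Nat.le_floor (by exact_mod_cast h6)
  have hle : ((⌊2 * π / τ⌋₊ : ℕ) : ℝ) ≤ 2 * π / τ := Nat.floor_le (by linarith)
  have hlt := Nat.lt_floor_add_one (2 * π / τ)
  have hL6' : (6:ℝ) ≤ (⌊2 * π / τ⌋₊ : ℕ) := by exact_mod_cast hL6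
  refine ⟨2 * π / τ / (⌊2 * π / τ⌋₊ : ℕ), ⌊2 * π / τ⌋₊, ⟨hτ, ?_, ?_, hL6⟩, ?_⟩
  · field_simp
  · rw [le_div_iff₀ (by linarith)]; linarith
  · rw [div_le_iff₀ (by linarith)]; linarith

namespace Grid
variable {τ h : ℝ} {L : ℕ} (G : Grid τ h L)
include G

lemma h_pos : 0 < h := zero_lt_one.trans_le G.one_le

lemma one_le_L : 1 ≤ L := by have := G.six_le; omega

lemma six_le_cast : (6:ℝ) ≤ L := by exact_mod_cast G.six_le

lemma tau_mul_L_le : τ * L ≤ 2 * π := by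
  have := G.period; have := G.one_le; have := G.pos; have := G.six_le_cast
  have : 0 ≤ τ * L * (h - 1) := by apply mul_nonneg (by positivity); linarith
  nlinarith

lemma abs_sub_cell_le (s t : ℝ) :
    |(s - t) - h * ((cell h s - cell h t : ℤ) : ℝ)| ≤ h := by
  have hh := G.h_pos
  have h1 := Int.floor_le (s / h)
  have h2 := Int.lt_floor_add_one (s / h)
  have h3 := Int.floor_le (t / h)
  have h4 := Int.lt_floor_add_one (t / h)
  have e : (s - t) - h * ((cell h s - cell h t : ℤ) : ℝ) =
      h * ((s / h - ⌊s / h⌋) - (t / h - ⌊t / h⌋)) := by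
    unfold cell; push_cast; field_simp; ring
  rw [e, abs_mul, abs_of_pos hh]
  have : |(s / h - ⌊s / h⌋) - (t / h - ⌊t / h⌋)| ≤ 1 := by rw [abs_le]; constructor <;> linarith
  nlinarith

lemma jb_cell_sub_le (s t : ℝ) : jb (cell h s - cell h t) ≤ 2 + |s - t| := by
  have h1 := G.abs_sub_cell_le s t
  have hh := G.one_le
  have h2 : h * |((cell h s - cell h t : ℤ) : ℝ)| ≤ |s - t| + h := by
    have := abs_sub_abs_le_abs_sub (h * ((cell h s - cell h t : ℤ) : ℝ)) (s - t)
    rw [abs_mul, abs_of_pos G.h_pos, abs_sub_comm _ (s - t)] at this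
    linarith
  have h3 := abs_nonneg (s - t)
  unfold jb
  nlinarith [abs_nonneg ((cell h s - cell h t : ℤ) : ℝ)]

lemma jb_cell_le (t : ℝ) : jb (cell h t) ≤ 2 + |t| := by
  simpa [cell_zero] using G.jb_cell_sub_le t 0

lemma abs_ge (s t : ℝ) : h * (jb (cell h s - cell h t) - 2) ≤ |s - t| := by
  have h1 := G.abs_sub_cell_le s t
  have := abs_sub_abs_le_abs_sub (h * ((cell h s - cell h t : ℤ) : ℝ)) (s - t)
  rw [abs_mul, abs_of_pos G.h_pos, abs_sub_comm _ (s - t)] at this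
  unfold jb
  linarith

lemma abs_le (t : ℝ) : |t| ≤ h * jb (cell h t) := by
  have h1 := G.abs_sub_cell_le t 0
  rw [sub_zero, cell_zero, sub_zero] at h1
  have := abs_sub_abs_le_abs_sub t (h * (cell h t : ℝ))
  rw [abs_mul, abs_of_pos G.h_pos] at this
  unfold jb
  linarith

lemma inv_le (s t : ℝ) : (1 + |s - t|)⁻¹ ≤ 2 * (jb (cell h s - cell h t))⁻¹ := by
  have h1 := G.jb_cell_sub_le s t
  have h2 := jb_pos (cell h s - cell h t)
  have h3 := abs_nonneg (s - t)
  rw [← div_eq_mul_inv, inv_le_iff_one_le_mul₀ (by positivity)]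
  rw [mul_comm, ← mul_div_assoc, le_div_iff₀ h2]
  linarith

lemma norm_osc_le {u v : ℝ} (huv : |v - u| ≤ τ) (s t : ℝ) :
    ‖osc u v (s - t)‖ ≤ 2 * τ * pw L (cell h s - cell h t) := by
  have hτ := G.pos
  have h6 := G.six_le_cast
  have hj := jb_pos (cell h s - cell h t)
  have h1 := (norm_osc_le_abs u v (s - t)).trans huv
  have h0 := norm_nonneg (osc u v (s - t))
  rcases le_total (jb (cell h s - cell h t)) L with hl | hl
  · rw [pw_eq_one hl]; linarith
  · have h2 := norm_osc_mul_le u v (s - t)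
    have h3 := G.abs_ge s t
    have hh := G.one_le
    have hp := G.period
    have hπ := Real.pi_gt_three
    unfold pw
    rw [mul_min_of_nonneg _ _ (by positivity)]
    refine le_min (by linarith) ?_
    rw [← mul_div_assoc, le_div_iff₀ hj]
    set S := ‖osc u v (s - t)‖
    set b := jb (cell h s - cell h t)
    have h4 : h * (b * (2 / 3)) * S ≤ 2 :=
      le_trans (by gcongr; exact le_trans (by gcongr; linarith) h3) h2
    have h5 : h * (S * b) ≤ h * (2 * τ * L) := by nlinarith
    exact le_of_mul_le_mul_left h5 G.h_pos

lemma norm_osc_le' {u v : ℝ} (huv : |v - u| ≤ τ) (t : ℝ) :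
    ‖osc u v t‖ ≤ 2 * τ * pw L (cell h t) := by
  simpa [cell_zero] using G.norm_osc_le huv t 0

omit G in
lemma inv_le_dw (hL : 1 ≤ L) (m k : ℤ) : (1 + |((m - L * k : ℤ) : ℝ)|)⁻¹ ≤ dw L m := by
  have key : ∀ m k : ℤ, 0 ≤ m - L * k → (1 + |((m - L * k : ℤ) : ℝ)|)⁻¹ ≤ dwp L m := by
    intro m k hk
    have h1 : m % (L : ℤ) = (m - L * k) % (L : ℤ) := by simp
    have h2 : (m - L * k) % (L : ℤ) ≤ m - L * k := by
      have := Int.emod_add_mul_ediv (m - L * k) L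
      have h3 : 0 ≤ (m - L * k) / (L : ℤ) := Int.ediv_nonneg hk (by omega)
      have : 0 ≤ (L : ℤ) * ((m - L * k) / (L : ℤ)) := by positivity
      omega
    have h3 : ((m % (L : ℤ) : ℤ) : ℝ) ≤ ((m - L * k : ℤ) : ℝ) := by rw [h1]; exact_mod_cast h2
    have h4 := emod_cast_nonneg hL m
    rw [dwp, one_div, abs_of_nonneg (by exact_mod_cast hk)]
    gcongr
  rcases le_total 0 (m - L * k) with hk | hk
  · exact (key m k hk).trans (le_add_of_nonneg_right (dwp_nonneg hL _))
  · have h1 := key (-m) (-k) (by linarith)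
    have e : (-m - L * -k) = -(m - L * k) := by ring
    rw [e, Int.cast_neg, abs_neg] at h1
    exact h1.trans (le_add_of_nonneg_left (dwp_nonneg hL _))

lemma norm_expSum_le {n : ℕ} {T : ℝ} (hn : n * τ ≤ T) (s t : ℝ) :
    ‖expSum τ n (s - t)‖ ≤ (2 * T + π) / τ * dw L (cell h s - cell h t) := by
  have hτ := G.pos
  have h6 := G.six_le_cast
  have hh := G.one_le
  have hp := G.period
  have hπ := Real.pi_gt_three
  set x := s - t
  set m := cell h s - cell h t
  set k := round (x / (h * L))
  set u := x - h * L * k with hu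
  have hhL : 0 < h * L := by have := G.h_pos; positivity
  have hu1 : |u| ≤ h * L / 2 := by
    have h1 := abs_sub_round (x / (h * L))
    have e : u = h * L * (x / (h * L) - round (x / (h * L))) := by
      rw [hu, mul_sub, mul_div_cancel₀ _ hhL.ne']
    rw [e, abs_mul, abs_of_pos hhL]
    nlinarith
  have e1 : ex (τ * x) = ex (τ * u) := by
    have : τ * x = k * (2 * π) + τ * u := by rw [hu, ← hp]; ring
    rw [this, ex_add, ex_int_mul_two_pi, one_mul]
  have e2 := congrArg norm (expSum_mul τ n x)
  rw [e1, norm_mul, norm_ex_sub_one] at e2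
  have h1 : 2 / π * |τ * u / 2| ≤ |sin (τ * u / 2)| := by
    refine Real.mul_abs_le_abs_sin ?_
    rw [abs_div, abs_mul, abs_of_pos hτ, abs_two]
    nlinarith
  have h2 : ‖ex (n * τ * x) - 1‖ ≤ 2 := by
    refine (norm_sub_le _ _).trans ?_
    rw [norm_ex, norm_one]; norm_num
  have hS0 := norm_nonneg (expSum τ n x)
  have h3 : τ * ‖expSum τ n x‖ * |u| ≤ π := by
    rw [abs_div, abs_mul, abs_of_pos hτ, abs_two] at h1
    have h4 : τ * |u| ≤ π * |sin (τ * u / 2)| := by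
      have := mul_le_mul_of_nonneg_left h1 Real.pi_pos.le
      field_simp at this
      linarith
    have h5 := mul_le_mul_of_nonneg_left h4 hS0
    have : π * (‖expSum τ n x‖ * (2 * |sin (τ * u / 2)|)) ≤ π * 2 := by
      rw [e2]; gcongr
    linarith
  have h4 : τ * ‖expSum τ n x‖ ≤ T := by
    have := _root_.norm_expSum_le τ n x
    nlinarith
  have h5 : |((m - L * k : ℤ) : ℝ)| ≤ |u| + 1 := by
    have h7 := G.abs_sub_cell_le s t
    have e : h * ((m - L * k : ℤ) : ℝ) = u - (x - h * (m : ℝ)) := by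
      rw [hu]; push_cast; ring
    have h8 := congrArg abs e
    rw [abs_mul, abs_of_pos G.h_pos] at h8
    have h9 := abs_sub u (x - h * (m : ℝ))
    have := abs_nonneg u
    have := abs_nonneg ((m - L * k : ℤ) : ℝ)
    have h10 : h * |((m - L * k : ℤ) : ℝ)| ≤ h * (|u| + 1) := by nlinarith
    exact le_of_mul_le_mul_left h10 G.h_pos
  have h6 := inv_le_dw G.one_le_L m k
  have h7 : (2 + |u|)⁻¹ ≤ dw L m := by
    refine le_trans (inv_anti₀ ?_ ?_) h6
    · have := abs_nonneg ((m - L * k : ℤ) : ℝ); linarith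
    · linarith
  have h8 : ‖expSum τ n x‖ ≤ (2 * T + π) / τ * (2 + |u|)⁻¹ := by
    have := abs_nonneg u
    rw [← div_eq_mul_inv, div_div, le_div_iff₀ (by positivity)]
    nlinarith
  refine h8.trans ?_
  have hT : 0 ≤ T := le_trans (by positivity) hn
  gcongr

end Grid

/-- Difference of the exact and the frozen filter of one step. -/
noncomputable def inner' (τ s t : ℝ) : ℂ := osc 0 τ (s - t) - osc 0 τ s

lemma isPath_ex_sub_one {τ : ℝ} (t : ℝ) :
    IsPath τ (τ * |t|) (fun r => ex (r * t) - 1) (fun r => Complex.I * t * ex (r * t)) where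
  deriv s := (hasDerivAt_ex t s).sub_const 1
  cont := by fun_prop
  bound := by
    simp [norm_ex, ex_zero]

namespace Grid
variable {τ h : ℝ} {L : ℕ} (G : Grid τ h L)
include G

lemma norm_inner_le_abs (s t : ℝ) :
    ‖inner' τ s t‖ ≤ 2 * τ * pw L (cell h s) * (τ * |t|) := by
  have hτ := G.pos
  have e : inner' τ s t = ∫ r in (0:ℝ)..τ, ex (r * s) * (ex (r * -t) - 1) := by
    unfold inner' osc
    rw [← intervalIntegral.integral_sub (Continuous.intervalIntegrable (by fun_prop) _ _)
      (Continuous.intervalIntegrable (by fun_prop) _ _)]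
    refine intervalIntegral.integral_congr fun r _ => ?_
    change ex (r * (s - t)) - ex (r * s) = ex (r * s) * (ex (r * -t) - 1)
    rw [mul_sub (ex _), mul_one, ← ex_add]
    congr 2; ring
  rw [e, ← abs_neg t]
  refine (isPath_ex_sub_one (-t)).norm_integral_ex_mul_le le_rfl hτ.le le_rfl ?_
  intro r h0 h1
  exact G.norm_osc_le' (by rw [abs_of_nonneg] <;> linarith) s

lemma norm_inner_le (s t : ℝ) :
    ‖inner' τ s t‖ ≤ 4 * π * τ * inn L (cell h s) (cell h t) := by
  have hτ := G.pos
  have hπ := Real.pi_gt_three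
  have h6 := G.six_le_cast
  have hp0 := pw_nonneg L (cell h s)
  unfold inn
  split_ifs with hj
  · refine (G.norm_inner_le_abs s t).trans ?_
    have h1 := G.abs_le t
    have h2 : τ * |t| ≤ 2 * π * (jb (cell h t) / L) := by
      rw [← G.period, mul_assoc τ, mul_assoc τ]
      gcongr
      refine h1.trans (le_of_eq ?_)
      field_simp
    calc _ ≤ 2 * τ * pw L (cell h s) * (2 * π * (jb (cell h t) / L)) := by gcongr
      _ = _ := by ring
  · refine (norm_sub_le _ _).trans ?_
    have h1 := G.norm_osc_le (u := 0) (v := τ) (by simp [abs_of_pos hτ]) s t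
    have h2 := G.norm_osc_le' (u := 0) (v := τ) (by simp [abs_of_pos hτ]) s
    have hp1 := pw_nonneg L (cell h s - cell h t)
    have : 0 ≤ (pw L (cell h s) + pw L (cell h s - cell h t)) * τ := by positivity
    nlinarith

end Grid

/-- `z` is represented by the density `f` against the kernel `k ξ`. -/
def KernelRep (k : ℝ → ℝ → ℂ) (ξ : ℝ) (z : ℂ) (f : ℝ → ℂ) : Prop :=
  Integrable (fun η => k ξ η * f η) ∧ z = ∫ η, k ξ η * f η

namespace KernelRep
variable {k : ℝ → ℝ → ℂ} {ξ : ℝ}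

lemma add {z w : ℂ} {f g : ℝ → ℂ} (hf : KernelRep k ξ z f) (hg : KernelRep k ξ w g) :
    KernelRep k ξ (z + w) (fun η => f η + g η) := by
  constructor
  · simp only [mul_add]
    exact hf.1.add hg.1
  · simp only [mul_add]
    rw [integral_add hf.1 hg.1, hf.2, hg.2]

lemma const_mul {z : ℂ} {f : ℝ → ℂ} (c : ℂ) (hf : KernelRep k ξ z f) :
    KernelRep k ξ (c * z) (fun η => c * f η) := by
  have e : ∀ η, k ξ η * (c * f η) = c * (k ξ η * f η) := fun η => by ring
  constructor
  · simpa only [e] using hf.1.const_mul c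
  · simp only [e]
    rw [integral_const_mul, hf.2]

lemma sum {ι : Type*} (s : Finset ι) {z : ι → ℂ} {f : ι → ℝ → ℂ}
    (hf : ∀ i ∈ s, KernelRep k ξ (z i) (f i)) :
    KernelRep k ξ (∑ i ∈ s, z i) (fun η => ∑ i ∈ s, f i η) := by
  constructor
  · simp only [Finset.mul_sum]
    exact integrable_finsetSum _ fun i hi => (hf i hi).1
  · simp only [Finset.mul_sum]
    rw [integral_finsetSum _ fun i hi => (hf i hi).1]
    exact Finset.sum_congr rfl fun i hi => (hf i hi).2

lemma enorm_le {z : ℂ} {f : ℝ → ℂ} (hf : KernelRep k ξ z f) :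
    ‖z‖ₑ ≤ ∫⁻ η, ‖k ξ η‖ₑ * ‖f η‖ₑ := by
  rw [hf.2]
  refine (enorm_integral_le_lintegral_enorm _).trans (le_of_eq ?_)
  simp only [enorm_mul]

lemma enorm_le_of_le {z : ℂ} {f : ℝ → ℂ} {b : ℝ → ℝ≥0∞} (hf : KernelRep k ξ z f)
    (h : ∀ η, ‖f η‖ₑ ≤ b η) : ‖z‖ₑ ≤ ∫⁻ η, ‖k ξ η‖ₑ * b η :=
  hf.enorm_le.trans (lintegral_mono fun η => mul_le_mul_right (h η) _)

end KernelRep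

/-- A solution of the twisted Duhamel equation with kernel `k` and phase `A`, all of whose
trajectories are `C¹` paths, with size controlled by an integrable majorant `V`. -/
structure DuhamelFlow (T K : ℝ) (A : ℝ → ℝ) (k : ℝ → ℝ → ℂ) (V : ℝ → ℝ) (ψ g : ℝ → ℝ → ℂ) :
    Prop where
  T_nonneg : 0 ≤ T
  meas_A : Measurable A
  meas_k : Measurable (Function.uncurry k)
  bound_k : ∀ ξ η, ‖k ξ η‖ ≤ K
  int_V : Integrable V
  meas_V : Measurable V
  meas : Measurable (Function.uncurry ψ)
  path : ∀ η, IsPath T (V η) (fun s => ψ s η) (fun s => g s η)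
  rate : ∀ s, 0 ≤ s → s ≤ T → ∀ ξ, g s ξ = ∫ η, k ξ η * (ex (s * (A ξ - A η)) * ψ s η)

namespace DuhamelFlow
variable {T K : ℝ} {A : ℝ → ℝ} {k : ℝ → ℝ → ℂ} {V : ℝ → ℝ} {ψ g : ℝ → ℝ → ℂ}
  (S : DuhamelFlow T K A k V ψ g)
include S

lemma norm_le {s : ℝ} (hs : 0 ≤ s) (hsT : s ≤ T) (η : ℝ) : ‖ψ s η‖ ≤ V η :=
  (S.path η).norm_le hs hsT

lemma V_nonneg (η : ℝ) : 0 ≤ V η := (S.path η).nonneg S.T_nonneg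

lemma K_nonneg : 0 ≤ K := (norm_nonneg _).trans (S.bound_k 0 0)

lemma rep_const {s : ℝ} (hs : 0 ≤ s) (hsT : s ≤ T) (ξ t : ℝ) :
    KernelRep k ξ (∫ η, k ξ η * (ex (t * (A ξ - A η)) * ψ s η))
      (fun η => ex (t * (A ξ - A η)) * ψ s η) := by
  refine ⟨?_, rfl⟩
  refine (S.int_V.const_mul K).mono' ?_ (Filter.Eventually.of_forall fun η => ?_)
  · have h1 : Measurable fun η => k ξ η := S.meas_k.comp measurable_prodMk_left
    have h2 : Measurable fun η => ψ s η := S.meas.comp measurable_prodMk_left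
    have h3 := S.meas_A
    have h4 : Measurable ex := continuous_ex.measurable
    exact (h1.mul ((h4.comp (by fun_prop)).mul h2)).aestronglyMeasurable
  · rw [norm_mul, norm_mul, norm_ex, one_mul]
    exact mul_le_mul (S.bound_k _ _) (S.norm_le hs hsT _) (norm_nonneg _) S.K_nonneg

lemma rep_integral {a b : ℝ} (ha : 0 ≤ a) (hab : a ≤ b) (hb : b ≤ T) {c : ℝ → ℂ}
    (hc : Continuous c) (ξ : ℝ) :
    KernelRep k ξ (∫ r in a..b, c r * g r ξ)
      (fun η => ∫ r in a..b, c r * (ex (r * (A ξ - A η)) * ψ r η)) := by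
  obtain ⟨M, hM⟩ := (isCompact_Icc (a := a) (b := b)).exists_bound_of_continuousOn
    hc.continuousOn
  have hInt : Integrable (fun p : ℝ × ℝ =>
      k ξ p.2 * (c p.1 * (ex (p.1 * (A ξ - A p.2)) * ψ p.1 p.2)))
      ((volume.restrict (Set.Ioc a b)).prod volume) := by
    have hm : Measurable (fun p : ℝ × ℝ =>
        k ξ p.2 * (c p.1 * (ex (p.1 * (A ξ - A p.2)) * ψ p.1 p.2))) := by
      have h1 : Measurable fun p : ℝ × ℝ => k ξ p.2 :=
        S.meas_k.comp (measurable_const.prodMk measurable_snd)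
      have h2 : Measurable fun p : ℝ × ℝ => ψ p.1 p.2 := S.meas
      have h3 := S.meas_A
      have h4 : Measurable ex := continuous_ex.measurable
      have h5 := hc.measurable
      exact h1.mul ((h5.comp measurable_fst).mul ((h4.comp (by fun_prop)).mul h2))
    have hV : Integrable (fun p : ℝ × ℝ => K * (M * V p.2))
        ((volume.restrict (Set.Ioc a b)).prod volume) :=
      ((S.int_V.const_mul M).const_mul K).comp_snd _
    refine hV.mono' hm.aestronglyMeasurable ?_
    have h0 : ∀ᵐ p ∂((volume.restrict (Set.Ioc a b)).prod volume : Measure (ℝ × ℝ)),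
        p.1 ∈ Set.Ioc a b :=
      Measure.quasiMeasurePreserving_fst.ae (ae_restrict_mem measurableSet_Ioc)
    filter_upwards [h0] with p hp
    rw [norm_mul, norm_mul, norm_mul, norm_ex, one_mul]
    have h1 := hM p.1 ⟨hp.1.le, hp.2⟩
    have h2 := S.norm_le (ha.trans hp.1.le) (hp.2.trans hb) p.2
    have h3 := S.bound_k ξ p.2
    have h4 := S.K_nonneg
    have h5 : 0 ≤ M := (norm_nonneg _).trans h1
    gcongr
  have e : ∀ η, k ξ η * (∫ r in a..b, c r * (ex (r * (A ξ - A η)) * ψ r η)) =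
      ∫ r in Set.Ioc a b, k ξ η * (c r * (ex (r * (A ξ - A η)) * ψ r η)) := fun η => by
    rw [intervalIntegral.integral_of_le hab, integral_const_mul]
  constructor
  · simp only [e]
    exact hInt.integral_prod_right
  · simp only [e]
    rw [← integral_integral_swap (f := fun r η =>
      k ξ η * (c r * (ex (r * (A ξ - A η)) * ψ r η))) hInt,
      intervalIntegral.integral_of_le hab]
    refine setIntegral_congr_fun measurableSet_Ioc fun r hr => ?_
    rw [S.rate r (ha.trans hr.1.le) (hr.2.trans hb), ← integral_const_mul]
    exact integral_congr_ae (Filter.Eventually.of_forall fun η => by ring)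

end DuhamelFlow

/-- The double oscillatory integral of one step. -/
noncomputable def oscJ (τ x y : ℝ) : ℂ := ∫ r in (0:ℝ)..τ, osc r τ x * ex (r * y)

lemma oscJ_mul (τ x y : ℝ) :
    Complex.I * y * oscJ τ x y = osc 0 τ (x + y) - osc 0 τ x := by
  have ho := continuous_osc_left τ x
  have h1 : ∫ r in (0:ℝ)..τ, (-ex (r * x) * ex (r * y) + osc r τ x * (Complex.I * y * ex (r * y))) =
      osc τ τ x * ex (τ * y) - osc 0 τ x * ex (0 * y) :=
    intervalIntegral.integral_eq_sub_of_hasDerivAt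
      (fun r _ => (hasDerivAt_osc_left τ x r).mul (hasDerivAt_ex y r))
      (Continuous.intervalIntegrable (by fun_prop) _ _)
  rw [intervalIntegral.integral_add (Continuous.intervalIntegrable (by fun_prop) _ _)
    (Continuous.intervalIntegrable (by fun_prop) _ _)] at h1
  have h2 : osc τ τ x = 0 := by simp [osc]
  have h3 : ∫ r in (0:ℝ)..τ, -ex (r * x) * ex (r * y) = -osc 0 τ (x + y) := by
    unfold osc
    rw [← intervalIntegral.integral_neg]
    refine intervalIntegral.integral_congr fun r _ => ?_
    rw [mul_add r, ex_add]; ring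
  have h4 : ∫ r in (0:ℝ)..τ, osc r τ x * (Complex.I * y * ex (r * y)) =
      Complex.I * y * oscJ τ x y := by
    rw [oscJ, ← intervalIntegral.integral_const_mul]
    refine intervalIntegral.integral_congr fun r _ => ?_
    ring
  rw [h2, h3, h4, zero_mul, zero_mul, ex_zero] at h1
  linear_combination h1

lemma norm_oscJ_le {τ x y ω : ℝ} (hτ : 0 ≤ τ)
    (hω : ∀ r, 0 ≤ r → r ≤ τ → ‖osc r τ x‖ ≤ ω) : ‖oscJ τ x y‖ ≤ ω * τ := by
  have := intervalIntegral.norm_integral_le_of_norm_le_const (C := ω) (a := 0) (b := τ)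
    (f := fun r => osc r τ x * ex (r * y)) (fun r hr => by
      rw [Set.uIoc_of_le hτ] at hr
      rw [norm_mul, norm_ex, mul_one]; exact hω r hr.1.le hr.2)
  rwa [sub_zero, abs_of_nonneg hτ] at this

lemma integral_osc_mul_ex (a τ x y : ℝ) :
    ∫ r in a..a + τ, osc r (a + τ) x * ex (r * y) = ex (a * (x + y)) * oscJ τ x y := by
  have := intervalIntegral.integral_comp_add_left
    (fun r => osc r (a + τ) x * ex (r * y)) a (a := 0) (b := τ)
  rw [add_zero] at this
  rw [← this, oscJ, ← intervalIntegral.integral_const_mul]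
  refine intervalIntegral.integral_congr fun r _ => ?_
  rw [osc_shift, add_mul a r y, ex_add, mul_add a x y, ex_add]; ring

/-- The density of the second-order part of the defect. -/
noncomputable def defectDensity (τ : ℝ) (n : ℕ) (a b c : ℝ) (u : ℝ → ℂ) : ℂ :=
  ∑ m ∈ Finset.range n,
    (inner' τ a b * (ex (m * τ * (a - b)) * ∫ r in (0:ℝ)..m * τ, ex (r * (b - c)) * u r) +
      ∫ r in (m * τ)..(m * τ + τ), osc r (m * τ + τ) (a - b) * (ex (r * (b - c)) * u r))

/-- The part of the defect density with `u` frozen at the beginning of each step. -/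
noncomputable def defectMain (τ : ℝ) (n : ℕ) (a b c : ℝ) (u : ℝ → ℂ) : ℂ :=
  ∑ m ∈ Finset.range n,
    (inner' τ a b * (ex (m * τ * (a - b)) * ∫ r in (0:ℝ)..m * τ, ex (r * (b - c)) * u r) +
      ex (m * τ * (a - c)) * oscJ τ (a - b) (b - c) * u (m * τ))

/-- Exponential sum of sampled primitives. -/
noncomputable def primSum (τ : ℝ) (n : ℕ) (x y : ℝ) (f : ℝ → ℂ) : ℂ :=
  ∑ m ∈ Finset.range n, ex (m * τ * x) * ∫ r in (0:ℝ)..m * τ, ex (r * y) * f r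

namespace IsPath
variable {T V : ℝ} {u u' : ℝ → ℂ} (hu : IsPath T V u u')
include hu

lemma norm_density_sub_main_le {τ : ℝ} {n : ℕ} {a b c ω Q : ℝ} (hτ : 0 ≤ τ) (hQ : 0 ≤ Q)
    (hω : ∀ v r, 0 ≤ v - r → v - r ≤ τ → ‖osc r v (a - b)‖ ≤ ω)
    (hn : (n : ℝ) * τ ≤ T)
    (hQu : ∀ m < n, ∀ r, m * τ ≤ r → r ≤ m * τ + τ → ‖u r - u (m * τ)‖ ≤ Q) :
    ‖defectDensity τ n a b c u - defectMain τ n a b c u‖ ≤ T * (ω * Q) := by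
  have hcu := hu.continuous
  have hω0 : 0 ≤ ω := (norm_nonneg _).trans (hω 0 0 (by simp) (by simpa))
  have key : ∀ m ∈ Finset.range n,
      ‖(∫ r in (m * τ)..(m * τ + τ), osc r (m * τ + τ) (a - b) * (ex (r * (b - c)) * u r)) -
        ex (m * τ * (a - c)) * oscJ τ (a - b) (b - c) * u (m * τ)‖ ≤ ω * Q * τ := by
    intro m hm
    have ho := continuous_osc_left (m * τ + τ) (a - b)
    have e1 := integral_osc_mul_ex (m * τ) τ (a - b) (b - c)
    rw [sub_add_sub_cancel] at e1
    rw [← e1, ← intervalIntegral.integral_mul_const,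
      ← intervalIntegral.integral_sub (Continuous.intervalIntegrable (by fun_prop) _ _)
        (Continuous.intervalIntegrable (by fun_prop) _ _)]
    have := intervalIntegral.norm_integral_le_of_norm_le_const (C := ω * Q)
      (a := m * τ) (b := m * τ + τ)
      (f := fun r => osc r (m * τ + τ) (a - b) * (ex (r * (b - c)) * u r) -
        osc r (m * τ + τ) (a - b) * ex (r * (b - c)) * u (m * τ)) (fun r hr => by
        rw [Set.uIoc_of_le (by linarith)] at hr
        rw [← mul_assoc, ← mul_sub, norm_mul, norm_mul, norm_ex, mul_one]
        exact mul_le_mul (hω _ _ (by linarith [hr.2]) (by linarith [hr.1]))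
          (hQu m (Finset.mem_range.1 hm) r hr.1.le hr.2) (norm_nonneg _) hω0)
    rwa [add_sub_cancel_left, abs_of_nonneg hτ] at this
  rw [defectDensity, defectMain, ← Finset.sum_sub_distrib]
  refine (norm_sum_le _ _).trans
    ((Finset.sum_le_sum (g := fun _ => ω * Q * τ) fun m hm => ?_).trans ?_)
  · rw [add_sub_add_left_eq_sub]; exact key m hm
  · rw [Finset.sum_const, Finset.card_range, nsmul_eq_mul]
    have : 0 ≤ ω * Q := by positivity
    nlinarith

lemma defectMain_mul (τ : ℝ) (n : ℕ) (a b c : ℝ) :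
    Complex.I * (b - c : ℝ) * defectMain τ n a b c u =
      inner' τ a c * (expSum τ n (a - c) * u 0 + primSum τ n (a - c) 0 u') -
      inner' τ a b * (expSum τ n (a - b) * u 0 + primSum τ n (a - b) (b - c) u') := by
  simp only [defectMain, expSum, primSum, Finset.mul_sum, Finset.sum_mul,
    ← Finset.sum_add_distrib, ← Finset.sum_sub_distrib]
  refine Finset.sum_congr rfl fun m _ => ?_
  have h1 := hu.integral_ex_mul' 0 (m * τ) (b - c)
  have h2 := oscJ_mul τ (a - b) (b - c)
  have h3 := hu.integral_eq 0 (m * τ)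
  rw [zero_mul, ex_zero, one_mul] at h1
  rw [sub_add_sub_cancel] at h2
  have h4 : ∫ r in (0:ℝ)..m * τ, ex (r * 0) * u' r = u (m * τ) - u 0 := by
    simp only [mul_zero, ex_zero, one_mul, h3]
  have h5 : ex (m * τ * (a - b)) * ex (m * τ * (b - c)) = ex (m * τ * (a - c)) := by
    rw [← ex_add]; congr 1; ring
  rw [h4]
  unfold inner'
  linear_combination (osc 0 τ (a - b) - osc 0 τ a) * ex (m * τ * (a - b)) * h1 +
    ex (m * τ * (a - c)) * u (m * τ) * h2 + (osc 0 τ (a - b) - osc 0 τ a) * u (m * τ) * h5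

lemma norm_defectMain_le {τ : ℝ} {n : ℕ} {a b c ω D₁ D₂ M : ℝ} (hτ : 0 ≤ τ)
    (hω : ∀ r, 0 ≤ r → r ≤ τ → ‖osc r τ (a - b)‖ ≤ ω) (hn : (n : ℝ) * τ ≤ T)
    (hD₁ : ∀ m ≤ n, ‖expSum τ m (a - b)‖ ≤ D₁) (hD₂ : ∀ m ≤ n, ‖expSum τ m (a - c)‖ ≤ D₂)
    (hM : ∀ r, 0 ≤ r → r ≤ T → ‖u r‖ ≤ M) :
    ‖defectMain τ n a b c u‖ ≤
      ‖inner' τ a b‖ * (2 * D₁ * (T * M)) + ω * τ * (2 * D₂ * V) := by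
  have h1 := hu.norm_sum_ex_mul_integral_le (θ := b - c) hτ hn hD₁ hM
  have h2 := hu.norm_sum_ex_mul_le hτ hn hD₂
  have h3 := norm_oscJ_le (y := b - c) hτ hω
  have e : defectMain τ n a b c u =
      inner' τ a b * ∑ m ∈ Finset.range n, ex (m * τ * (a - b)) *
        (∫ r in (0:ℝ)..m * τ, ex (r * (b - c)) * u r) +
      oscJ τ (a - b) (b - c) * ∑ m ∈ Finset.range n, ex (m * τ * (a - c)) * u (m * τ) := by
    rw [defectMain, Finset.mul_sum, Finset.mul_sum, ← Finset.sum_add_distrib]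
    exact Finset.sum_congr rfl fun m _ => by ring
  have hω0 : 0 ≤ ω := (norm_nonneg _).trans (hω 0 le_rfl hτ)
  rw [e]
  refine (_root_.norm_add_le _ _).trans ?_
  rw [norm_mul, norm_mul]
  gcongr

end IsPath

/-- Weighted action of the kernel on the majorant. -/
noncomputable def kint (k : ℝ → ℝ → ℂ) (V : ℝ → ℝ) (ζ : ℝ) (w : ℝ → ℝ) : ℝ≥0∞ :=
  ∫⁻ θ, ‖k ζ θ‖ₑ * ENNReal.ofReal (w θ * V θ)

/-- Weight of the source terms. -/
noncomputable def srcW (L : ℕ) (i j l : ℤ) : ℝ :=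
  (jb (j - l))⁻¹ * (inn L i l * dw L (i - l) + inn L i j * dw L (i - j))

/-- Weight of the near-diagonal terms. -/
noncomputable def nearW (L : ℕ) (i j l : ℤ) : ℝ := (jb (j - l))⁻¹ * (pw L (i - j) * dw L (i - l))

/-- Weight of the oscillating third-order terms. -/
noncomputable def triW (L : ℕ) (i j l n : ℤ) : ℝ :=
  (jb (j - l))⁻¹ * (jb (l - n))⁻¹ * (inn L i l * (dw L (i - l) + dw L (i - n))) +
    (jb (j - l))⁻¹ * (jb (j - n))⁻¹ * (inn L i j * (dw L (i - j) + dw L (i - n)))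

lemma inv_jb_nonneg (k : ℤ) : 0 ≤ (jb k)⁻¹ := inv_nonneg.2 (jb_pos k).le

lemma srcW_nonneg {L : ℕ} (hL : 1 ≤ L) (i j l : ℤ) : 0 ≤ srcW L i j l := by
  have := inv_jb_nonneg (j - l)
  have := inn_nonneg L i l
  have := inn_nonneg L i j
  have := dw_nonneg hL (i - l)
  have := dw_nonneg hL (i - j)
  unfold srcW; positivity

lemma nearW_nonneg {L : ℕ} (hL : 1 ≤ L) (i j l : ℤ) : 0 ≤ nearW L i j l := by
  have := inv_jb_nonneg (j - l)
  have := pw_nonneg L (i - j)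
  have := dw_nonneg hL (i - l)
  unfold nearW; positivity

lemma triW_nonneg {L : ℕ} (hL : 1 ≤ L) (i j l n : ℤ) : 0 ≤ triW L i j l n := by
  have := inv_jb_nonneg (j - l)
  have := inv_jb_nonneg (l - n)
  have := inv_jb_nonneg (j - n)
  have := inn_nonneg L i l
  have := inn_nonneg L i j
  have := dw_nonneg hL (i - l)
  have := dw_nonneg hL (i - j)
  have := dw_nonneg hL (i - n)
  unfold triW; positivity

lemma enorm_le_ofReal {z : ℂ} {c : ℝ} (h : ‖z‖ ≤ c) : ‖z‖ₑ ≤ ENNReal.ofReal c := by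
  rw [← ofReal_norm]; exact ENNReal.ofReal_le_ofReal h

namespace DuhamelFlow
variable {T K : ℝ} {A : ℝ → ℝ} {k : ℝ → ℝ → ℂ} {V : ℝ → ℝ} {ψ g : ℝ → ℝ → ℂ}
  (S : DuhamelFlow T K A k V ψ g)
include S

lemma kint_mono {w w' : ℝ → ℝ} (h : ∀ θ, w θ ≤ w' θ) (ζ : ℝ) :
    kint k V ζ w ≤ kint k V ζ w' := by
  refine lintegral_mono fun θ => mul_le_mul_right ?_ _
  exact ENNReal.ofReal_le_ofReal (mul_le_mul_of_nonneg_right (h θ) (S.V_nonneg θ))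

lemma kint_add_le {w w' : ℝ → ℝ} (h : ∀ θ, 0 ≤ w θ) (h' : ∀ θ, 0 ≤ w' θ) (ζ : ℝ) :
    kint k V ζ w + kint k V ζ w' ≤ kint k V ζ (fun θ => w θ + w' θ) := by
  refine (le_lintegral_add _ _).trans (lintegral_mono fun θ => ?_)
  rw [← mul_add, add_mul, ENNReal.ofReal_add (mul_nonneg (h θ) (S.V_nonneg θ))
    (mul_nonneg (h' θ) (S.V_nonneg θ))]

omit S in
lemma ofReal_mul_kint_le {c : ℝ} (hc : 0 ≤ c) (w : ℝ → ℝ) (ζ : ℝ) :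
    ENNReal.ofReal c * kint k V ζ w ≤ kint k V ζ (fun θ => c * w θ) := by
  refine (lintegral_const_mul_le _ _).trans (lintegral_mono fun θ => ?_)
  rw [mul_assoc c, ENNReal.ofReal_mul hc]
  exact le_of_eq (by ring)

lemma kint_ne_top {w : ℝ → ℝ} {c : ℝ} (h : ∀ θ, w θ ≤ c) (ζ : ℝ) : kint k V ζ w ≠ ⊤ := by
  have h1 : kint k V ζ w ≤ ∫⁻ θ, ENNReal.ofReal (K * (c * V θ)) := by
    refine lintegral_mono fun θ => ?_
    rw [ENNReal.ofReal_mul S.K_nonneg]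
    exact mul_le_mul' (enorm_le_ofReal (S.bound_k ζ θ))
      (ENNReal.ofReal_le_ofReal (mul_le_mul_of_nonneg_right (h θ) (S.V_nonneg θ)))
  exact ne_top_of_le_ne_top ((S.int_V.const_mul c).const_mul K).lintegral_lt_top.ne h1

lemma enorm_increment_le {a b : ℝ} (ha : 0 ≤ a) (hab : a ≤ b) (hb : b ≤ T) {ζ : ℝ} {w : ℝ → ℝ}
    (hw : ∀ θ r, a ≤ r → r ≤ b → ‖osc r b (A ζ - A θ)‖ ≤ w θ) :
    ‖ψ b ζ - ψ a ζ‖ₑ ≤ kint k V ζ w := by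
  have h1 := S.rep_integral ha hab hb (c := fun _ => 1) continuous_const ζ
  simp only [one_mul] at h1
  rw [(S.path ζ).integral_eq a b] at h1
  exact h1.enorm_le_of_le fun θ => enorm_le_ofReal
    ((S.path θ).norm_integral_ex_mul_le ha hab hb (hw θ))

lemma norm_increment_le {a b : ℝ} (ha : 0 ≤ a) (hab : a ≤ b) (hb : b ≤ T) {ζ c : ℝ} {w : ℝ → ℝ}
    (hw : ∀ θ r, a ≤ r → r ≤ b → ‖osc r b (A ζ - A θ)‖ ≤ w θ) (hc : ∀ θ, w θ ≤ c) :
    ‖ψ b ζ - ψ a ζ‖ ≤ (kint k V ζ w).toReal := by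
  have h1 := S.enorm_increment_le ha hab hb hw
  rw [← toReal_enorm]
  exact ENNReal.toReal_mono (S.kint_ne_top hc ζ) h1

lemma enorm_primSum_le {τ D₁ x y : ℝ} {D₂ : ℝ → ℝ} (hτ : 0 ≤ τ) {n : ℕ} (hn : (n : ℝ) * τ ≤ T)
    (ζ : ℝ) (hD₁ : ∀ m ≤ n, ‖expSum τ m x‖ ≤ D₁)
    (hD₂ : ∀ θ, ∀ m ≤ n, ‖expSum τ m (x + (y + (A ζ - A θ)))‖ ≤ D₂ θ) :
    ‖primSum τ n x y (fun s => g s ζ)‖ₑ ≤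
      kint k V ζ fun θ => (4 * T + 6) * (1 + |y + (A ζ - A θ)|)⁻¹ * (D₁ + D₂ θ) := by
  have h1 : KernelRep k ζ (primSum τ n x y (fun s => g s ζ))
      (fun θ => ∑ m ∈ Finset.range n, ex (m * τ * x) *
        ∫ r in (0:ℝ)..m * τ, ex (r * y) * (ex (r * (A ζ - A θ)) * ψ r θ)) := by
    refine KernelRep.sum _ fun m hm => KernelRep.const_mul _ ?_
    have hm' : (m : ℝ) * τ ≤ T := by
      refine le_trans ?_ hn
      have : m ≤ n := (Finset.mem_range.1 hm).le
      gcongr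
    exact S.rep_integral le_rfl (by positivity) hm' (c := fun r => ex (r * y))
      (by fun_prop) ζ
  refine h1.enorm_le_of_le fun θ => enorm_le_ofReal ?_
  have h2 := (S.path θ).norm_sum_ex_mul_integral_le_decay hτ S.T_nonneg hn hD₁ (hD₂ θ)
  simp only [mul_add _ y, ex_add, mul_assoc (ex _) (ex _)] at h2
  exact h2

variable {τ h : ℝ} {L : ℕ} (G : Grid τ h L)
include G

lemma norm_increment_step_le {a b : ℝ} (ha : 0 ≤ a) (hab : a ≤ b) (hb : b ≤ T) (hτ : b - a ≤ τ)
    (ζ : ℝ) :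
    ‖ψ b ζ - ψ a ζ‖ ≤
      (kint k V ζ fun θ => 2 * τ * pw L (cell h (A ζ) - cell h (A θ))).toReal := by
  have hτ0 := G.pos
  refine S.norm_increment_le ha hab hb (c := 2 * τ)
    (fun θ r h1 h2 => G.norm_osc_le (by rw [abs_of_nonneg] <;> linarith) _ _) fun θ => ?_
  have := pw_le_one L (cell h (A ζ) - cell h (A θ))
  nlinarith

lemma enorm_density_sub_main_le {n : ℕ} (hn : (n : ℝ) * τ ≤ T) (a b ζ : ℝ) :
    ‖defectDensity τ n a b (A ζ) (fun s => ψ s ζ) - defectMain τ n a b (A ζ) (fun s => ψ s ζ)‖ₑ ≤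
      kint k V ζ fun θ => 4 * T *
        (τ ^ 2 * (pw L (cell h a - cell h b) * pw L (cell h (A ζ) - cell h (A θ)))) := by
  have hτ := G.pos
  have hp := pw_nonneg L (cell h a - cell h b)
  have hfin : kint k V ζ (fun θ => 2 * τ * pw L (cell h (A ζ) - cell h (A θ))) ≠ ⊤ := by
    refine S.kint_ne_top (c := 2 * τ) (fun θ => ?_) ζ
    have := pw_le_one L (cell h (A ζ) - cell h (A θ))
    nlinarith
  have h1 := (S.path ζ).norm_density_sub_main_le (c := A ζ) (a := a) (b := b) hτ.le
    ENNReal.toReal_nonneg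
    (fun v r h1 h2 => G.norm_osc_le (by rw [abs_of_nonneg] <;> linarith) _ _) hn
    (fun m hm r h1 h2 => by
      have hm' : (m : ℝ) + 1 ≤ n := by exact_mod_cast hm
      exact S.norm_increment_step_le G (by positivity) h1 (by nlinarith) (by linarith) ζ)
  refine (enorm_le_ofReal h1).trans ?_
  have hT := S.T_nonneg
  rw [← mul_assoc, ENNReal.ofReal_mul (by positivity), ENNReal.ofReal_toReal hfin]
  refine (ofReal_mul_kint_le (by positivity) _ ζ).trans (S.kint_mono (fun θ => le_of_eq ?_) ζ)
  ring

end DuhamelFlow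

/-- The constant of the pointwise defect bound. -/
noncomputable def defectConst (T : ℝ) : ℝ := 400 * (T + 2) ^ 2 * (2 * T + π)

lemma defectConst_nonneg {T : ℝ} (hT : 0 ≤ T) : 0 ≤ defectConst T := by
  unfold defectConst; positivity

namespace DuhamelFlow
variable {T K : ℝ} {A : ℝ → ℝ} {k : ℝ → ℝ → ℂ} {V : ℝ → ℝ} {ψ g : ℝ → ℝ → ℂ}
  (S : DuhamelFlow T K A k V ψ g) {τ h : ℝ} {L : ℕ} (G : Grid τ h L)
include S G

omit S in
lemma norm_expSum_le_of_le {n m : ℕ} (hm : m ≤ n) (hn : (n : ℝ) * τ ≤ T) (s t : ℝ) :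
    ‖expSum τ m (s - t)‖ ≤ (2 * T + π) / τ * dw L (cell h s - cell h t) := by
  have hτ := G.pos
  refine G.norm_expSum_le (le_trans ?_ hn) s t
  gcongr

lemma enorm_primSum_grid_le {n : ℕ} (hn : (n : ℝ) * τ ≤ T) (a b ζ : ℝ) :
    ‖primSum τ n (a - b) (b - A ζ) (fun s => g s ζ)‖ₑ ≤
      kint k V ζ fun θ => 2 * (4 * T + 6) * ((2 * T + π) / τ) *
        ((jb (cell h b - cell h (A θ)))⁻¹ *
        (dw L (cell h a - cell h b) + dw L (cell h a - cell h (A θ)))) := by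
  have hτ := G.pos
  have hT := S.T_nonneg
  have h1 := S.enorm_primSum_le (x := a - b) (y := b - A ζ) hτ.le hn ζ
    (fun m hm => norm_expSum_le_of_le G hm hn a b)
    (D₂ := fun θ => (2 * T + π) / τ * dw L (cell h a - cell h (A θ)))
    (fun θ m hm => by
      have e : a - b + (b - A ζ + (A ζ - A θ)) = a - A θ := by ring
      rw [e]; exact norm_expSum_le_of_le G hm hn a (A θ))
  refine h1.trans (S.kint_mono (fun θ => ?_) ζ)
  rw [sub_add_sub_cancel, ← mul_add]
  have h2 := G.inv_le b (A θ)
  have h3 := dw_nonneg G.one_le_L (cell h a - cell h b)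
  have h4 := dw_nonneg G.one_le_L (cell h a - cell h (A θ))
  calc _ ≤ (4 * T + 6) * (2 * (jb (cell h b - cell h (A θ)))⁻¹) * ((2 * T + π) / τ *
        (dw L (cell h a - cell h b) + dw L (cell h a - cell h (A θ)))) := by gcongr
    _ = _ := by ring

lemma enorm_main_far_le {n : ℕ} (hn : (n : ℝ) * τ ≤ T) (a b ζ : ℝ) (hy : 1 ≤ |b - A ζ|) :
    ‖defectMain τ n a b (A ζ) (fun s => ψ s ζ)‖ₑ ≤
      ENNReal.ofReal (defectConst T *
        (srcW L (cell h a) (cell h b) (cell h (A ζ)) * ‖ψ 0 ζ‖)) +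
      kint k V ζ fun θ => defectConst T *
        triW L (cell h a) (cell h b) (cell h (A ζ)) (cell h (A θ)) := by
  have hτ := G.pos
  have hT := S.T_nonneg
  have hπ := Real.pi_gt_three
  have hπ4 := Real.pi_le_four
  set i := cell h a with hi
  set j := cell h b with hj
  set l := cell h (A ζ) with hl
  have he := inv_jb_nonneg (j - l)
  have hil := inn_nonneg L i l
  have hij := inn_nonneg L i j
  have hdl := dw_nonneg G.one_le_L (i - l)
  have hdj := dw_nonneg G.one_le_L (i - j)
  set X1 := primSum τ n (a - A ζ) 0 (fun s => g s ζ) with hX1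
  set X2 := primSum τ n (a - b) (b - A ζ) (fun s => g s ζ) with hX2
  set u0 := ‖ψ 0 ζ‖ with hu0
  set c := (2 * T + π) with hc
  have hc0 : 0 < c := by positivity
  have hu00 : 0 ≤ u0 := norm_nonneg _
  have hyinv : |b - A ζ|⁻¹ ≤ 4 * (jb (j - l))⁻¹ := by
    have h1 := G.inv_le b (A ζ)
    have h2 : |b - A ζ|⁻¹ ≤ 2 * (1 + |b - A ζ|)⁻¹ := by
      rw [← div_eq_mul_inv, inv_eq_one_div, div_le_div_iff₀ (by linarith) (by linarith)]
      linarith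
    linarith
  have hmain : ‖defectMain τ n a b (A ζ) (fun s => ψ s ζ)‖ ≤
      4 * (jb (j - l))⁻¹ * (4 * π * τ * inn L i l * (c / τ * dw L (i - l) * u0 + ‖X1‖) +
        4 * π * τ * inn L i j * (c / τ * dw L (i - j) * u0 + ‖X2‖)) := by
    have h1 := congrArg norm ((S.path ζ).defectMain_mul τ n a b (A ζ))
    rw [norm_mul, norm_mul, Complex.norm_I, one_mul, Complex.norm_real, Real.norm_eq_abs] at h1
    have h2 : |b - A ζ| * ‖defectMain τ n a b (A ζ) (fun s => ψ s ζ)‖ ≤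
        4 * π * τ * inn L i l * (c / τ * dw L (i - l) * u0 + ‖X1‖) +
        4 * π * τ * inn L i j * (c / τ * dw L (i - j) * u0 + ‖X2‖) := by
      rw [h1]
      refine (norm_sub_le _ _).trans (add_le_add ?_ ?_)
      · rw [norm_mul]
        refine mul_le_mul (G.norm_inner_le a (A ζ)) ?_ (norm_nonneg _) (by positivity)
        refine (norm_add_le _ _).trans ?_
        rw [norm_mul]
        have := norm_expSum_le_of_le G le_rfl hn a (A ζ)
        gcongr
      · rw [norm_mul]
        refine mul_le_mul (G.norm_inner_le a b) ?_ (norm_nonneg _) (by positivity)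
        refine (norm_add_le _ _).trans ?_
        rw [norm_mul]
        have := norm_expSum_le_of_le G le_rfl hn a b
        gcongr
    have hy0 : 0 < |b - A ζ| := by linarith
    rw [← inv_mul_cancel_left₀ hy0.ne' ‖defectMain τ n a b (A ζ) (fun s => ψ s ζ)‖]
    refine mul_le_mul hyinv h2 (by positivity) (by positivity)
  have hsplit : 4 * (jb (j - l))⁻¹ * (4 * π * τ * inn L i l * (c / τ * dw L (i - l) * u0 + ‖X1‖) +
        4 * π * τ * inn L i j * (c / τ * dw L (i - j) * u0 + ‖X2‖)) =
      16 * π * c * (srcW L i j l * u0) + (16 * π * τ * ((jb (j - l))⁻¹ * inn L i l) * ‖X1‖ +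
        16 * π * τ * ((jb (j - l))⁻¹ * inn L i j) * ‖X2‖) := by
    unfold srcW; field_simp; ring
  rw [hsplit] at hmain
  refine (enorm_le_ofReal hmain).trans ?_
  have hs := srcW_nonneg G.one_le_L i j l
  rw [ENNReal.ofReal_add (by positivity) (by positivity)]
  refine add_le_add (ENNReal.ofReal_le_ofReal ?_) ?_
  · refine mul_le_mul_of_nonneg_right ?_ (by positivity)
    unfold defectConst
    refine mul_le_mul_of_nonneg_right ?_ hc0.le
    nlinarith
  · rw [ENNReal.ofReal_add (by positivity) (by positivity),       ENNReal.ofReal_mul (p := 16 * π * τ * ((jb (j - l))⁻¹ * inn L i l)) (by positivity),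
      ENNReal.ofReal_mul (p := 16 * π * τ * ((jb (j - l))⁻¹ * inn L i j)) (by positivity),
      ofReal_norm, ofReal_norm]
    have b1 := S.enorm_primSum_grid_le G hn a (A ζ) ζ
    rw [sub_self, ← hX1, ← hi, ← hl] at b1
    have b2 := S.enorm_primSum_grid_le G hn a b ζ
    rw [← hX2, ← hi, ← hj] at b2
    have hw1 : ∀ θ, 0 ≤ 2 * (4 * T + 6) * (c / τ) * ((jb (l - cell h (A θ)))⁻¹ *
        (dw L (i - l) + dw L (i - cell h (A θ)))) := fun θ => by
      have := inv_jb_nonneg (l - cell h (A θ))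
      have := dw_nonneg G.one_le_L (i - cell h (A θ))
      positivity
    have hw2 : ∀ θ, 0 ≤ 2 * (4 * T + 6) * (c / τ) * ((jb (j - cell h (A θ)))⁻¹ *
        (dw L (i - j) + dw L (i - cell h (A θ)))) := fun θ => by
      have := inv_jb_nonneg (j - cell h (A θ))
      have := dw_nonneg G.one_le_L (i - cell h (A θ))
      positivity
    have b1' := (mul_le_mul_right b1
      (ENNReal.ofReal (16 * π * τ * ((jb (j - l))⁻¹ * inn L i l)))).trans
      (ofReal_mul_kint_le (by positivity) _ ζ)
    have b2' := (mul_le_mul_right b2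
      (ENNReal.ofReal (16 * π * τ * ((jb (j - l))⁻¹ * inn L i j)))).trans
      (ofReal_mul_kint_le (by positivity) _ ζ)
    refine (add_le_add b1' b2').trans ((S.kint_add_le (fun θ => ?_) (fun θ => ?_) ζ).trans
      (S.kint_mono (fun θ => ?_) ζ))
    · exact mul_nonneg (by positivity) (hw1 θ)
    · exact mul_nonneg (by positivity) (hw2 θ)
    · have e : 16 * π * τ * ((jb (j - l))⁻¹ * inn L i l) * (2 * (4 * T + 6) * (c / τ) *
            ((jb (l - cell h (A θ)))⁻¹ * (dw L (i - l) + dw L (i - cell h (A θ))))) +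
          16 * π * τ * ((jb (j - l))⁻¹ * inn L i j) * (2 * (4 * T + 6) * (c / τ) *
            ((jb (j - cell h (A θ)))⁻¹ * (dw L (i - j) + dw L (i - cell h (A θ))))) =
          32 * π * (4 * T + 6) * c * triW L i j l (cell h (A θ)) := by
        unfold triW; field_simp; ring
      rw [e]
      refine mul_le_mul_of_nonneg_right ?_ (triW_nonneg G.one_le_L _ _ _ _)
      unfold defectConst
      refine mul_le_mul_of_nonneg_right ?_ hc0.le
      nlinarith

set_option maxHeartbeats 1000000 in
lemma enorm_main_near_le {n : ℕ} (hn : (n : ℝ) * τ ≤ T) (a b ζ : ℝ) (hy : |b - A ζ| ≤ 1) :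
    ‖defectMain τ n a b (A ζ) (fun s => ψ s ζ)‖ₑ ≤
      ENNReal.ofReal (defectConst T *
        (srcW L (cell h a) (cell h b) (cell h (A ζ)) * ‖ψ 0 ζ‖)) +
      ENNReal.ofReal (defectConst T *
        (τ * (nearW L (cell h a) (cell h b) (cell h (A ζ)) * V ζ))) +
      kint k V ζ fun θ => defectConst T *
        triW L (cell h a) (cell h b) (cell h (A ζ)) (cell h (A θ)) := by
  have hτ := G.pos
  have hT := S.T_nonneg
  have hπ := Real.pi_gt_three
  have hπ4 := Real.pi_le_four
  set i := cell h a with hi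
  set j := cell h b with hj
  set l := cell h (A ζ) with hl
  have he := inv_jb_nonneg (j - l)
  have hil := inn_nonneg L i l
  have hij := inn_nonneg L i j
  have hdl := dw_nonneg G.one_le_L (i - l)
  have hdj := dw_nonneg G.one_le_L (i - j)
  have hp := pw_nonneg L (i - j)
  have hV := S.V_nonneg ζ
  set u0 := ‖ψ 0 ζ‖ with hu0
  set c := (2 * T + π) with hc
  have hc0 : 0 < c := by positivity
  have hu00 : 0 ≤ u0 := norm_nonneg _
  have hone : 1 ≤ 3 * (jb (j - l))⁻¹ := by
    have := G.jb_cell_sub_le b (A ζ)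
    rw [← div_eq_mul_inv, le_div_iff₀ (jb_pos _)]
    linarith
  set w : ℝ → ℝ := fun θ => (T + 2) * (1 + |A ζ - A θ|)⁻¹ with hw
  have hw0 : ∀ θ, w θ ≤ T + 2 := fun θ => by
    have h1 : (1 + |A ζ - A θ|)⁻¹ ≤ 1 :=
      inv_le_one_of_one_le₀ (by linarith [abs_nonneg (A ζ - A θ)])
    have : (T + 2) * (1 + |A ζ - A θ|)⁻¹ ≤ (T + 2) * 1 := by gcongr
    simpa using this
  set Q := kint k V ζ w with hQ
  have hQfin : Q ≠ ⊤ := S.kint_ne_top hw0 ζ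
  have hM : ∀ r, 0 ≤ r → r ≤ T → ‖ψ r ζ‖ ≤ u0 + Q.toReal := fun r hr hrT => by
    have h1 := S.norm_increment_le le_rfl hr hrT (ζ := ζ) (w := w) (fun θ q hq hqr => by
      have h2 := norm_osc_le_abs q r (A ζ - A θ)
      have h3 := norm_osc_mul_le q r (A ζ - A θ)
      have h4 : |r - q| ≤ T := by rw [abs_of_nonneg] <;> linarith
      have h5 := abs_nonneg (A ζ - A θ)
      change _ ≤ (T + 2) * (1 + |A ζ - A θ|)⁻¹
      rw [← div_eq_mul_inv, le_div_iff₀ (by linarith)]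
      nlinarith) hw0
    have h2 := norm_add_le (ψ r ζ - ψ 0 ζ) (ψ 0 ζ)
    rw [sub_add_cancel] at h2
    linarith
  have h1 := (S.path ζ).norm_defectMain_le (a := a) (b := b) (c := A ζ) hτ.le
    (fun r h1 h2 => G.norm_osc_le (by rw [abs_of_nonneg] <;> linarith) _ _) hn
    (fun m hm => norm_expSum_le_of_le G hm hn a b)
    (fun m hm => norm_expSum_le_of_le G hm hn a (A ζ)) hM
  rw [← hi, ← hj, ← hl, ← hc] at h1
  have hQ0 : 0 ≤ Q.toReal := ENNReal.toReal_nonneg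
  have h2 : ‖defectMain τ n a b (A ζ) (fun s => ψ s ζ)‖ ≤
      defectConst T * (srcW L i j l * u0) + defectConst T * (τ * (nearW L i j l * V ζ)) +
      8 * π * T * c * (inn L i j * dw L (i - j)) * Q.toReal := by
    refine h1.trans ?_
    have h3 : ‖inner' τ a b‖ * (2 * (c / τ * dw L (i - j)) * (T * (u0 + Q.toReal))) ≤
        (4 * π * τ * inn L i j) * (2 * (c / τ * dw L (i - j)) * (T * (u0 + Q.toReal))) := by
      gcongr
      exact G.norm_inner_le a b
    have e1 : (4 * π * τ * inn L i j) * (2 * (c / τ * dw L (i - j)) * (T * (u0 + Q.toReal))) =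
        8 * π * T * c * (inn L i j * dw L (i - j)) * u0 +
        8 * π * T * c * (inn L i j * dw L (i - j)) * Q.toReal := by field_simp; ring
    have e2 : 2 * τ * pw L (i - j) * τ * (2 * (c / τ * dw L (i - l)) * V ζ) =
        4 * c * (τ * (pw L (i - j) * dw L (i - l) * V ζ)) := by field_simp; ring
    have h4 : 8 * π * T * c * (inn L i j * dw L (i - j)) * u0 ≤
        defectConst T * (srcW L i j l * u0) := by
      have h5 : inn L i j * dw L (i - j) ≤ 3 * srcW L i j l := by
        unfold srcW
        have : 0 ≤ inn L i l * dw L (i - l) := by positivity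
        have : 0 ≤ inn L i j * dw L (i - j) := by positivity
        nlinarith
      have hs := srcW_nonneg G.one_le_L i j l
      calc _ ≤ 8 * π * T * c * (3 * srcW L i j l) * u0 := by gcongr
        _ = 24 * π * T * c * (srcW L i j l * u0) := by ring
        _ ≤ _ := by
          refine mul_le_mul_of_nonneg_right ?_ (by positivity)
          unfold defectConst
          refine mul_le_mul_of_nonneg_right ?_ hc0.le
          nlinarith
    have h6 : 4 * c * (τ * (pw L (i - j) * dw L (i - l) * V ζ)) ≤
        defectConst T * (τ * (nearW L i j l * V ζ)) := by
      have h5 : pw L (i - j) * dw L (i - l) ≤ 3 * nearW L i j l := by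
        unfold nearW
        have : 0 ≤ pw L (i - j) * dw L (i - l) := by positivity
        nlinarith
      have hs := nearW_nonneg G.one_le_L i j l
      calc _ ≤ 4 * c * (τ * (3 * nearW L i j l * V ζ)) := by gcongr
        _ = 12 * c * (τ * (nearW L i j l * V ζ)) := by ring
        _ ≤ _ := by
          refine mul_le_mul_of_nonneg_right ?_ (by positivity)
          unfold defectConst
          refine mul_le_mul_of_nonneg_right ?_ hc0.le
          nlinarith
    linarith
  refine (enorm_le_ofReal h2).trans ?_
  have hC := defectConst_nonneg hT
  have hs := srcW_nonneg G.one_le_L i j l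
  have hs' := nearW_nonneg G.one_le_L i j l
  rw [ENNReal.ofReal_add (by positivity) (by positivity),
    ENNReal.ofReal_add (by positivity) (by positivity)]
  refine add_le_add le_rfl ?_
  rw [ENNReal.ofReal_mul (by positivity), ENNReal.ofReal_toReal hQfin]
  refine (ofReal_mul_kint_le (by positivity) _ ζ).trans (S.kint_mono (fun θ => ?_) ζ)
  set q := cell h (A θ) with hq
  have hdq := dw_nonneg G.one_le_L (i - q)
  have hejq := inv_jb_nonneg (j - q)
  have helq := inv_jb_nonneg (l - q)
  have h3 : (1 + |A ζ - A θ|)⁻¹ ≤ 4 * (jb (j - q))⁻¹ := by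
    have h4 := G.inv_le b (A θ)
    have h5 : (1 + |A ζ - A θ|)⁻¹ ≤ 2 * (1 + |b - A θ|)⁻¹ := by
      have h6 := abs_sub_le b (A ζ) (A θ)
      have h7 := abs_nonneg (A ζ - A θ)
      have h8 := abs_nonneg (b - A θ)
      rw [← div_eq_mul_inv, inv_eq_one_div, div_le_div_iff₀ (by linarith) (by linarith)]
      linarith
    linarith
  have h5 : inn L i j * dw L (i - j) * (jb (j - q))⁻¹ ≤ 3 * triW L i j l q := by
    unfold triW
    have t1 : 0 ≤ (jb (j - l))⁻¹ * (jb (l - q))⁻¹ *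
      (inn L i l * (dw L (i - l) + dw L (i - q))) := by positivity
    have t2 : 0 ≤ inn L i j * dw L (i - j) * (jb (j - q))⁻¹ := by positivity
    have t3 : 0 ≤ (jb (j - l))⁻¹ * (inn L i j * dw L (i - q) * (jb (j - q))⁻¹) := by positivity
    nlinarith
  have ht := triW_nonneg G.one_le_L i j l q
  calc _ = 8 * π * T * c * (inn L i j * dw L (i - j)) *
        ((T + 2) * (1 + |A ζ - A θ|)⁻¹) := rfl
    _ ≤ 8 * π * T * c * (inn L i j * dw L (i - j)) * ((T + 2) * (4 * (jb (j - q))⁻¹)) := by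
        gcongr
    _ = 32 * π * T * (T + 2) * c * (inn L i j * dw L (i - j) * (jb (j - q))⁻¹) := by ring
    _ ≤ 32 * π * T * (T + 2) * c * (3 * triW L i j l q) := by gcongr
    _ = 96 * π * T * (T + 2) * c * triW L i j l q := by ring
    _ ≤ _ := by
      refine mul_le_mul_of_nonneg_right ?_ ht
      unfold defectConst
      refine mul_le_mul_of_nonneg_right ?_ hc0.le
      have : 96 * π * T * (T + 2) ≤ 96 * 4 * T * (T + 2) := by gcongr
      nlinarith

/-- Pointwise bound for the second-order defect density. -/
lemma enorm_density_le {n : ℕ} (hn : (n : ℝ) * τ ≤ T) (a b ζ : ℝ) :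
    ‖defectDensity τ n a b (A ζ) (fun s => ψ s ζ)‖ₑ ≤
      ENNReal.ofReal (defectConst T *
        (srcW L (cell h a) (cell h b) (cell h (A ζ)) * ‖ψ 0 ζ‖)) +
      ENNReal.ofReal (defectConst T *
        (τ * (nearW L (cell h a) (cell h b) (cell h (A ζ)) * V ζ))) +
      kint k V ζ (fun θ => defectConst T *
        triW L (cell h a) (cell h b) (cell h (A ζ)) (cell h (A θ))) +
      kint k V ζ fun θ => 4 * T *
        (τ ^ 2 * (pw L (cell h a - cell h b) * pw L (cell h (A ζ) - cell h (A θ)))) := by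
  have h1 := S.enorm_density_sub_main_le G hn a b ζ
  have h2 : ‖defectDensity τ n a b (A ζ) (fun s => ψ s ζ)‖ₑ ≤
      ‖defectMain τ n a b (A ζ) (fun s => ψ s ζ)‖ₑ +
      ‖defectDensity τ n a b (A ζ) (fun s => ψ s ζ) -
        defectMain τ n a b (A ζ) (fun s => ψ s ζ)‖ₑ := by
    refine le_trans (le_of_eq ?_) (enorm_add_le _ _)
    rw [add_sub_cancel]
  refine h2.trans (add_le_add ?_ h1)
  rcases le_total 1 |b - A ζ| with hy | hy
  · refine (S.enorm_main_far_le G hn a b ζ hy).trans ?_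
    gcongr
    exact le_self_add
  · exact S.enorm_main_near_le G hn a b ζ hy

end DuhamelFlow

/-- Accumulated local defect of the exponential integrator. -/
noncomputable def localDefect (τ : ℝ) (A : ℝ → ℝ) (k : ℝ → ℝ → ℂ) (ψ : ℝ → ℝ → ℂ) (n : ℕ)
    (ξ : ℝ) : ℂ :=
  ∑ m ∈ Finset.range n, (ψ (m * τ + τ) ξ - ψ (m * τ) ξ -
    osc 0 τ (A ξ) * ∫ η, k ξ η * (ex (m * τ * (A ξ - A η)) * ψ (m * τ) η))

namespace DuhamelFlow
variable {T K : ℝ} {A : ℝ → ℝ} {k : ℝ → ℝ → ℂ} {V : ℝ → ℝ} {ψ g : ℝ → ℝ → ℂ}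
  (S : DuhamelFlow T K A k V ψ g) {τ : ℝ}
include S

lemma rep_localDefect (hτ : 0 ≤ τ) {n : ℕ} (hn : (n : ℝ) * τ ≤ T) (ξ : ℝ) :
    KernelRep k ξ (localDefect τ A k ψ n ξ) (fun η =>
      inner' τ (A ξ) (A η) * expSum τ n (A ξ - A η) * ψ 0 η +
      ∑ m ∈ Finset.range n,
        (inner' τ (A ξ) (A η) * (ex (m * τ * (A ξ - A η)) * ∫ r in (0:ℝ)..m * τ, g r η) +
          ∫ r in (m * τ)..(m * τ + τ), osc r (m * τ + τ) (A ξ - A η) * g r η)) := by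
  have h := KernelRep.sum (k := k) (ξ := ξ) (Finset.range n)
    (z := fun m : ℕ => (ψ (m * τ + τ) ξ - ψ (m * τ) ξ -
      osc 0 τ (A ξ) * ∫ η, k ξ η * (ex (m * τ * (A ξ - A η)) * ψ (m * τ) η)))
    (f := fun m η => (∫ r in (m * τ)..(m * τ + τ), 1 * (ex (r * (A ξ - A η)) * ψ r η)) +
      -(osc 0 τ (A ξ)) * (ex (m * τ * (A ξ - A η)) * ψ (m * τ) η)) (fun m hm => by
      have hmn : ((m : ℝ) + 1) ≤ n := by exact_mod_cast Finset.mem_range.1 hm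
      have h0 : 0 ≤ (m : ℝ) * τ := by positivity
      have h1 : (m : ℝ) * τ + τ ≤ T := by nlinarith
      have r1 := S.rep_integral h0 (by linarith) h1 (c := fun _ => 1) continuous_const ξ
      have r2 := (S.rep_const h0 (by linarith) ξ (m * τ)).const_mul (-(osc 0 τ (A ξ)))
      have r3 := r1.add r2
      simp only [one_mul] at r3 ⊢
      rwa [(S.path ξ).integral_eq, neg_mul, ← sub_eq_add_neg] at r3)
  have e : (fun η => ∑ m ∈ Finset.range n,
      ((∫ r in ((m : ℝ) * τ)..(m * τ + τ), 1 * (ex (r * (A ξ - A η)) * ψ r η)) +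
      -(osc 0 τ (A ξ)) * (ex (m * τ * (A ξ - A η)) * ψ (m * τ) η))) = fun η =>
      inner' τ (A ξ) (A η) * expSum τ n (A ξ - A η) * ψ 0 η +
      ∑ m ∈ Finset.range n,
        (inner' τ (A ξ) (A η) * (ex (m * τ * (A ξ - A η)) * ∫ r in (0:ℝ)..m * τ, g r η) +
          ∫ r in (m * τ)..(m * τ + τ), osc r (m * τ + τ) (A ξ - A η) * g r η) := by
    funext η
    rw [expSum, Finset.mul_sum, Finset.sum_mul, ← Finset.sum_add_distrib]
    refine Finset.sum_congr rfl fun m _ => ?_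
    simp only [one_mul]
    have h1 := osc_shift (m * τ) 0 τ (A ξ - A η)
    rw [add_zero] at h1
    rw [(S.path η).integral_ex_mul, (S.path η).integral_eq, h1, inner']
    ring
  rw [e] at h
  exact h

lemma enorm_localDefect_le (hτ : 0 ≤ τ) {n : ℕ} (hn : (n : ℝ) * τ ≤ T) (ξ : ℝ) :
    ‖localDefect τ A k ψ n ξ‖ₑ ≤ ∫⁻ η, ‖k ξ η‖ₑ *
      (‖inner' τ (A ξ) (A η) * expSum τ n (A ξ - A η) * ψ 0 η‖ₑ +
        ∫⁻ ζ, ‖k η ζ‖ₑ * ‖defectDensity τ n (A ξ) (A η) (A ζ) (fun s => ψ s ζ)‖ₑ) := by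
  refine (S.rep_localDefect hτ hn ξ).enorm_le_of_le fun η => (enorm_add_le _ _).trans
    (add_le_add le_rfl ?_)
  refine KernelRep.enorm_le (KernelRep.sum (Finset.range n) fun m hm => ?_)
  have hmn : ((m : ℝ) + 1) ≤ n := by exact_mod_cast Finset.mem_range.1 hm
  have h0 : 0 ≤ (m : ℝ) * τ := by positivity
  have h1 : (m : ℝ) * τ + τ ≤ T := by nlinarith
  have r1 := S.rep_integral le_rfl h0 (by linarith) (c := fun _ => 1) continuous_const η
  simp only [one_mul] at r1
  exact ((r1.const_mul _).const_mul _).add (S.rep_integral h0 (by linarith) h1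
    (continuous_osc_left (m * τ + τ) (A ξ - A η)) η)

end DuhamelFlow

/-- A nonnegative kernel whose columns have mass at most `R`, and mass at most `D * W i` on the
`i`-th cell of `ι`. -/
structure CellKernel (q : ℝ → ℝ → ℝ≥0∞) (ι : ℝ → ℤ) (W : ℤ → ℝ≥0∞) (D R : ℝ≥0∞) : Prop where
  meas_q : Measurable (Function.uncurry q)
  meas_ι : Measurable ι
  cell_le : ∀ (η : ℝ) (F : ℤ → ℝ≥0∞), ∫⁻ ξ, q ξ η * F (ι ξ) ≤ D * ∑' i, W i * F i
  mass_le : ∀ η, ∫⁻ ξ, q ξ η ≤ R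

lemma cellKernel_of_volume_le {q : ℝ → ℝ → ℝ≥0∞} {ι : ℝ → ℤ} {W : ℤ → ℝ≥0∞} {K N R : ℝ≥0∞}
    (hq : Measurable (Function.uncurry q)) (hι : Measurable ι) (hK : ∀ ξ η, q ξ η ≤ K)
    (hN : ∀ i, volume {y | ι y = i} ≤ N * W i) (hR : ∀ η, ∫⁻ ξ, q ξ η ≤ R) :
    CellKernel q ι W (K * N) R := by
  refine ⟨hq, hι, fun η F => ?_, hR⟩
  calc ∫⁻ ξ, q ξ η * F (ι ξ) ≤ ∫⁻ ξ, K * F (ι ξ) :=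
        lintegral_mono fun ξ => mul_le_mul_left (hK ξ η) _
    _ = K * ∫⁻ ξ, F (ι ξ) :=
        lintegral_const_mul _ ((measurable_of_countable F).comp hι)
    _ = K * ∑' i, F i * volume {y | ι y = i} := by
        rw [← lintegral_map (measurable_of_countable F) hι, lintegral_countable']
        congr 1
        refine tsum_congr fun i => ?_
        rw [Measure.map_apply hι (measurableSet_singleton i)]
        rfl
    _ ≤ K * ∑' i, F i * (N * W i) := by gcongr with i; exact hN i
    _ = K * N * ∑' i, W i * F i := by
        rw [mul_assoc]
        congr 1
        rw [← ENNReal.tsum_mul_left]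
        exact tsum_congr fun i => by ring

namespace CellKernel
variable {q : ℝ → ℝ → ℝ≥0∞} {ι : ℝ → ℤ} {W : ℤ → ℝ≥0∞} {D R : ℝ≥0∞}
  (Q : CellKernel q ι W D R)
include Q

lemma measurable_comp {Φ : ℤ → ℝ → ℝ≥0∞} (hΦ : ∀ i, Measurable (Φ i)) :
    Measurable fun p : ℝ × ℝ => Φ (ι p.1) p.2 := by
  have h : Measurable fun p : ℤ × ℝ => Φ p.1 p.2 := measurable_from_prod_countable_right hΦ
  exact h.comp ((Q.meas_ι.comp measurable_fst).prodMk measurable_snd)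

lemma measurable_mul {Φ : ℤ → ℝ → ℝ≥0∞} (hΦ : ∀ i, Measurable (Φ i)) :
    Measurable fun p : ℝ × ℝ => q p.1 p.2 * Φ (ι p.1) p.2 :=
  Measurable.mul Q.meas_q (Q.measurable_comp hΦ)

lemma measurable_lintegral {Φ : ℤ → ℝ → ℝ≥0∞} (hΦ : ∀ i, Measurable (Φ i)) :
    Measurable fun ξ => ∫⁻ η, q ξ η * Φ (ι ξ) η :=
  (Q.measurable_mul hΦ).lintegral_prod_right'

lemma lintegral_le {Φ : ℤ → ℝ → ℝ≥0∞} (hΦ : ∀ i, Measurable (Φ i)) :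
    ∫⁻ ξ, ∫⁻ η, q ξ η * Φ (ι ξ) η ≤ D * ∑' i, W i * ∫⁻ η, Φ i η := by
  rw [lintegral_lintegral_swap (Q.measurable_mul hΦ).aemeasurable]
  calc _ ≤ ∫⁻ η, D * ∑' i, W i * Φ i η :=
        lintegral_mono fun η => Q.cell_le η fun i => Φ i η
    _ = D * ∫⁻ η, ∑' i, W i * Φ i η :=
        lintegral_const_mul _ (Measurable.tsum fun i => (hΦ i).const_mul _)
    _ = D * ∑' i, W i * ∫⁻ η, Φ i η := by
        rw [lintegral_tsum fun i => ((hΦ i).const_mul _).aemeasurable]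
        congr 1
        exact tsum_congr fun i => lintegral_const_mul _ (hΦ i)

lemma lintegral_mass_le {Y : ℝ → ℝ≥0∞} (hY : Measurable Y) :
    ∫⁻ ξ, ∫⁻ η, q ξ η * Y η ≤ R * ∫⁻ η, Y η := by
  rw [lintegral_lintegral_swap (Q.measurable_mul (Φ := fun _ => Y) fun _ => hY).aemeasurable,
    ← lintegral_const_mul _ hY]
  refine lintegral_mono fun η => ?_
  have h1 : Measurable fun ξ => q ξ η := Q.meas_q.comp measurable_prodMk_right
  simp only
  rw [lintegral_mul_const _ h1]
  exact mul_le_mul_left (Q.mass_le η) _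

lemma measurable_weight {F : ℤ → ℝ≥0∞} {v : ℝ → ℝ≥0∞} (hv : Measurable v) :
    Measurable fun η => F (ι η) * v η :=
  ((measurable_of_countable F).comp Q.meas_ι).mul hv

/-- One application of the kernel. -/
lemma single_le {F : ℤ → ℤ → ℝ≥0∞} {v : ℝ → ℝ≥0∞} (hv : Measurable v) {X : ℝ≥0∞}
    (hX : ∀ j, ∑' i, W i * F i j ≤ X) :
    ∫⁻ ξ, ∫⁻ η, q ξ η * (F (ι ξ) (ι η) * v η) ≤ D * X * ∫⁻ η, v η := by
  refine (Q.lintegral_le (Φ := fun i η => F i (ι η) * v η)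
    fun i => Q.measurable_weight hv).trans ?_
  rw [mul_assoc, ← lintegral_const_mul _ hv]
  refine mul_le_mul_right ?_ _
  have e : ∀ i, W i * ∫⁻ η, F i (ι η) * v η = ∫⁻ η, W i * (F i (ι η) * v η) := fun i =>
    (lintegral_const_mul _ (Q.measurable_weight hv)).symm
  rw [tsum_congr e, ← lintegral_tsum fun i =>
    ((Q.measurable_weight hv).const_mul _).aemeasurable]
  refine lintegral_mono fun η => ?_
  simp only [← mul_assoc, ENNReal.tsum_mul_right]
  exact mul_le_mul_left (hX _) _

/-- Two applications of the kernel. -/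
lemma double_le {F : ℤ → ℤ → ℤ → ℝ≥0∞} {v : ℝ → ℝ≥0∞} (hv : Measurable v) {X : ℝ≥0∞}
    (hX : ∀ l, ∑' j, ∑' i, W i * (W j * F i j l) ≤ X) :
    ∫⁻ ξ, ∫⁻ η, q ξ η * ∫⁻ ζ, q η ζ * (F (ι ξ) (ι η) (ι ζ) * v ζ) ≤
      D * D * X * ∫⁻ ζ, v ζ := by
  have hm : ∀ i, Measurable fun η => ∫⁻ ζ, q η ζ * (F i (ι η) (ι ζ) * v ζ) := fun i =>
    Q.measurable_lintegral (Φ := fun j ζ => F i j (ι ζ) * v ζ) fun j => Q.measurable_weight hv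
  refine (Q.lintegral_le hm).trans ?_
  rw [mul_assoc, mul_assoc]
  refine mul_le_mul_right ?_ _
  calc ∑' i, W i * ∫⁻ η, ∫⁻ ζ, q η ζ * (F i (ι η) (ι ζ) * v ζ)
      ≤ ∑' i, W i * (D * ∑' j, W j * ∫⁻ ζ, F i j (ι ζ) * v ζ) := by
        gcongr with i
        exact Q.lintegral_le (Φ := fun j ζ => F i j (ι ζ) * v ζ) fun j => Q.measurable_weight hv
    _ = D * ∑' i, ∑' j, ∫⁻ ζ, W i * (W j * (F i j (ι ζ) * v ζ)) := by
        rw [← ENNReal.tsum_mul_left]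
        refine tsum_congr fun i => ?_
        rw [mul_left_comm, ← ENNReal.tsum_mul_left]
        congr 1
        refine tsum_congr fun j => ?_
        rw [lintegral_const_mul _ ((Q.measurable_weight hv).const_mul _),
          lintegral_const_mul _ (Q.measurable_weight hv)]
    _ = D * ∫⁻ ζ, ∑' j, ∑' i, W i * (W j * (F i j (ι ζ) * v ζ)) := by
        rw [ENNReal.tsum_comm, lintegral_tsum fun j => (Measurable.tsum fun i =>
          ((Q.measurable_weight hv).const_mul _).const_mul _).aemeasurable]
        congr 1
        exact tsum_congr fun j => (lintegral_tsum fun i =>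
          (((Q.measurable_weight hv).const_mul _).const_mul _).aemeasurable).symm
    _ ≤ D * (X * ∫⁻ ζ, v ζ) := by
        rw [← lintegral_const_mul _ hv]
        refine mul_le_mul_right (lintegral_mono fun ζ => ?_) _
        simp only [← mul_assoc, ENNReal.tsum_mul_right]
        simp only [mul_assoc]
        exact mul_le_mul_left (hX _) _

/-- Three applications of the kernel. -/
lemma triple_le {F : ℤ → ℤ → ℤ → ℤ → ℝ≥0∞} {v : ℝ → ℝ≥0∞} (hv : Measurable v) {X : ℝ≥0∞}
    (hX : ∀ n, ∑' l, ∑' j, ∑' i, W i * (W j * (W l * F i j l n)) ≤ X) :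
    ∫⁻ ξ, ∫⁻ η, q ξ η * ∫⁻ ζ, q η ζ * ∫⁻ θ, q ζ θ * (F (ι ξ) (ι η) (ι ζ) (ι θ) * v θ) ≤
      D * D * D * X * ∫⁻ θ, v θ := by
  have hm2 : ∀ i j, Measurable fun ζ => ∫⁻ θ, q ζ θ * (F i j (ι ζ) (ι θ) * v θ) := fun i j =>
    Q.measurable_lintegral (Φ := fun l θ => F i j l (ι θ) * v θ) fun j => Q.measurable_weight hv
  have hm : ∀ i, Measurable fun η => ∫⁻ ζ, q η ζ *
      ∫⁻ θ, q ζ θ * (F i (ι η) (ι ζ) (ι θ) * v θ) := fun i =>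
    Q.measurable_lintegral (Φ := fun j ζ => ∫⁻ θ, q ζ θ * (F i j (ι ζ) (ι θ) * v θ))
      fun j => hm2 i j
  refine (Q.lintegral_le hm).trans ?_
  simp only [mul_assoc]
  refine mul_le_mul_right ?_ _
  calc ∑' i, W i * ∫⁻ η, ∫⁻ ζ, q η ζ * ∫⁻ θ, q ζ θ * (F i (ι η) (ι ζ) (ι θ) * v θ)
      ≤ ∑' i, W i * (D * ∑' j, W j * (D * ∑' l, W l * ∫⁻ θ, F i j l (ι θ) * v θ)) := by
        gcongr with i
        refine (Q.lintegral_le fun j => hm2 i j).trans ?_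
        gcongr with j
        exact Q.lintegral_le (Φ := fun l θ => F i j l (ι θ) * v θ)
          fun j => Q.measurable_weight hv
    _ = D * (D * ∑' i, ∑' j, ∑' l, ∫⁻ θ, W i * (W j * (W l * (F i j l (ι θ) * v θ)))) := by
        simp only [← ENNReal.tsum_mul_left]
        refine tsum_congr fun i => tsum_congr fun j => tsum_congr fun l => ?_
        rw [lintegral_const_mul _ (((Q.measurable_weight hv).const_mul _).const_mul _),
          lintegral_const_mul _ ((Q.measurable_weight hv).const_mul _),
          lintegral_const_mul _ (Q.measurable_weight hv)]
        ring
    _ = D * (D * ∫⁻ θ, ∑' l, ∑' j, ∑' i, W i * (W j * (W l * (F i j l (ι θ) * v θ)))) := by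
        have hmeas : ∀ i j l, Measurable fun θ =>
            W i * (W j * (W l * (F i j l (ι θ) * v θ))) := fun i j l =>
          (((Q.measurable_weight hv).const_mul _).const_mul _).const_mul _
        rw [lintegral_tsum fun l => (Measurable.tsum fun j =>
          Measurable.tsum fun i => hmeas i j l).aemeasurable]
        congr 2
        rw [tsum_congr fun l => (lintegral_tsum fun j =>
          (Measurable.tsum fun i => hmeas i j l).aemeasurable),
          tsum_congr fun l => tsum_congr fun j => lintegral_tsum fun i =>
            (hmeas i j l).aemeasurable]
        rw [ENNReal.tsum_comm, tsum_congr fun j => ENNReal.tsum_comm, ENNReal.tsum_comm]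
    _ ≤ D * (D * (X * ∫⁻ θ, v θ)) := by
        rw [← lintegral_const_mul _ hv]
        refine mul_le_mul_right (mul_le_mul_right (lintegral_mono fun θ => ?_) _) _
        simp only [← mul_assoc, ENNReal.tsum_mul_right]
        simp only [mul_assoc]
        exact mul_le_mul_left (hX _) _

end CellKernel

namespace CellKernel
variable {q : ℝ → ℝ → ℝ≥0∞} {ι : ℝ → ℤ} {W : ℤ → ℝ≥0∞} {D R : ℝ≥0∞}
  (Q : CellKernel q ι W D R)
include Q

lemma lintegral_mul_const_mul {f : ℝ → ℝ≥0∞} (hf : Measurable f) (c : ℝ≥0∞) (η : ℝ) :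
    ∫⁻ ζ, q η ζ * (c * f ζ) = c * ∫⁻ ζ, q η ζ * f ζ := by
  have h : Measurable fun ζ => q η ζ * f ζ :=
    Measurable.mul (Q.meas_q.comp measurable_prodMk_left) hf
  rw [← lintegral_const_mul _ h]
  exact lintegral_congr fun ζ => mul_left_comm _ _ _

/-- Three applications of the kernel to a weight that does not couple the first two variables
to the last two. -/
lemma split_le {F F' : ℤ → ℤ → ℝ≥0∞} {v : ℝ → ℝ≥0∞} (hv : Measurable v) {X : ℝ≥0∞}
    (hX : ∀ j, ∑' i, W i * F i j ≤ X) (hX' : ∀ j, ∑' i, W i * F' i j ≤ X) :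
    ∫⁻ ξ, ∫⁻ η, q ξ η * ∫⁻ ζ, q η ζ * ∫⁻ θ, q ζ θ *
      (F (ι ξ) (ι η) * F' (ι ζ) (ι θ) * v θ) ≤ D * X * (R * (D * X * ∫⁻ θ, v θ)) := by
  have hm2 : Measurable fun ζ => ∫⁻ θ, q ζ θ * (F' (ι ζ) (ι θ) * v θ) :=
    Q.measurable_lintegral (Φ := fun l θ => F' l (ι θ) * v θ) fun j => Q.measurable_weight hv
  have hm1 : Measurable fun η => ∫⁻ ζ, q η ζ * ∫⁻ θ, q ζ θ * (F' (ι ζ) (ι θ) * v θ) :=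
    Q.measurable_lintegral (Φ := fun _ ζ => ∫⁻ θ, q ζ θ * (F' (ι ζ) (ι θ) * v θ)) fun _ => hm2
  have e : ∀ ξ η, ∫⁻ ζ, q η ζ * ∫⁻ θ, q ζ θ * (F (ι ξ) (ι η) * F' (ι ζ) (ι θ) * v θ) =
      F (ι ξ) (ι η) * ∫⁻ ζ, q η ζ * ∫⁻ θ, q ζ θ * (F' (ι ζ) (ι θ) * v θ) := fun ξ η => by
    simp only [mul_assoc (F (ι ξ) (ι η))]
    rw [← Q.lintegral_mul_const_mul hm2]
    refine lintegral_congr fun ζ => congrArg _ ?_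
    exact Q.lintegral_mul_const_mul (Q.measurable_weight (F := fun n => F' (ι ζ) n) hv) _ _
  simp only [e]
  refine (Q.single_le hm1 hX).trans (mul_le_mul_right ?_ _)
  refine (Q.lintegral_mass_le hm2).trans (mul_le_mul_right ?_ _)
  exact Q.single_le hv hX'

lemma lintegral_mul_add {f g : ℝ → ℝ≥0∞} (hf : Measurable f) (η : ℝ) :
    ∫⁻ ζ, q η ζ * (f ζ + g ζ) = (∫⁻ ζ, q η ζ * f ζ) + ∫⁻ ζ, q η ζ * g ζ := by
  simp only [mul_add]
  exact lintegral_add_left (Measurable.mul (Q.meas_q.comp measurable_prodMk_left) hf) _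

lemma lintegral_add {Φ Ψ : ℤ → ℝ → ℝ≥0∞} (hΦ : ∀ i, Measurable (Φ i)) :
    ∫⁻ ξ, ∫⁻ η, q ξ η * (Φ (ι ξ) η + Ψ (ι ξ) η) =
      (∫⁻ ξ, ∫⁻ η, q ξ η * Φ (ι ξ) η) + ∫⁻ ξ, ∫⁻ η, q ξ η * Ψ (ι ξ) η := by
  simp only [Q.lintegral_mul_add (hΦ _)]
  exact lintegral_add_left (Q.measurable_lintegral hΦ) _

lemma total_le {F₁ F₅ F₆ : ℤ → ℤ → ℝ≥0∞} {F₂ F₃ : ℤ → ℤ → ℤ → ℝ≥0∞}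
    {F₄ : ℤ → ℤ → ℤ → ℤ → ℝ≥0∞} {v₁ v₂ v₃ v₄ v₅ : ℝ → ℝ≥0∞} (hv₁ : Measurable v₁)
    (hv₂ : Measurable v₂) (hv₃ : Measurable v₃) (hv₄ : Measurable v₄) (hv₅ : Measurable v₅)
    {X₁ X₂ X₃ X₄ X₅ : ℝ≥0∞} (h₁ : ∀ j, ∑' i, W i * F₁ i j ≤ X₁)
    (h₂ : ∀ l, ∑' j, ∑' i, W i * (W j * F₂ i j l) ≤ X₂)
    (h₃ : ∀ l, ∑' j, ∑' i, W i * (W j * F₃ i j l) ≤ X₃)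
    (h₄ : ∀ n, ∑' l, ∑' j, ∑' i, W i * (W j * (W l * F₄ i j l n)) ≤ X₄)
    (h₅ : ∀ j, ∑' i, W i * F₅ i j ≤ X₅) (h₆ : ∀ j, ∑' i, W i * F₆ i j ≤ X₅) :
    ∫⁻ ξ, ∫⁻ η, q ξ η * (F₁ (ι ξ) (ι η) * v₁ η + ∫⁻ ζ, q η ζ *
      (F₂ (ι ξ) (ι η) (ι ζ) * v₂ ζ + (F₃ (ι ξ) (ι η) (ι ζ) * v₃ ζ +
        ((∫⁻ θ, q ζ θ * (F₄ (ι ξ) (ι η) (ι ζ) (ι θ) * v₄ θ)) +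
          ∫⁻ θ, q ζ θ * (F₅ (ι ξ) (ι η) * F₆ (ι ζ) (ι θ) * v₅ θ))))) ≤
      D * X₁ * (∫⁻ η, v₁ η) + (D * D * X₂ * (∫⁻ ζ, v₂ ζ) + (D * D * X₃ * (∫⁻ ζ, v₃ ζ) +
        (D * D * D * X₄ * (∫⁻ θ, v₄ θ) + D * X₅ * (R * (D * X₅ * ∫⁻ θ, v₅ θ))))) := by
  have m4 : ∀ i j, Measurable fun ζ => ∫⁻ θ, q ζ θ * (F₄ i j (ι ζ) (ι θ) * v₄ θ) := fun i j =>
    Q.measurable_lintegral (Φ := fun l θ => F₄ i j l (ι θ) * v₄ θ)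
      fun j => Q.measurable_weight hv₄
  have m4' : ∀ i, Measurable fun η => ∫⁻ ζ, q η ζ *
      ∫⁻ θ, q ζ θ * (F₄ i (ι η) (ι ζ) (ι θ) * v₄ θ) := fun i =>
    Q.measurable_lintegral (Φ := fun j ζ => ∫⁻ θ, q ζ θ * (F₄ i j (ι ζ) (ι θ) * v₄ θ))
      fun j => m4 i j
  have m2' : ∀ i, Measurable fun η => ∫⁻ ζ, q η ζ * (F₂ i (ι η) (ι ζ) * v₂ ζ) := fun i =>
    Q.measurable_lintegral (Φ := fun j ζ => F₂ i j (ι ζ) * v₂ ζ)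
      fun j => Q.measurable_weight hv₂
  have m3' : ∀ i, Measurable fun η => ∫⁻ ζ, q η ζ * (F₃ i (ι η) (ι ζ) * v₃ ζ) := fun i =>
    Q.measurable_lintegral (Φ := fun j ζ => F₃ i j (ι ζ) * v₃ ζ)
      fun j => Q.measurable_weight hv₃
  have e : ∀ ξ η, (∫⁻ ζ, q η ζ *
      (F₂ (ι ξ) (ι η) (ι ζ) * v₂ ζ + (F₃ (ι ξ) (ι η) (ι ζ) * v₃ ζ +
        ((∫⁻ θ, q ζ θ * (F₄ (ι ξ) (ι η) (ι ζ) (ι θ) * v₄ θ)) +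
          ∫⁻ θ, q ζ θ * (F₅ (ι ξ) (ι η) * F₆ (ι ζ) (ι θ) * v₅ θ))))) =
      (∫⁻ ζ, q η ζ * (F₂ (ι ξ) (ι η) (ι ζ) * v₂ ζ)) +
        ((∫⁻ ζ, q η ζ * (F₃ (ι ξ) (ι η) (ι ζ) * v₃ ζ)) +
        ((∫⁻ ζ, q η ζ * ∫⁻ θ, q ζ θ * (F₄ (ι ξ) (ι η) (ι ζ) (ι θ) * v₄ θ)) +
          ∫⁻ ζ, q η ζ * ∫⁻ θ, q ζ θ * (F₅ (ι ξ) (ι η) * F₆ (ι ζ) (ι θ) * v₅ θ))) :=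
    fun ξ η => by
      rw [Q.lintegral_mul_add (Q.measurable_weight (F := fun l => F₂ (ι ξ) (ι η) l) hv₂),
        Q.lintegral_mul_add (Q.measurable_weight (F := fun l => F₃ (ι ξ) (ι η) l) hv₃),
        Q.lintegral_mul_add (m4 (ι ξ) (ι η))]
  simp only [e]
  rw [Q.lintegral_add (Φ := fun i η => F₁ i (ι η) * v₁ η)
      (Ψ := fun i η => (∫⁻ ζ, q η ζ * (F₂ i (ι η) (ι ζ) * v₂ ζ)) +
        ((∫⁻ ζ, q η ζ * (F₃ i (ι η) (ι ζ) * v₃ ζ)) +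
        ((∫⁻ ζ, q η ζ * ∫⁻ θ, q ζ θ * (F₄ i (ι η) (ι ζ) (ι θ) * v₄ θ)) +
          ∫⁻ ζ, q η ζ * ∫⁻ θ, q ζ θ * (F₅ i (ι η) * F₆ (ι ζ) (ι θ) * v₅ θ))))
      (fun i => Q.measurable_weight hv₁),
    Q.lintegral_add (Φ := fun i η => ∫⁻ ζ, q η ζ * (F₂ i (ι η) (ι ζ) * v₂ ζ))
      (Ψ := fun i η => (∫⁻ ζ, q η ζ * (F₃ i (ι η) (ι ζ) * v₃ ζ)) +
        ((∫⁻ ζ, q η ζ * ∫⁻ θ, q ζ θ * (F₄ i (ι η) (ι ζ) (ι θ) * v₄ θ)) +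
          ∫⁻ ζ, q η ζ * ∫⁻ θ, q ζ θ * (F₅ i (ι η) * F₆ (ι ζ) (ι θ) * v₅ θ))) m2',
    Q.lintegral_add (Φ := fun i η => ∫⁻ ζ, q η ζ * (F₃ i (ι η) (ι ζ) * v₃ ζ))
      (Ψ := fun i η => ((∫⁻ ζ, q η ζ * ∫⁻ θ, q ζ θ * (F₄ i (ι η) (ι ζ) (ι θ) * v₄ θ)) +
          ∫⁻ ζ, q η ζ * ∫⁻ θ, q ζ θ * (F₅ i (ι η) * F₆ (ι ζ) (ι θ) * v₅ θ))) m3',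
    Q.lintegral_add (Φ := fun i η => ∫⁻ ζ, q η ζ *
        ∫⁻ θ, q ζ θ * (F₄ i (ι η) (ι ζ) (ι θ) * v₄ θ))
      (Ψ := fun i η =>
          ∫⁻ ζ, q η ζ * ∫⁻ θ, q ζ θ * (F₅ i (ι η) * F₆ (ι ζ) (ι θ) * v₅ θ)) m4']
  exact add_le_add (Q.single_le hv₁ h₁) (add_le_add (Q.double_le hv₂ h₂)
    (add_le_add (Q.double_le hv₃ h₃) (add_le_add (Q.triple_le hv₄ h₄)
      (Q.split_le hv₅ h₅ h₆))))

end CellKernel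

/-- Mass of the `i`-th cell relative to the central one. -/
noncomputable def cellWeight (γ : ℝ) (i : ℤ) : ℝ≥0∞ := ENNReal.ofReal (jb i ^ (-γ))

/-- Size of the resonant sums. -/
noncomputable def resSize (γ s : ℝ) (L : ℕ) : ℝ := (L : ℝ) ^ (2 * s - 2 * γ) / s ^ 2

lemma resSize_nonneg (γ s : ℝ) (L : ℕ) : 0 ≤ resSize γ s L := by
  unfold resSize; positivity

lemma cellWeight_mul_ofReal (γ : ℝ) (i : ℤ) (x : ℝ) :
    cellWeight γ i * ENNReal.ofReal x = ENNReal.ofReal (jb i ^ (-γ) * x) :=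
  (ENNReal.ofReal_mul (rpow_nonneg (jb_pos i).le _)).symm

section WeightSums
variable {γ s : ℝ} (h : Params γ s) {L : ℕ} (hL : 1 ≤ L)
include h hL

lemma tsum_first_le (j : ℤ) :
    ∑' i, cellWeight γ i * ENNReal.ofReal (pw L i * dw L (i - j)) ≤ ENNReal.ofReal 1944 := by
  simp only [cellWeight_mul_ofReal]
  have := zs_pw_dw h hL 0 j
  simp only [sub_zero] at this
  exact this

lemma tsum_pw_le (j : ℤ) :
    ∑' i, cellWeight γ i * ENNReal.ofReal (pw L (i - j)) ≤
      ENNReal.ofReal (6 / s * (L : ℝ) ^ (1 - γ + s)) := by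
  simp only [cellWeight_mul_ofReal]
  exact zs_pw h hL j

lemma tsum_near_le (l : ℤ) :
    ∑' j, ∑' i, cellWeight γ i * (cellWeight γ j * ENNReal.ofReal (nearW L i j l)) ≤
      ENNReal.ofReal (1944 * 12) := by
  simp only [cellWeight_mul_ofReal]
  exact zs2_near h hL l

lemma tsum_src_le (l : ℤ) :
    ∑' j, ∑' i, cellWeight γ i * (cellWeight γ j *
      ENNReal.ofReal ((jb l)⁻¹ * srcW L i j l)) ≤
      ENNReal.ofReal (46656 * ((L : ℝ)⁻¹ + resSize γ s L)) := by
  simp only [cellWeight_mul_ofReal]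
  have hl := jb_pos l
  have hr := resSize_nonneg γ s L
  have h1 := zs2_le_mul (inv_nonneg.2 hl.le) (fun j i => le_rfl) (zs2_source_outer h hL l)
  have h2 := zs2_le_mul (inv_nonneg.2 hl.le) (fun j i => le_rfl) (zs2_source_inner h hL l)
  refine (zs2_le_add (F := fun j i => jb i ^ (-γ) * (jb j ^ (-γ) * ((jb l)⁻¹ * srcW L i j l)))
    (by positivity) (by positivity) (fun j i => le_of_eq ?_) h1 h2).trans
    (ENNReal.ofReal_le_ofReal ?_)
  · unfold srcW; ring
  · have e1 : (jb l)⁻¹ * (46656 * (jb l / L)) = 46656 * (L : ℝ)⁻¹ := by field_simp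
    have e2 : (jb l)⁻¹ * (jb l * (11664 / s ^ 2 * (L : ℝ) ^ (2 * s - 2 * γ))) =
        11664 * resSize γ s L := by
      unfold resSize; field_simp
    rw [e1, e2]
    linarith

lemma tsum_tri_le (n : ℤ) :
    ∑' l, ∑' j, ∑' i, cellWeight γ i * (cellWeight γ j * (cellWeight γ l *
      ENNReal.ofReal (triW L i j l n))) ≤ ENNReal.ofReal (1119744 * resSize γ s L) := by
  simp only [cellWeight_mul_ofReal]
  have hs := h.s_pos
  have hr := resSize_nonneg γ s L
  have e : 3888 * (12 / s) * (6 / s * (L : ℝ) ^ (2 * s - 2 * γ)) = 279936 * resSize γ s L := by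
    unfold resSize; field_simp; norm_num
  have o1 := zs3_outer h hL n (fun l => l)
  have o2 := zs3_outer h hL n (fun _ => n)
  have i1 := zs3_inner h hL n (fun l => l)
  have i2 := zs3_inner h hL n (fun _ => n)
  rw [e] at o1 o2 i1 i2
  have e2 : 1119744 * resSize γ s L = (279936 * resSize γ s L + 279936 * resSize γ s L) +
      (279936 * resSize γ s L + 279936 * resSize γ s L) := by ring
  rw [e2, ENNReal.ofReal_add (by positivity) (by positivity),
    ENNReal.ofReal_add (by positivity) (by positivity)]
  refine le_trans ?_ (add_le_add (add_le_add o1 o2) (add_le_add i1 i2))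
  unfold zs2 zs
  simp only [← ENNReal.tsum_add]
  refine ENNReal.tsum_le_tsum fun l => ENNReal.tsum_le_tsum fun j =>
    ENNReal.tsum_le_tsum fun i => ?_
  have p1 := inv_jb_nonneg (j - l)
  have p2 := inv_jb_nonneg (l - n)
  have p3 := inv_jb_nonneg (j - n)
  have p4 := inn_nonneg L i l
  have p5 := inn_nonneg L i j
  have p6 := dw_nonneg hL (i - l)
  have p7 := dw_nonneg hL (i - j)
  have p8 := dw_nonneg hL (i - n)
  have q1 := jb_pos i
  have q2 := jb_pos j
  have q3 := jb_pos l
  rw [← ENNReal.ofReal_add (by positivity) (by positivity),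
    ← ENNReal.ofReal_add (by positivity) (by positivity),
    ← ENNReal.ofReal_add (by positivity) (by positivity)]
  refine ENNReal.ofReal_le_ofReal (le_of_eq ?_)
  unfold triW; ring

end WeightSums

lemma lintegral_ofReal_mul_le {f : ℝ → ℝ} {c M : ℝ} (hf : Measurable f) (hc : 0 ≤ c)
    (h : ∫⁻ x, ENNReal.ofReal (f x) ≤ ENNReal.ofReal M) :
    ∫⁻ x, ENNReal.ofReal (c * f x) ≤ ENNReal.ofReal (c * M) := by
  simp only [ENNReal.ofReal_mul hc]
  rw [lintegral_const_mul _ hf.ennreal_ofReal]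
  exact mul_le_mul_right h _

namespace DuhamelFlow
variable {T K : ℝ} {A : ℝ → ℝ} {k : ℝ → ℝ → ℂ} {V : ℝ → ℝ} {ψ g : ℝ → ℝ → ℂ}
  (S : DuhamelFlow T K A k V ψ g) {τ h : ℝ} {L : ℕ} (G : Grid τ h L)
include S G

lemma lintegral_localDefect_le {γ s : ℝ} (prm : Params γ s) {D R a B M : ℝ}
    (hh : h ≤ 2) (hD : 0 ≤ D) (hR : 0 ≤ R) (ha : 0 ≤ a) (ha1 : a ≤ 1) (hB : 0 ≤ B) (hM : 0 ≤ M)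
    (Q : CellKernel (fun ξ η => ‖k ξ η‖ₑ) (fun y => cell h (A y)) (cellWeight γ)
      (ENNReal.ofReal D) (ENNReal.ofReal R))
    {w : ℝ → ℝ} (hwm : Measurable w) (hw : ∀ y, 1 ≤ w y) (hA : ∀ y, |A y| ≤ a * (B * w y))
    (hM₀ : ∫⁻ y, ENNReal.ofReal (w y * ‖ψ 0 y‖) ≤ ENNReal.ofReal M)
    (hMV : ∫⁻ y, ENNReal.ofReal (V y) ≤ ENNReal.ofReal M)
    {n : ℕ} (hn : (n : ℝ) * τ ≤ T) :
    ∫⁻ ξ, ‖localDefect τ A k ψ n ξ‖ₑ ≤ ENNReal.ofReal (10 ^ 7 * defectConst T * (B + 2) * M *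
      (D * (a * τ) + D ^ 2 * (τ + resSize γ s L) + D ^ 3 * resSize γ s L +
        D ^ 2 * R * resSize γ s L)) := by
  have hτ := G.pos
  have hT := S.T_nonneg
  have hL := G.one_le_L
  have hπ := Real.pi_gt_three
  have hπ4 := Real.pi_lt_d2
  have hs := prm.s_pos
  have hψ : Measurable fun y => ‖ψ 0 y‖ := (S.meas.comp measurable_prodMk_left).norm
  have hC := defectConst_nonneg hT
  set c := 2 * T + π with hc
  have hc0 : 0 < c := by positivity
  set Λ := resSize γ s L with hΛ
  have hΛ0 : 0 ≤ Λ := resSize_nonneg γ s L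
  set X₅ := 6 / s * (L : ℝ) ^ (1 - γ + s) with hX₅
  have hX₅0 : 0 ≤ X₅ := by positivity
  set f₁ : ℝ → ℝ := fun y => 2 * c * τ * (a * B) * (w y * ‖ψ 0 y‖) with hf₁
  set f₂ : ℝ → ℝ := fun y => defectConst T * (B + 2) * (w y * ‖ψ 0 y‖) with hf₂
  set f₃ : ℝ → ℝ := fun y => defectConst T * τ * V y with hf₃
  set f₄ : ℝ → ℝ := fun y => defectConst T * V y with hf₄
  set f₅ : ℝ → ℝ := fun y => 4 * T * τ ^ 2 * V y with hf₅
  have hwψ : Measurable fun y => w y * ‖ψ 0 y‖ := hwm.mul hψ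
  have hV := S.meas_V
  have key := Q.total_le (v₁ := fun y => ENNReal.ofReal (f₁ y))
    (v₂ := fun y => ENNReal.ofReal (f₂ y)) (v₃ := fun y => ENNReal.ofReal (f₃ y))
    (v₄ := fun y => ENNReal.ofReal (f₄ y)) (v₅ := fun y => ENNReal.ofReal (f₅ y))
    (hwψ.const_mul _).ennreal_ofReal (hwψ.const_mul _).ennreal_ofReal
    (hV.const_mul _).ennreal_ofReal (hV.const_mul _).ennreal_ofReal
    (hV.const_mul _).ennreal_ofReal
    (tsum_first_le prm hL) (tsum_src_le prm hL) (tsum_near_le prm hL) (tsum_tri_le prm hL)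
    (tsum_pw_le prm hL) (tsum_pw_le prm hL)
  refine (le_trans (lintegral_mono fun ξ => (S.enorm_localDefect_le hτ.le hn ξ).trans
      (lintegral_mono fun η => mul_le_mul_right (add_le_add ?_
        (lintegral_mono fun ζ => mul_le_mul_right ?_ _)) _)) key).trans ?_
  · have h1 := G.norm_inner_le_abs (A ξ) (A η)
    have h2 := norm_expSum_le_of_le G le_rfl hn (A ξ) (A η)
    have hp := pw_nonneg L (cell h (A ξ))
    have hd := dw_nonneg hL (cell h (A ξ) - cell h (A η))
    have hwη := hw η
    rw [← ENNReal.ofReal_mul (by positivity)]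
    refine enorm_le_ofReal ?_
    rw [norm_mul, norm_mul]
    calc _ ≤ (2 * τ * pw L (cell h (A ξ)) * (τ * |A η|)) *
          ((2 * T + π) / τ * dw L (cell h (A ξ) - cell h (A η))) * ‖ψ 0 η‖ := by gcongr
      _ = 2 * c * τ * |A η| * (pw L (cell h (A ξ)) * dw L (cell h (A ξ) - cell h (A η))) *
          ‖ψ 0 η‖ := by rw [hc]; field_simp
      _ ≤ 2 * c * τ * (a * (B * w η)) *
          (pw L (cell h (A ξ)) * dw L (cell h (A ξ) - cell h (A η))) * ‖ψ 0 η‖ := by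
        gcongr; exact hA η
      _ = _ := by rw [hf₁]; ring
  · refine (S.enorm_density_le G hn (A ξ) (A η) ζ).trans ?_
    rw [add_assoc, add_assoc]
    have hs := srcW_nonneg hL (cell h (A ξ)) (cell h (A η)) (cell h (A ζ))
    have hnr := nearW_nonneg hL (cell h (A ξ)) (cell h (A η)) (cell h (A ζ))
    have hj := jb_pos (cell h (A ζ))
    have hwζ := hw ζ
    refine add_le_add ?_ (add_le_add ?_ (add_le_add ?_ ?_))
    · rw [← ENNReal.ofReal_mul (by positivity)]
      refine ENNReal.ofReal_le_ofReal ?_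
      have h1 : jb (cell h (A ζ)) ≤ (B + 2) * w ζ := by
        have h2 := G.jb_cell_le (A ζ)
        have h3 := hA ζ
        have h4 : a * (B * w ζ) ≤ 1 * (B * w ζ) := by gcongr
        linarith
      calc _ = defectConst T * (jb (cell h (A ζ)) * ((jb (cell h (A ζ)))⁻¹ *
            srcW L (cell h (A ξ)) (cell h (A η)) (cell h (A ζ)) * ‖ψ 0 ζ‖)) := by
            field_simp
        _ ≤ defectConst T * ((B + 2) * w ζ * ((jb (cell h (A ζ)))⁻¹ *
            srcW L (cell h (A ξ)) (cell h (A η)) (cell h (A ζ)) * ‖ψ 0 ζ‖)) := by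
            gcongr
        _ = _ := by rw [hf₂]; ring
    · rw [← ENNReal.ofReal_mul hnr]
      exact ENNReal.ofReal_le_ofReal (le_of_eq (by rw [hf₃]; ring))
    · refine lintegral_mono fun θ => mul_le_mul_right ?_ _
      rw [← ENNReal.ofReal_mul (triW_nonneg hL _ _ _ _)]
      exact ENNReal.ofReal_le_ofReal (le_of_eq (by rw [hf₄]; ring))
    · refine lintegral_mono fun θ => mul_le_mul_right ?_ _
      have hp := pw_nonneg L (cell h (A ξ) - cell h (A η))
      have hp' := pw_nonneg L (cell h (A ζ) - cell h (A θ))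
      rw [← ENNReal.ofReal_mul hp, ← ENNReal.ofReal_mul (by positivity)]
      exact ENNReal.ofReal_le_ofReal (le_of_eq (by rw [hf₅]; ring))
  · have b₁ := lintegral_ofReal_mul_le hwψ (c := 2 * c * τ * (a * B)) (by positivity) hM₀
    have b₂ := lintegral_ofReal_mul_le hwψ (c := defectConst T * (B + 2)) (by positivity) hM₀
    have b₃ := lintegral_ofReal_mul_le hV (c := defectConst T * τ) (by positivity) hMV
    have b₄ := lintegral_ofReal_mul_le hV (c := defectConst T) (by positivity) hMV
    have b₅ := lintegral_ofReal_mul_le hV (c := 4 * T * τ ^ 2) (by positivity) hMV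
    have hLi : (0 : ℝ) ≤ (L : ℝ)⁻¹ := by positivity
    have hfin : ENNReal.ofReal D * ENNReal.ofReal 1944 * ENNReal.ofReal (2 * c * τ * (a * B) * M) +
        (ENNReal.ofReal D * ENNReal.ofReal D * ENNReal.ofReal (46656 * ((L : ℝ)⁻¹ + Λ)) *
          ENNReal.ofReal (defectConst T * (B + 2) * M) +
        (ENNReal.ofReal D * ENNReal.ofReal D * ENNReal.ofReal (1944 * 12) *
          ENNReal.ofReal (defectConst T * τ * M) +
        (ENNReal.ofReal D * ENNReal.ofReal D * ENNReal.ofReal D * ENNReal.ofReal (1119744 * Λ) *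
          ENNReal.ofReal (defectConst T * M) +
        ENNReal.ofReal D * ENNReal.ofReal X₅ * (ENNReal.ofReal R * (ENNReal.ofReal D *
          ENNReal.ofReal X₅ * ENNReal.ofReal (4 * T * τ ^ 2 * M)))))) =
        ENNReal.ofReal (D * 1944 * (2 * c * τ * (a * B) * M) +
          (D * D * (46656 * ((L : ℝ)⁻¹ + Λ)) * (defectConst T * (B + 2) * M) +
          (D * D * (1944 * 12) * (defectConst T * τ * M) +
          (D * D * D * (1119744 * Λ) * (defectConst T * M) +
          D * X₅ * (R * (D * X₅ * (4 * T * τ ^ 2 * M))))))) := by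
      simp (disch := positivity) only [← ENNReal.ofReal_mul, ← ENNReal.ofReal_add]
    refine (add_le_add (mul_le_mul_right b₁ _) (add_le_add (mul_le_mul_right b₂ _)
      (add_le_add (mul_le_mul_right b₃ _) (add_le_add (mul_le_mul_right b₄ _)
      (mul_le_mul_right (mul_le_mul_right (mul_le_mul_right b₅ _) _) _))))).trans ?_
    rw [hfin]
    refine ENNReal.ofReal_le_ofReal ?_
    have hcC : 1600 * c ≤ defectConst T := by
      unfold defectConst
      rw [← hc]
      nlinarith [mul_nonneg hT hc0.le, mul_nonneg (mul_nonneg hT hT) hc0.le]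
    have hTC : 1600 * T ≤ defectConst T := by linarith
    have hLτ : (L : ℝ)⁻¹ ≤ τ := by
      have hp := G.period
      rw [inv_le_iff_one_le_mul₀ (by positivity)]
      have : τ * h * L ≤ τ * 2 * L := by gcongr
      linarith
    have hX : X₅ ^ 2 * τ ^ 2 ≤ 1600 * Λ := by
      have e1 : X₅ ^ 2 * τ ^ 2 = 36 * (τ * L) ^ 2 * Λ := by
        have e2 : ((L : ℝ) ^ (1 - γ + s)) ^ 2 = (L : ℝ) ^ 2 * (L : ℝ) ^ (2 * s - 2 * γ) := by
          rw [← rpow_natCast (L : ℝ) 2, ← rpow_add (by positivity), ← rpow_natCast,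
            ← rpow_mul (by positivity)]
          congr 1; push_cast; ring
        rw [hX₅, hΛ, resSize, mul_pow, e2]
        field_simp; ring
      have h1 := G.tau_mul_L_le
      have h2 : (τ * L) ^ 2 ≤ (2 * π) ^ 2 := by gcongr
      rw [e1]
      gcongr
      nlinarith
    set E := defectConst T with hE
    have t₁ : D * 1944 * (2 * c * τ * (a * B) * M) ≤
        10 ^ 7 * E * (B + 2) * M * (D * (a * τ)) := by
      have h1 : 2 * 1944 * c * B ≤ 10 ^ 7 * E * (B + 2) := by nlinarith
      calc _ = 2 * 1944 * c * B * M * (D * (a * τ)) := by ring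
        _ ≤ _ := by gcongr
    have t₂ : D * D * (46656 * ((L : ℝ)⁻¹ + Λ)) * (E * (B + 2) * M) +
        D * D * (1944 * 12) * (E * τ * M) ≤
        5 * 10 ^ 6 * E * (B + 2) * M * (D ^ 2 * (τ + Λ)) := by
      have h1 : D ^ 2 * (46656 * ((L : ℝ)⁻¹ + Λ)) * (E * (B + 2) * M) ≤
          D ^ 2 * (46656 * (τ + Λ)) * (E * (B + 2) * M) := by gcongr
      have h2 : D ^ 2 * (1944 * 12) * (E * τ * M) * 1 ≤
          D ^ 2 * (1944 * 12) * (E * (τ + Λ) * M) * (B + 2) := by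
        gcongr <;> linarith
      have h3 : 0 ≤ E * (B + 2) * M * (D ^ 2 * (τ + Λ)) := by positivity
      linarith
    have t₃ : D * D * D * (1119744 * Λ) * (E * M) ≤
        10 ^ 7 * E * (B + 2) * M * (D ^ 3 * Λ) := by
      have h1 : 0 ≤ E * M * (D ^ 3 * Λ) := by positivity
      have h2 := mul_nonneg hB h1
      linarith
    have t₄ : D * X₅ * (R * (D * X₅ * (4 * T * τ ^ 2 * M))) ≤
        10 ^ 7 * E * (B + 2) * M * (D ^ 2 * R * Λ) := by
      have h1 : X₅ ^ 2 * τ ^ 2 * (4 * T) * (D ^ 2 * R * M) ≤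
          1600 * Λ * (4 * T) * (D ^ 2 * R * M) := by gcongr
      have h2 : 1600 * T * (4 * Λ * (D ^ 2 * R * M)) ≤ E * (4 * Λ * (D ^ 2 * R * M)) := by
        gcongr
      have h3 : 0 ≤ E * M * (D ^ 2 * R * Λ) := by positivity
      have h4 := mul_nonneg hB h3
      linarith
    have t₅ : 0 ≤ E * (B + 2) * M * (D ^ 2 * (τ + Λ)) := by positivity
    linarith

end DuhamelFlow

lemma measurable_intervalIntegral {E : Type*} [NormedAddCommGroup E] [NormedSpace ℝ E]
    [MeasurableSpace E] [BorelSpace E] [SecondCountableTopology E] {f : ℝ → ℝ → E}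
    (hf : Measurable (Function.uncurry f)) (a b : ℝ) :
    Measurable fun ξ => ∫ s in a..b, f s ξ := by
  have h : StronglyMeasurable fun p : ℝ × ℝ => f p.2 p.1 :=
    (hf.comp measurable_swap).stronglyMeasurable
  unfold intervalIntegral
  exact (h.integral_prod_right').measurable.sub (h.integral_prod_right').measurable

/-- A bounded measurable kernel whose columns have mass at most `R`. -/
structure IsColumnBounded (K R : ℝ) (k : ℝ → ℝ → ℂ) : Prop where
  meas : Measurable (Function.uncurry k)
  bound : ∀ ξ η, ‖k ξ η‖ ≤ K
  mass : ∀ η, ∫⁻ ξ, ‖k ξ η‖ₑ ≤ ENNReal.ofReal R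

namespace IsColumnBounded
variable {K R : ℝ} {k : ℝ → ℝ → ℂ} (hk : IsColumnBounded K R k)
include hk

lemma nonneg : 0 ≤ K := (norm_nonneg _).trans (hk.bound 0 0)

lemma measurable_row (ξ : ℝ) : Measurable (k ξ) := hk.meas.comp measurable_prodMk_left

lemma lintegral_integral_le {f : ℝ → ℝ → ℂ} {b : ℝ → ℝ≥0∞} (hb : Measurable b)
    (hf : ∀ ξ η, ‖f ξ η‖ₑ ≤ b η) :
    ∫⁻ ξ, ‖∫ η, k ξ η * f ξ η‖ₑ ≤ ENNReal.ofReal R * ∫⁻ η, b η := by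
  have hq : Measurable fun p : ℝ × ℝ => ‖k p.1 p.2‖ₑ * b p.2 :=
    hk.meas.enorm.mul (hb.comp measurable_snd)
  calc ∫⁻ ξ, ‖∫ η, k ξ η * f ξ η‖ₑ ≤ ∫⁻ ξ, ∫⁻ η, ‖k ξ η‖ₑ * b η := by
        refine lintegral_mono fun ξ => (enorm_integral_le_lintegral_enorm _).trans ?_
        refine lintegral_mono fun η => ?_
        rw [enorm_mul]
        exact mul_le_mul_right (hf ξ η) _
    _ = ∫⁻ η, ∫⁻ ξ, ‖k ξ η‖ₑ * b η := lintegral_lintegral_swap hq.aemeasurable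
    _ = ∫⁻ η, (∫⁻ ξ, ‖k ξ η‖ₑ) * b η := by
        refine lintegral_congr fun η => lintegral_mul_const _ ?_
        exact (hk.meas.comp measurable_prodMk_right).enorm
    _ ≤ ∫⁻ η, ENNReal.ofReal R * b η := lintegral_mono fun η => mul_le_mul_left (hk.mass η) _
    _ = _ := lintegral_const_mul _ hb

end IsColumnBounded

/-- Solution of the twisted Duhamel equation with kernel `k` and phase `A`. -/
structure IsKernelSolution (T K R M : ℝ) (A : ℝ → ℝ) (k : ℝ → ℝ → ℂ) (μ : ℝ → ℂ)
    (φ : ℝ → ℝ → ℂ) : Prop where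
  T_pos : 0 < T
  R_nonneg : 0 ≤ R
  meas_A : Measurable A
  kern : IsColumnBounded K R k
  meas_μ : Measurable μ
  int_μ : Integrable μ
  meas : Measurable (Function.uncurry φ)
  mass : ∀ z ∈ Set.Icc 0 T, ∫⁻ ξ, ‖φ z ξ‖ₑ ≤ ENNReal.ofReal M
  eqn : ∀ z ∈ Set.Icc 0 T, ∀ᵐ ξ, φ z ξ =
    μ ξ + ∫ s in (0:ℝ)..z, ∫ η, k ξ η * (ex (s * (A ξ - A η)) * φ s η)

/-- The twisted potential term. -/
noncomputable def rateOf (A : ℝ → ℝ) (k : ℝ → ℝ → ℂ) (φ : ℝ → ℝ → ℂ) (s ξ : ℝ) : ℂ :=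
  ∫ η, k ξ η * (ex (s * (A ξ - A η)) * φ s η)

namespace IsKernelSolution
variable {T K R M : ℝ} {A : ℝ → ℝ} {k : ℝ → ℝ → ℂ} {μ : ℝ → ℂ} {φ : ℝ → ℝ → ℂ}
  (S : IsKernelSolution T K R M A k μ φ)
include S

lemma measurable_slice (s : ℝ) : Measurable (φ s) := S.meas.comp measurable_prodMk_left

lemma measurable_rateOf : Measurable (Function.uncurry (rateOf A k φ)) := by
  have hA := S.meas_A
  have h : Measurable fun p : (ℝ × ℝ) × ℝ =>
      k p.1.2 p.2 * (ex (p.1.1 * (A p.1.2 - A p.2)) * φ p.1.1 p.2) := by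
    have h1 : Measurable fun p : (ℝ × ℝ) × ℝ => k p.1.2 p.2 :=
      S.kern.meas.comp ((measurable_snd.comp measurable_fst).prodMk measurable_snd)
    have h2 : Measurable fun p : (ℝ × ℝ) × ℝ => φ p.1.1 p.2 :=
      S.meas.comp ((measurable_fst.comp measurable_fst).prodMk measurable_snd)
    have h3 : Measurable fun p : (ℝ × ℝ) × ℝ => ex (p.1.1 * (A p.1.2 - A p.2)) :=
      continuous_ex.measurable.comp (by fun_prop)
    exact h1.mul (h3.mul h2)
  exact (h.stronglyMeasurable.integral_prod_right').measurable

lemma lintegral_rateOf_le (s : ℝ) :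
    ∫⁻ ξ, ‖rateOf A k φ s ξ‖ₑ ≤ ENNReal.ofReal R * ∫⁻ η, ‖φ s η‖ₑ :=
  S.kern.lintegral_integral_le (S.measurable_slice s).enorm fun ξ η => by
    rw [enorm_mul, ← ofReal_norm (ex _), norm_ex]; simp

lemma integrable_slice {s : ℝ} (hs : s ∈ Set.Icc 0 T) : Integrable (φ s) :=
  ⟨(S.measurable_slice s).aestronglyMeasurable,
    lt_of_le_of_lt (S.mass s hs) ENNReal.ofReal_lt_top⟩

lemma norm_rateOf_le {s : ℝ} (hs : s ∈ Set.Icc 0 T) (ξ : ℝ) :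
    ‖rateOf A k φ s ξ‖ ≤ K * (ENNReal.ofReal M).toReal := by
  have hi := S.integrable_slice hs
  calc ‖rateOf A k φ s ξ‖ ≤ ∫ η, K * ‖φ s η‖ := by
        refine norm_integral_le_of_norm_le (hi.norm.const_mul K) (.of_forall fun η => ?_)
        rw [norm_mul, norm_mul, norm_ex, one_mul]
        exact mul_le_mul_of_nonneg_right (S.kern.bound ξ η) (norm_nonneg _)
    _ = K * ∫ η, ‖φ s η‖ := integral_const_mul _ _
    _ ≤ _ := by
        refine mul_le_mul_of_nonneg_left ?_ S.kern.nonneg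
        rw [integral_norm_eq_lintegral_enorm hi.1]
        exact ENNReal.toReal_mono ENNReal.ofReal_ne_top (S.mass s hs)

lemma intervalIntegrable_rateOf {a b : ℝ} (ha : a ∈ Set.Icc 0 T) (hb : b ∈ Set.Icc 0 T) (ξ : ℝ) :
    IntervalIntegrable (fun s => rateOf A k φ s ξ) volume a b := by
  refine (intervalIntegrable_const (c := K * (ENNReal.ofReal M).toReal)).mono_fun' ?_ ?_
  · exact (S.measurable_rateOf.comp measurable_prodMk_right).aestronglyMeasurable
  · refine (ae_restrict_iff' measurableSet_uIoc).2 (.of_forall fun s hs => ?_)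
    exact S.norm_rateOf_le (Set.uIcc_subset_Icc ha hb (Set.uIoc_subset_uIcc hs)) ξ

lemma mass_le_add {z : ℝ} (hz : z ∈ Set.Icc 0 T) :
    ∫⁻ ξ, ‖φ z ξ‖ₑ ≤ (∫⁻ ξ, ‖μ ξ‖ₑ) +
      ∫⁻ s in Set.Ioc 0 z, ENNReal.ofReal R * ∫⁻ η, ‖φ s η‖ₑ := by
  have hm := S.measurable_rateOf
  calc ∫⁻ ξ, ‖φ z ξ‖ₑ ≤ ∫⁻ ξ, (‖μ ξ‖ₑ + ∫⁻ s in Set.Ioc 0 z, ‖rateOf A k φ s ξ‖ₑ) := by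
        refine lintegral_mono_ae ((S.eqn z hz).mono fun ξ h => ?_)
        rw [h]
        refine (enorm_add_le _ _).trans (add_le_add le_rfl ?_)
        rw [intervalIntegral.integral_of_le hz.1]
        exact enorm_integral_le_lintegral_enorm _
    _ = (∫⁻ ξ, ‖μ ξ‖ₑ) + ∫⁻ ξ, ∫⁻ s in Set.Ioc 0 z, ‖rateOf A k φ s ξ‖ₑ :=
        lintegral_add_left S.meas_μ.enorm _
    _ = (∫⁻ ξ, ‖μ ξ‖ₑ) + ∫⁻ s in Set.Ioc 0 z, ∫⁻ ξ, ‖rateOf A k φ s ξ‖ₑ := by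
        rw [lintegral_lintegral_swap]
        exact (hm.comp measurable_swap).enorm.aemeasurable
    _ ≤ _ := add_le_add le_rfl (lintegral_mono fun s => S.lintegral_rateOf_le s)

lemma mass_le {m : ℝ} (hm0 : 0 ≤ m) (hm : ∫⁻ ξ, ‖μ ξ‖ₑ ≤ ENNReal.ofReal m) {z : ℝ}
    (hz : z ∈ Set.Icc 0 T) :
    ∫⁻ ξ, ‖φ z ξ‖ₑ ≤ ENNReal.ofReal (2 * m * exp (2 * R * T)) := by
  have hR := S.R_nonneg
  set N : ℝ → ℝ≥0∞ := fun s => ∫⁻ ξ, ‖φ s ξ‖ₑ with hN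
  set X : ℝ≥0∞ := ⨆ s : Set.Icc (0:ℝ) T, ENNReal.ofReal (exp (-(2 * R * s))) * N s with hX
  have hNX : ∀ s ∈ Set.Icc 0 T, N s ≤ ENNReal.ofReal (exp (2 * R * s)) * X := by
    intro s hs
    have h1 : ENNReal.ofReal (exp (-(2 * R * s))) * N s ≤ X :=
      le_iSup (fun s : Set.Icc (0:ℝ) T => ENNReal.ofReal (exp (-(2 * R * s))) * N s) ⟨s, hs⟩
    calc N s = ENNReal.ofReal (exp (2 * R * s)) * (ENNReal.ofReal (exp (-(2 * R * s))) * N s) := by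
          rw [← mul_assoc, ← ENNReal.ofReal_mul (exp_pos _).le, ← exp_add]; simp
      _ ≤ _ := mul_le_mul_right h1 _
  have hXtop : X ≠ ⊤ := by
    refine ne_top_of_le_ne_top (ENNReal.ofReal_ne_top (r := M)) (iSup_le fun s => ?_)
    have : ENNReal.ofReal (exp (-(2 * R * s))) ≤ 1 := by
      have := s.2.1
      rw [← ENNReal.ofReal_one]
      exact ENNReal.ofReal_le_ofReal (exp_le_one_iff.2 (neg_nonpos.2 (by positivity)))
    calc _ ≤ 1 * N s := mul_le_mul_left this _
      _ ≤ _ := by rw [one_mul]; exact S.mass s s.2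
  have hInt : ∀ z, 0 ≤ z → ∫⁻ s in Set.Ioc 0 z, ENNReal.ofReal (R * exp (2 * R * s)) ≤
      ENNReal.ofReal (exp (2 * R * z) / 2) := by
    intro z hz
    have hd : ∀ s ∈ Set.uIcc 0 z, HasDerivAt (fun s => exp (2 * R * s) / 2)
        (R * exp (2 * R * s)) s := fun s _ => by
      have h := (((hasDerivAt_id s).const_mul (2 * R)).exp).div_const 2
      refine h.congr_deriv ?_
      simp only [id]; ring
    have hc : Continuous fun s => R * exp (2 * R * s) := by fun_prop
    have h1 := intervalIntegral.integral_eq_sub_of_hasDerivAt hd (hc.intervalIntegrable _ _)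
    rw [intervalIntegral.integral_of_le hz] at h1
    rw [← ofReal_integral_eq_lintegral_ofReal (hc.integrableOn_Ioc)
      (.of_forall fun s => by positivity), h1]
    refine ENNReal.ofReal_le_ofReal ?_
    simp
  have hXle : X ≤ ENNReal.ofReal m + X * ENNReal.ofReal (1 / 2) := by
    refine iSup_le fun z => ?_
    have hz := z.2
    have h1 : ENNReal.ofReal (exp (-(2 * R * z))) ≤ 1 := by
      have := hz.1
      rw [← ENNReal.ofReal_one]
      exact ENNReal.ofReal_le_ofReal (exp_le_one_iff.2 (neg_nonpos.2 (by positivity)))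
    have h2 : N z ≤ ENNReal.ofReal m + X * ENNReal.ofReal (exp (2 * R * z) / 2) := by
      refine (S.mass_le_add hz).trans (add_le_add hm ?_)
      calc _ ≤ ∫⁻ s in Set.Ioc 0 (z:ℝ), X * ENNReal.ofReal (R * exp (2 * R * s)) := by
            refine setLIntegral_mono_ae' measurableSet_Ioc (.of_forall fun s hs => ?_)
            rw [ENNReal.ofReal_mul hR, mul_comm X, mul_assoc]
            exact mul_le_mul_right (hNX s ⟨hs.1.le, hs.2.trans hz.2⟩) _
        _ = X * ∫⁻ s in Set.Ioc 0 (z:ℝ), ENNReal.ofReal (R * exp (2 * R * s)) :=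
            lintegral_const_mul _ (by fun_prop)
        _ ≤ _ := mul_le_mul_right (hInt z hz.1) _
    calc _ ≤ ENNReal.ofReal (exp (-(2 * R * z))) *
          (ENNReal.ofReal m + X * ENNReal.ofReal (exp (2 * R * z) / 2)) := mul_le_mul_right h2 _
      _ = ENNReal.ofReal (exp (-(2 * R * z))) * ENNReal.ofReal m +
          X * (ENNReal.ofReal (exp (-(2 * R * z))) * ENNReal.ofReal (exp (2 * R * z) / 2)) := by
          ring
      _ ≤ 1 * ENNReal.ofReal m + X * ENNReal.ofReal (1 / 2) := by
          refine add_le_add (mul_le_mul_left h1 _) (mul_le_mul_right (le_of_eq ?_) _)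
          rw [← ENNReal.ofReal_mul (exp_pos _).le, ← mul_div_assoc, ← exp_add]; simp
      _ = _ := by rw [one_mul]
  have hX2 : X ≤ ENNReal.ofReal (2 * m) := by
    rw [← ENNReal.ofReal_toReal hXtop] at hXle ⊢
    have hx := ENNReal.toReal_nonneg (a := X)
    rw [← ENNReal.ofReal_mul hx, ← ENNReal.ofReal_add hm0 (by positivity),
      ENNReal.ofReal_le_ofReal_iff (by positivity)] at hXle
    exact ENNReal.ofReal_le_ofReal (by linarith)
  calc N z ≤ ENNReal.ofReal (exp (2 * R * z)) * X := hNX z hz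
    _ ≤ ENNReal.ofReal (exp (2 * R * T)) * ENNReal.ofReal (2 * m) := by
        refine mul_le_mul' (ENNReal.ofReal_le_ofReal ?_) hX2
        have := hz.2
        gcongr
    _ = _ := by rw [← ENNReal.ofReal_mul (exp_pos _).le, mul_comm]

end IsKernelSolution

/-- Projection of the time axis onto `[0, T]`. -/
noncomputable def clampT (T s : ℝ) : ℝ := max 0 (min s T)

@[fun_prop]
lemma continuous_clampT (T : ℝ) : Continuous (clampT T) := by unfold clampT; fun_prop

lemma clampT_mem {T : ℝ} (hT : 0 ≤ T) (s : ℝ) : clampT T s ∈ Set.Icc 0 T :=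
  ⟨le_max_left _ _, max_le hT (min_le_right _ _)⟩

lemma clampT_eq {T s : ℝ} (hs : s ∈ Set.Icc 0 T) : clampT T s = s := by
  unfold clampT
  rw [min_eq_left hs.2, max_eq_right hs.1]

/-- Pointwise majorant of the trajectories of `φ`. -/
noncomputable def majorant (T : ℝ) (A : ℝ → ℝ) (k : ℝ → ℝ → ℂ) (μ : ℝ → ℂ) (φ : ℝ → ℝ → ℂ)
    (ξ : ℝ) : ℝ :=
  ‖μ ξ‖ + ∫ s in (0:ℝ)..T, ‖rateOf A k φ s ξ‖

/-- Version of `φ`, continuous in time and stopped outside `[0, T]`. -/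
noncomputable def stopped (T : ℝ) (A : ℝ → ℝ) (k : ℝ → ℝ → ℂ) (μ : ℝ → ℂ) (φ : ℝ → ℝ → ℂ)
    (s ξ : ℝ) : ℂ :=
  μ ξ + ∫ r in (0:ℝ)..clampT T s, rateOf A k φ r ξ

/-- The rate of the version of `φ` that is `C¹` in time. -/
noncomputable def flowRate (T : ℝ) (A : ℝ → ℝ) (k : ℝ → ℝ → ℂ) (μ : ℝ → ℂ) (φ : ℝ → ℝ → ℂ)
    (s ξ : ℝ) : ℂ :=
  ∫ η, k ξ η * (ex (clampT T s * (A ξ - A η)) * stopped T A k μ φ s η)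

/-- Version of `φ` that is `C¹` in time. -/
noncomputable def flow (T : ℝ) (A : ℝ → ℝ) (k : ℝ → ℝ → ℂ) (μ : ℝ → ℂ) (φ : ℝ → ℝ → ℂ)
    (z ξ : ℝ) : ℂ :=
  μ ξ + ∫ s in (0:ℝ)..z, flowRate T A k μ φ s ξ

namespace IsKernelSolution
variable {T K R M : ℝ} {A : ℝ → ℝ} {k : ℝ → ℝ → ℂ} {μ : ℝ → ℂ} {φ : ℝ → ℝ → ℂ}
  (S : IsKernelSolution T K R M A k μ φ)
include S

lemma measurable_majorant : Measurable (majorant T A k μ φ) :=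
  S.meas_μ.norm.add (measurable_intervalIntegral (f := fun s ξ => ‖rateOf A k φ s ξ‖)
    S.measurable_rateOf.norm 0 T)

lemma majorant_nonneg (ξ : ℝ) : 0 ≤ majorant T A k μ φ ξ :=
  add_nonneg (norm_nonneg _)
    (intervalIntegral.integral_nonneg S.T_pos.le fun _ _ => norm_nonneg _)

lemma lintegral_majorant_le {m X : ℝ} (hm0 : 0 ≤ m) (hX0 : 0 ≤ X)
    (hm : ∫⁻ ξ, ‖μ ξ‖ₑ ≤ ENNReal.ofReal m)
    (hX : ∀ z ∈ Set.Icc 0 T, ∫⁻ ξ, ‖φ z ξ‖ₑ ≤ ENNReal.ofReal X) :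
    ∫⁻ ξ, ENNReal.ofReal (majorant T A k μ φ ξ) ≤ ENNReal.ofReal (m + T * (R * X)) := by
  have hT := S.T_pos
  have hR := S.R_nonneg
  have hmeas := S.measurable_rateOf
  calc ∫⁻ ξ, ENNReal.ofReal (majorant T A k μ φ ξ) ≤
        ∫⁻ ξ, (‖μ ξ‖ₑ + ∫⁻ s in Set.Ioc 0 T, ‖rateOf A k φ s ξ‖ₑ) := by
        refine lintegral_mono fun ξ => ?_
        refine ENNReal.ofReal_add_le.trans (add_le_add (ofReal_norm _).le ?_)
        rw [intervalIntegral.integral_of_le hT.le]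
        refine (ofReal_integral_norm_eq_lintegral_enorm ?_).le
        exact (S.intervalIntegrable_rateOf ⟨le_rfl, hT.le⟩ ⟨hT.le, le_rfl⟩ ξ).1
    _ = (∫⁻ ξ, ‖μ ξ‖ₑ) + ∫⁻ ξ, ∫⁻ s in Set.Ioc 0 T, ‖rateOf A k φ s ξ‖ₑ :=
        lintegral_add_left S.meas_μ.enorm _
    _ = (∫⁻ ξ, ‖μ ξ‖ₑ) + ∫⁻ s in Set.Ioc 0 T, ∫⁻ ξ, ‖rateOf A k φ s ξ‖ₑ := by
        rw [lintegral_lintegral_swap]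
        exact (hmeas.comp measurable_swap).enorm.aemeasurable
    _ ≤ ENNReal.ofReal m + ∫⁻ s in Set.Ioc 0 T, ENNReal.ofReal (R * X) := by
        refine add_le_add hm (setLIntegral_mono_ae' measurableSet_Ioc (.of_forall fun s hs => ?_))
        rw [ENNReal.ofReal_mul hR]
        exact (S.lintegral_rateOf_le s).trans (mul_le_mul_right (hX s ⟨hs.1.le, hs.2⟩) _)
    _ = _ := by
        rw [setLIntegral_const, Real.volume_Ioc, sub_zero, ← ENNReal.ofReal_mul (by positivity),
          ← ENNReal.ofReal_add hm0 (by positivity)]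
        congr 1; ring

lemma norm_stopped_le (s ξ : ℝ) : ‖stopped T A k μ φ s ξ‖ ≤ majorant T A k μ φ ξ := by
  have hT := S.T_pos.le
  have hc := clampT_mem hT s
  refine (norm_add_le _ _).trans (add_le_add le_rfl ?_)
  refine (intervalIntegral.norm_integral_le_integral_norm hc.1).trans ?_
  refine intervalIntegral.integral_mono_interval le_rfl hc.1 hc.2
    (.of_forall fun _ => norm_nonneg _) ?_
  exact (S.intervalIntegrable_rateOf ⟨le_rfl, hT⟩ ⟨hT, le_rfl⟩ ξ).norm

lemma measurable_stopped (s : ℝ) : Measurable (stopped T A k μ φ s) :=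
  S.meas_μ.add (measurable_intervalIntegral S.measurable_rateOf _ _)

lemma continuous_stopped (ξ : ℝ) : Continuous fun s => stopped T A k μ φ s ξ := by
  have hT := S.T_pos.le
  have h : ContinuousOn (fun t => ∫ r in (0:ℝ)..t, rateOf A k φ r ξ) (Set.uIcc 0 T) := by
    refine intervalIntegral.continuousOn_primitive_interval ?_
    rw [Set.uIcc_of_le hT, integrableOn_Icc_iff_integrableOn_Ioc]
    exact (S.intervalIntegrable_rateOf ⟨le_rfl, hT⟩ ⟨hT, le_rfl⟩ ξ).1
  rw [Set.uIcc_of_le hT] at h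
  exact continuous_const.add (h.comp_continuous (continuous_clampT T) (clampT_mem hT))

lemma stopped_ae_eq {z : ℝ} (hz : z ∈ Set.Icc 0 T) :
    ∀ᵐ ξ, stopped T A k μ φ z ξ = φ z ξ := by
  filter_upwards [S.eqn z hz] with ξ h
  rw [h, stopped, clampT_eq hz]
  rfl

lemma flowRate_eq {s : ℝ} (hs : s ∈ Set.Icc 0 T) (ξ : ℝ) :
    flowRate T A k μ φ s ξ = rateOf A k φ s ξ := by
  refine integral_congr_ae ?_
  filter_upwards [S.stopped_ae_eq hs] with η h
  rw [h, clampT_eq hs]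

lemma measurable_flowRate_slice (s : ℝ) : Measurable (flowRate T A k μ φ s) := by
  have hA := S.meas_A
  have h : Measurable fun p : ℝ × ℝ =>
      k p.1 p.2 * (ex (clampT T s * (A p.1 - A p.2)) * stopped T A k μ φ s p.2) := by
    have h2 : Measurable fun p : ℝ × ℝ => stopped T A k μ φ s p.2 :=
      (S.measurable_stopped s).comp measurable_snd
    have h3 : Measurable fun p : ℝ × ℝ => ex (clampT T s * (A p.1 - A p.2)) :=
      continuous_ex.measurable.comp (by fun_prop)
    exact S.kern.meas.mul (h3.mul h2)
  exact (h.stronglyMeasurable.integral_prod_right').measurable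

lemma continuous_flowRate (hV : Integrable (majorant T A k μ φ)) (ξ : ℝ) :
    Continuous fun s => flowRate T A k μ φ s ξ := by
  refine continuous_of_dominated (bound := fun η => K * majorant T A k μ φ η) (fun s => ?_)
    (fun s => .of_forall fun η => ?_) (hV.const_mul K) (.of_forall fun η => ?_)
  · have h3 : Measurable fun η => ex (clampT T s * (A ξ - A η)) :=
      continuous_ex.measurable.comp ((measurable_const.sub S.meas_A).const_mul _)
    exact ((S.kern.measurable_row ξ).mul (h3.mul (S.measurable_stopped s))).aestronglyMeasurable
  · rw [norm_mul, norm_mul, norm_ex, one_mul]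
    exact mul_le_mul (S.kern.bound ξ η) (S.norm_stopped_le s η) (norm_nonneg _) S.kern.nonneg
  · have h1 := S.continuous_stopped η
    fun_prop

lemma flow_eq_stopped {z : ℝ} (hz : z ∈ Set.Icc 0 T) (ξ : ℝ) :
    flow T A k μ φ z ξ = stopped T A k μ φ z ξ := by
  rw [flow, stopped, clampT_eq hz]
  congr 1
  refine intervalIntegral.integral_congr fun s hs => ?_
  rw [Set.uIcc_of_le hz.1] at hs
  exact S.flowRate_eq ⟨hs.1, hs.2.trans hz.2⟩ ξ

lemma flow_ae_eq {z : ℝ} (hz : z ∈ Set.Icc 0 T) : ∀ᵐ ξ, flow T A k μ φ z ξ = φ z ξ := by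
  filter_upwards [S.stopped_ae_eq hz] with ξ h
  rw [S.flow_eq_stopped hz, h]

lemma duhamelFlow (hV : Integrable (majorant T A k μ φ)) :
    DuhamelFlow T K A k (majorant T A k μ φ) (flow T A k μ φ) (flowRate T A k μ φ) where
  T_nonneg := S.T_pos.le
  meas_A := S.meas_A
  meas_k := S.kern.meas
  bound_k := S.kern.bound
  int_V := hV
  meas_V := S.measurable_majorant
  meas := by
    have hg : Measurable (Function.uncurry (flowRate T A k μ φ)) :=
      measurable_uncurry_of_continuous_of_measurable (S.continuous_flowRate hV)
        S.measurable_flowRate_slice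
    refine measurable_uncurry_of_continuous_of_measurable (fun ξ => ?_) fun z =>
      S.meas_μ.add (measurable_intervalIntegral hg 0 z)
    exact continuous_const.add (intervalIntegral.continuous_primitive
      (fun a b => (S.continuous_flowRate hV ξ).intervalIntegrable a b) 0)
  path := fun η => by
    have hc := S.continuous_flowRate hV η
    refine ⟨fun s => ?_, hc, le_of_eq ?_⟩
    · exact (intervalIntegral.integral_hasDerivAt_right (hc.intervalIntegrable _ _)
        (hc.stronglyMeasurableAtFilter _ _) hc.continuousAt).const_add _
    · rw [flow, intervalIntegral.integral_same, add_zero, majorant]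
      congr 1
      refine intervalIntegral.integral_congr fun s hs => ?_
      rw [Set.uIcc_of_le S.T_pos.le] at hs
      simp only [S.flowRate_eq hs]
  rate := fun s hs hsT ξ => by
    rw [flowRate, clampT_eq ⟨hs, hsT⟩]
    simp only [S.flow_eq_stopped ⟨hs, hsT⟩]

lemma integrable_majorant {X : ℝ} (h : ∫⁻ ξ, ENNReal.ofReal (majorant T A k μ φ ξ) ≤
    ENNReal.ofReal X) : Integrable (majorant T A k μ φ) := by
  refine ⟨S.measurable_majorant.aestronglyMeasurable, ?_⟩
  rw [hasFiniteIntegral_iff_ofReal (.of_forall S.majorant_nonneg)]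
  exact lt_of_le_of_lt h ENNReal.ofReal_lt_top

end IsKernelSolution

/-- The exponential integrator with kernel `k` and phase `A`. -/
noncomputable def kernelIter (A : ℝ → ℝ) (k : ℝ → ℝ → ℂ) (μ : ℝ → ℂ) (τ : ℝ) : ℕ → ℝ → ℂ
  | 0 => μ
  | n + 1 => fun ξ => kernelIter A k μ τ n ξ +
      osc 0 τ (A ξ) * ∫ η, k ξ η * (ex (n * τ * (A ξ - A η)) * kernelIter A k μ τ n η)

lemma kernelIter_eq_sum (A : ℝ → ℝ) (k : ℝ → ℝ → ℂ) (μ : ℝ → ℂ) (τ : ℝ) (n : ℕ) (ξ : ℝ) :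
    kernelIter A k μ τ n ξ = μ ξ + ∑ m ∈ Finset.range n,
      osc 0 τ (A ξ) * ∫ η, k ξ η * (ex (m * τ * (A ξ - A η)) * kernelIter A k μ τ m η) := by
  induction n with
  | zero => simp [kernelIter]
  | succ n ih => rw [Finset.sum_range_succ, ← add_assoc, ← ih, kernelIter]

lemma continuous_osc (u v : ℝ) : Continuous (osc u v) := by
  unfold osc
  exact intervalIntegral.continuous_parametric_intervalIntegral_of_continuous' (by fun_prop) u v

lemma IsColumnBounded.integrable_row_mul {K R : ℝ} {k : ℝ → ℝ → ℂ} (hk : IsColumnBounded K R k)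
    {A : ℝ → ℝ} (hA : Measurable A) {f : ℝ → ℂ} (hf : Integrable f) (c ξ : ℝ) :
    Integrable fun η => k ξ η * (ex (c * (A ξ - A η)) * f η) := by
  have h3 : Measurable fun η => ex (c * (A ξ - A η)) :=
    continuous_ex.measurable.comp ((measurable_const.sub hA).const_mul _)
  refine (hf.norm.const_mul K).mono'
    ((hk.measurable_row ξ).aestronglyMeasurable.mul (h3.aestronglyMeasurable.mul hf.1))
    (.of_forall fun η => ?_)
  rw [norm_mul, norm_mul, norm_ex, one_mul]
  exact mul_le_mul_of_nonneg_right (hk.bound ξ η) (norm_nonneg _)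

lemma IsColumnBounded.lintegral_step_le {K R τ : ℝ} {k : ℝ → ℝ → ℂ} (hk : IsColumnBounded K R k)
    (hτ : 0 ≤ τ) (A : ℝ → ℝ) {f : ℝ → ℂ} (hf : Measurable f) (c : ℝ) :
    ∫⁻ ξ, ‖osc 0 τ (A ξ) * ∫ η, k ξ η * (ex (c * (A ξ - A η)) * f η)‖ₑ ≤
      ENNReal.ofReal (τ * R) * ∫⁻ η, ‖f η‖ₑ := by
  rw [ENNReal.ofReal_mul hτ, mul_assoc]
  calc _ ≤ ∫⁻ ξ, ENNReal.ofReal τ * ‖∫ η, k ξ η * (ex (c * (A ξ - A η)) * f η)‖ₑ := by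
        refine lintegral_mono fun ξ => ?_
        rw [enorm_mul]
        refine mul_le_mul_left ?_ _
        have := norm_osc_le_abs 0 τ (A ξ)
        rw [sub_zero, abs_of_nonneg hτ] at this
        rw [← ofReal_norm]
        exact ENNReal.ofReal_le_ofReal this
    _ = ENNReal.ofReal τ * ∫⁻ ξ, ‖∫ η, k ξ η * (ex (c * (A ξ - A η)) * f η)‖ₑ :=
        lintegral_const_mul' _ _ ENNReal.ofReal_ne_top
    _ ≤ _ := mul_le_mul_right (hk.lintegral_integral_le hf.enorm fun ξ η => by
        rw [enorm_mul, ← ofReal_norm (ex _), norm_ex]; simp) _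

lemma enn_gronwall {e : ℕ → ℝ≥0∞} {Δ r : ℝ≥0∞} {N : ℕ}
    (h : ∀ n ≤ N, e n ≤ Δ + ∑ m ∈ Finset.range n, r * e m) : e N ≤ Δ * (1 + r) ^ N := by
  have key : ∀ n ≤ N, Δ + ∑ m ∈ Finset.range n, r * e m ≤ Δ * (1 + r) ^ n := by
    intro n
    induction n with
    | zero => simp
    | succ n ih =>
      intro hn
      have h1 := ih (by omega)
      have h2 := h n (by omega)
      rw [Finset.sum_range_succ, ← add_assoc]
      calc _ ≤ Δ * (1 + r) ^ n + r * (Δ * (1 + r) ^ n) :=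
            add_le_add h1 (mul_le_mul_right (h2.trans h1) _)
        _ = _ := by ring
  exact (h N le_rfl).trans (key N le_rfl)

namespace IsKernelSolution
variable {T K R M : ℝ} {A : ℝ → ℝ} {k : ℝ → ℝ → ℂ} {μ : ℝ → ℂ} {φ : ℝ → ℝ → ℂ}
  (S : IsKernelSolution T K R M A k μ φ)
include S

lemma measurable_kernelIter (τ : ℝ) (n : ℕ) : Measurable (kernelIter A k μ τ n) := by
  have hA := S.meas_A
  induction n with
  | zero => exact S.meas_μ
  | succ n ih =>
    have h : Measurable fun p : ℝ × ℝ =>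
        k p.1 p.2 * (ex (n * τ * (A p.1 - A p.2)) * kernelIter A k μ τ n p.2) := by
      have h3 : Measurable fun p : ℝ × ℝ => ex (n * τ * (A p.1 - A p.2)) :=
        continuous_ex.measurable.comp (by fun_prop)
      exact S.kern.meas.mul (h3.mul (ih.comp measurable_snd))
    exact ih.add (((continuous_osc 0 τ).measurable.comp hA).mul
      (h.stronglyMeasurable.integral_prod_right').measurable)

lemma integrable_kernelIter {τ : ℝ} (hτ : 0 ≤ τ) (n : ℕ) : Integrable (kernelIter A k μ τ n) := by
  induction n with
  | zero => exact S.int_μ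
  | succ n ih =>
    have hm : Measurable fun ξ => osc 0 τ (A ξ) *
        ∫ η, k ξ η * (ex (n * τ * (A ξ - A η)) * kernelIter A k μ τ n η) := by
      have e : (fun ξ => osc 0 τ (A ξ) *
          ∫ η, k ξ η * (ex (n * τ * (A ξ - A η)) * kernelIter A k μ τ n η)) =
          kernelIter A k μ τ (n + 1) - kernelIter A k μ τ n := by
        funext ξ
        simp [kernelIter]
      rw [e]
      exact (S.measurable_kernelIter τ (n + 1)).sub (S.measurable_kernelIter τ n)
    refine ih.add ⟨hm.aestronglyMeasurable, ?_⟩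
    refine lt_of_le_of_lt (S.kern.lintegral_step_le hτ A (S.measurable_kernelIter τ n) (n * τ)) ?_
    exact ENNReal.mul_lt_top ENNReal.ofReal_lt_top ih.2

lemma error_eq (hV : Integrable (majorant T A k μ φ)) {τ : ℝ} (hτ : 0 ≤ τ) {n : ℕ}
    (hn : (n : ℝ) * τ ≤ T) (ξ : ℝ) :
    flow T A k μ φ (n * τ) ξ - kernelIter A k μ τ n ξ =
      localDefect τ A k (flow T A k μ φ) n ξ + ∑ m ∈ Finset.range n, osc 0 τ (A ξ) *
        ∫ η, k ξ η * (ex (m * τ * (A ξ - A η)) *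
          (flow T A k μ φ (m * τ) η - kernelIter A k μ τ m η)) := by
  have F := S.duhamelFlow hV
  have e1 : flow T A k μ φ (n * τ) ξ = μ ξ + ∑ m ∈ Finset.range n,
      (flow T A k μ φ (m * τ + τ) ξ - flow T A k μ φ (m * τ) ξ) := by
    have h := Finset.sum_range_sub (fun m : ℕ => flow T A k μ φ (m * τ) ξ) n
    have h0 : flow T A k μ φ (0 * τ) ξ = μ ξ := by simp [flow]
    simp only [Nat.cast_add, Nat.cast_one, Nat.cast_zero, h0, add_mul, one_mul] at h
    rw [h]; ring
  rw [e1, kernelIter_eq_sum, localDefect, add_sub_add_left_eq_sub, ← Finset.sum_sub_distrib,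
    ← Finset.sum_add_distrib]
  refine Finset.sum_congr rfl fun m hm => ?_
  have hmn : (m : ℝ) ≤ n := by exact_mod_cast (Finset.mem_range.1 hm).le
  have hmT : (m : ℝ) * τ ≤ T := (mul_le_mul_of_nonneg_right hmn hτ).trans hn
  have hm0 : (0 : ℝ) ≤ m * τ := by positivity
  have i1 : Integrable fun η => flow T A k μ φ (m * τ) η :=
    hV.mono' (F.meas.comp measurable_prodMk_left).aestronglyMeasurable
      (.of_forall fun η => F.norm_le hm0 hmT η)
  have i2 := S.integrable_kernelIter hτ m
  simp only [mul_sub (ex _), mul_sub (k ξ _)]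
  rw [integral_sub (S.kern.integrable_row_mul S.meas_A i1 _ ξ)
    (S.kern.integrable_row_mul S.meas_A i2 _ ξ)]
  ring

lemma lintegral_error_le (hV : Integrable (majorant T A k μ φ)) {τ : ℝ} (hτ : 0 ≤ τ) {n : ℕ}
    (hn : (n : ℝ) * τ ≤ T) {Δ : ℝ} (hΔ0 : 0 ≤ Δ)
    (hΔ : ∀ m : ℕ, (m : ℝ) * τ ≤ T →
      ∫⁻ ξ, ‖localDefect τ A k (flow T A k μ φ) m ξ‖ₑ ≤ ENNReal.ofReal Δ) :
    ∫⁻ ξ, ‖φ (n * τ) ξ - kernelIter A k μ τ n ξ‖ₑ ≤ ENNReal.ofReal (Δ * exp (R * T)) := by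
  have F := S.duhamelFlow hV
  have hR := S.R_nonneg
  set e : ℕ → ℝ≥0∞ := fun m => ∫⁻ ξ, ‖flow T A k μ φ (m * τ) ξ - kernelIter A k μ τ m ξ‖ₑ with he
  have hmeas : ∀ m : ℕ, Measurable fun ξ => flow T A k μ φ (m * τ) ξ - kernelIter A k μ τ m ξ :=
    fun m => (F.meas.comp measurable_prodMk_left).sub (S.measurable_kernelIter τ m)
  have hstep : ∀ m ≤ n, e m ≤ ENNReal.ofReal Δ +
      ∑ l ∈ Finset.range m, ENNReal.ofReal (τ * R) * e l := by
    intro m hm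
    have hmn : (m : ℝ) ≤ n := by exact_mod_cast hm
    have hmT : (m : ℝ) * τ ≤ T := (mul_le_mul_of_nonneg_right hmn hτ).trans hn
    have hA := S.meas_A
    have hterm : ∀ l : ℕ, Measurable fun ξ => ‖osc 0 τ (A ξ) * ∫ η, k ξ η *
        (ex (l * τ * (A ξ - A η)) *
          (flow T A k μ φ (l * τ) η - kernelIter A k μ τ l η))‖ₑ := by
      intro l
      have h : Measurable fun p : ℝ × ℝ => k p.1 p.2 * (ex (l * τ * (A p.1 - A p.2)) *
          (flow T A k μ φ (l * τ) p.2 - kernelIter A k μ τ l p.2)) := by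
        have h3 : Measurable fun p : ℝ × ℝ => ex (l * τ * (A p.1 - A p.2)) :=
          continuous_ex.measurable.comp (by fun_prop)
        exact S.kern.meas.mul (h3.mul ((hmeas l).comp measurable_snd))
      exact (((continuous_osc 0 τ).measurable.comp hA).mul
        (h.stronglyMeasurable.integral_prod_right').measurable).enorm
    calc e m ≤ ∫⁻ ξ, (‖localDefect τ A k (flow T A k μ φ) m ξ‖ₑ +
          ∑ l ∈ Finset.range m, ‖osc 0 τ (A ξ) * ∫ η, k ξ η * (ex (l * τ * (A ξ - A η)) *
            (flow T A k μ φ (l * τ) η - kernelIter A k μ τ l η))‖ₑ) := by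
          refine lintegral_mono fun ξ => ?_
          rw [S.error_eq hV hτ hmT ξ]
          exact (enorm_add_le _ _).trans (add_le_add le_rfl (enorm_sum_le _ _))
      _ = (∫⁻ ξ, ‖localDefect τ A k (flow T A k μ φ) m ξ‖ₑ) + ∑ l ∈ Finset.range m,
          ∫⁻ ξ, ‖osc 0 τ (A ξ) * ∫ η, k ξ η * (ex (l * τ * (A ξ - A η)) *
            (flow T A k μ φ (l * τ) η - kernelIter A k μ τ l η))‖ₑ := by
          rw [lintegral_add_right _ (Finset.measurable_sum _ fun l _ => hterm l),
            lintegral_finsetSum _ fun l _ => hterm l]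
      _ ≤ _ := add_le_add (hΔ m hmT) (Finset.sum_le_sum fun l _ =>
          S.kern.lintegral_step_le hτ A (hmeas l) _)
  have hT : n * τ ∈ Set.Icc 0 T := ⟨by positivity, hn⟩
  calc ∫⁻ ξ, ‖φ (n * τ) ξ - kernelIter A k μ τ n ξ‖ₑ = e n := by
        refine lintegral_congr_ae ?_
        filter_upwards [S.flow_ae_eq hT] with ξ h
        rw [h]
    _ ≤ ENNReal.ofReal Δ * (1 + ENNReal.ofReal (τ * R)) ^ n := enn_gronwall hstep
    _ = ENNReal.ofReal (Δ * (1 + τ * R) ^ n) := by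
        rw [ENNReal.ofReal_mul hΔ0, ENNReal.ofReal_pow (by positivity),
          ENNReal.ofReal_add zero_le_one (by positivity), ENNReal.ofReal_one]
    _ ≤ _ := by
        refine ENNReal.ofReal_le_ofReal (mul_le_mul_of_nonneg_left ?_ hΔ0)
        calc (1 + τ * R) ^ n ≤ exp (τ * R) ^ n := by
              gcongr
              rw [add_comm]; exact add_one_le_exp _
          _ = exp (n * τ * R) := by rw [← exp_nat_mul]; ring_nf
          _ ≤ _ := exp_le_exp.2 (by rw [mul_comm R]; gcongr)

end IsKernelSolution

/-- Everywhere bounded version of an essentially bounded function. -/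
noncomputable def truncSup (ρ : ℝ → ℂ) (x : ℝ) : ℂ :=
  if ‖ρ x‖ ≤ (eLpNorm ρ ⊤ volume).toReal then ρ x else 0

lemma norm_truncSup_le (ρ : ℝ → ℂ) (x : ℝ) :
    ‖truncSup ρ x‖ ≤ (eLpNorm ρ ⊤ volume).toReal := by
  unfold truncSup
  split_ifs with h
  · exact h
  · simp

lemma measurable_truncSup {ρ : ℝ → ℂ} (hρ : Measurable ρ) : Measurable (truncSup ρ) :=
  Measurable.ite (measurableSet_le hρ.norm measurable_const) hρ measurable_const

lemma truncSup_ae_eq {ρ : ℝ → ℂ} (hρ : eLpNorm ρ ⊤ volume ≠ ⊤) : truncSup ρ =ᵐ[volume] ρ := by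
  filter_upwards [ae_le_eLpNormEssSup (f := ρ) (μ := volume)] with x hx
  rw [eLpNorm_exponent_top] at hρ
  have h : ‖ρ x‖ ≤ (eLpNorm ρ ⊤ volume).toReal := by
    rw [eLpNorm_exponent_top, ← toReal_enorm]
    exact ENNReal.toReal_mono hρ hx
  exact if_pos h

/-- Kernel of multiplication by the rescaled potential, in Fourier variables. -/
noncomputable def scaledKernel (ε : ℝ) (ρ : ℝ → ℂ) (ξ η : ℝ) : ℂ :=
  ε * truncSup ρ (ε * (ξ - η))

lemma integral_shift {ε : ℝ} (hε : 0 < ε) (F : ℝ → ℝ → ℂ) (ξ : ℝ) :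
    ∫ x, F x (ξ - x / ε) = ε * ∫ η, F (ε * (ξ - η)) η := by
  have h1 := integral_sub_left_eq_self (fun y => F (ε * y) (ξ - y)) volume ξ
  have h2 := Measure.integral_comp_mul_left (fun x => F x (ξ - x / ε)) ε
  have e : ∀ y, ξ - ε * y / ε = ξ - y := fun y => by field_simp
  simp only [e] at h2
  simp only [sub_sub_cancel] at h1
  rw [h1, h2, abs_of_pos (by positivity), Complex.real_smul, ← mul_assoc]
  push_cast
  rw [mul_inv_cancel₀ (by exact_mod_cast hε.ne'), one_mul]

lemma isColumnBounded_scaledKernel {ε : ℝ} (hε : 0 < ε) {ρ : ℝ → ℂ} (hρm : Measurable ρ)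
    (hρ1 : Integrable ρ) (hρ : eLpNorm ρ ⊤ volume ≠ ⊤) :
    IsColumnBounded (ε * (eLpNorm ρ ⊤ volume).toReal) (∫ x, ‖ρ x‖) (scaledKernel ε ρ) := by
  have hm := measurable_truncSup hρm
  refine ⟨?_, fun ξ η => ?_, fun η => ?_⟩
  · have : Measurable fun p : ℝ × ℝ => ε * (p.1 - p.2) := by fun_prop
    exact (hm.comp this).const_mul _
  · rw [scaledKernel, norm_mul, Complex.norm_real, Real.norm_eq_abs, abs_of_pos hε]
    exact mul_le_mul_of_nonneg_left (norm_truncSup_le ρ _) hε.le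
  · have hi : Integrable (truncSup ρ) := hρ1.congr (truncSup_ae_eq hρ).symm
    have hi2 : Integrable fun ξ => scaledKernel ε ρ ξ η :=
      ((hi.comp_mul_left' hε.ne').comp_sub_right η).const_mul _
    rw [← ofReal_integral_norm_eq_lintegral_enorm hi2]
    refine ENNReal.ofReal_le_ofReal (le_of_eq ?_)
    have e : ∀ ξ, ‖scaledKernel ε ρ ξ η‖ = ε * ‖truncSup ρ (ε * (ξ - η))‖ := fun ξ => by
      rw [scaledKernel, norm_mul, Complex.norm_real, Real.norm_eq_abs, abs_of_pos hε]
    simp only [e]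
    rw [integral_const_mul, integral_sub_right_eq_self (fun y => ‖truncSup ρ (ε * y)‖) η,
      Measure.integral_comp_mul_left (fun y => ‖truncSup ρ y‖), abs_of_pos (by positivity),
      smul_eq_mul, ← mul_assoc, mul_inv_cancel₀ hε.ne', one_mul]
    refine integral_congr_ae ?_
    filter_upwards [truncSup_ae_eq hρ] with x hx
    rw [hx]

lemma integral_scaledKernel {ε : ℝ} (hε : 0 < ε) {ρ : ℝ → ℂ} (hρ : eLpNorm ρ ⊤ volume ≠ ⊤)
    (f : ℝ → ℂ) (ξ : ℝ) :
    ∫ η, scaledKernel ε ρ ξ η * f η = ∫ x, ρ x * f (ξ - x / ε) := by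
  have h : ∫ x, ρ x * f (ξ - x / ε) = ∫ x, truncSup ρ x * f (ξ - x / ε) := by
    refine integral_congr_ae ?_
    filter_upwards [truncSup_ae_eq hρ] with x hx
    rw [hx]
  rw [h, integral_shift hε (fun x y => truncSup ρ x * f y), ← integral_const_mul]
  refine integral_congr_ae (.of_forall fun η => ?_)
  simp only [scaledKernel, mul_assoc]

lemma psiIter_eq_kernelIter (κ : ℕ) (d : ℕ → ℝ) {ρ : ℝ → ℂ} (hρ : eLpNorm ρ ⊤ volume ≠ ⊤)
    (μ₀ : ℝ → ℂ) {ε : ℝ} (hε : 0 < ε) (α τ : ℝ) (n : ℕ) :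
    psiIter κ d ρ μ₀ ε α τ n =
      kernelIter (fun y => ε ^ α * P κ d y) (scaledKernel ε ρ) μ₀ τ n := by
  induction n with
  | zero => rfl
  | succ n ih =>
    funext ξ
    simp only [psiIter, kernelIter]
    rw [integral_scaledKernel hε hρ (fun η =>
      ex (n * τ * (ε ^ α * P κ d ξ - ε ^ α * P κ d η)) * kernelIter (fun y => ε ^ α * P κ d y)
        (scaledKernel ε ρ) μ₀ τ n η), ih]
    congr 1
    have e1 : ∫ s in ((n : ℝ) * τ)..(((n : ℝ) + 1) * τ),
        Complex.exp (Complex.I * Complex.ofReal (s * ε ^ α * P κ d ξ)) =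
        ex (n * τ * (ε ^ α * P κ d ξ)) * osc 0 τ (ε ^ α * P κ d ξ) := by
      rw [← osc_shift, osc, add_zero, add_mul, one_mul]
      simp only [ex, mul_assoc]
    rw [e1, mul_comm (ex _), mul_assoc, ← integral_const_mul]
    congr 1
    refine integral_congr_ae (.of_forall fun x => ?_)
    have e2 : ex (n * τ * (ε ^ α * P κ d ξ - ε ^ α * P κ d (ξ - x / ε))) =
        ex (n * τ * (ε ^ α * P κ d ξ)) * Complex.exp (-Complex.I *
          Complex.ofReal ((n : ℝ) * τ * ε ^ α * P κ d (ξ - x / ε))) := by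
      rw [mul_sub, sub_eq_add_neg, ex_add]
      congr 1
      rw [ex]
      congr 1
      push_cast
      ring
    simp only [e2]
    ring

lemma IsDuhamelSolution.isKernelSolution {κ : ℕ} {d : ℕ → ℝ} {ε α T : ℝ} {ρ μ₀ : ℝ → ℂ}
    {ψ : ℝ → ℝ → ℂ} (h : IsDuhamelSolution κ d ε α T ρ μ₀ ψ) (hε : 0 < ε) (hT : 0 < T)
    (hρm : Measurable ρ) (hρ1 : Integrable ρ) (hρ : eLpNorm ρ ⊤ volume ≠ ⊤)
    (hμm : Measurable μ₀) (hμ1 : Integrable μ₀) :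
    ∃ M, IsKernelSolution T (ε * (eLpNorm ρ ⊤ volume).toReal) (∫ x, ‖ρ x‖) M
      (fun y => ε ^ α * P κ d y) (scaledKernel ε ρ) μ₀ ψ := by
  obtain ⟨hm, ⟨M, hM⟩, heq⟩ := h
  refine ⟨M, hT, integral_nonneg fun _ => norm_nonneg _, (continuous_P κ d).measurable.const_mul _,
    isColumnBounded_scaledKernel hε hρm hρ1 hρ, hμm, hμ1, hm, fun z hz => ?_, fun z hz => ?_⟩
  · refine le_trans (lintegral_mono fun ξ => ?_) (hM z hz)
    rw [← ofReal_norm]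
    refine ENNReal.ofReal_le_ofReal (le_mul_of_one_le_left (norm_nonneg _) ?_)
    have : 0 ≤ |ξ| ^ κ := by positivity
    linarith
  · filter_upwards [heq z hz] with ξ hξ
    rw [hξ]
    congr 1
    refine intervalIntegral.integral_congr fun s _ => ?_
    rw [integral_scaledKernel hε hρ (fun η =>
      ex (s * (ε ^ α * P κ d ξ - ε ^ α * P κ d η)) * ψ s η)]
    refine integral_congr_ae (.of_forall fun x => ?_)
    have e : ex (s * (ε ^ α * P κ d ξ - ε ^ α * P κ d (ξ - x / ε))) = Complex.exp (Complex.I *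
        Complex.ofReal (s * ε ^ α * (P κ d ξ - P κ d (ξ - x / ε)))) := by
      rw [ex]
      congr 3
      ring
    simp only [e]
    ring

lemma volume_cell_le {κ : ℕ} {d : ℕ → ℝ} {γ C : ℝ} (hκ : 2 ≤ κ) (hC : 0 < C)
    (h : ∀ b : ℝ, 0 < b → b ≤ 1 → ∀ k : ℤ, volume {y : ℝ | ⌊b * P κ d y⌋ = k} ≤
      ENNReal.ofReal (C * b ^ (-(1 / (κ : ℝ))) * jb k ^ (-γ)))
    {a H : ℝ} (ha : 0 < a) (ha1 : a ≤ 1) (hH1 : 1 ≤ H) (hH2 : H ≤ 2) (i : ℤ) :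
    volume {y : ℝ | cell H (a * P κ d y) = i} ≤
      ENNReal.ofReal (2 * C * a ^ (-(1 / (κ : ℝ)))) * cellWeight γ i := by
  have hH : 0 < H := by linarith
  have hκ' : (2 : ℝ) ≤ κ := by exact_mod_cast hκ
  have e : {y : ℝ | cell H (a * P κ d y) = i} = {y : ℝ | ⌊(a / H) * P κ d y⌋ = i} := by
    ext y
    simp only [cell, Set.mem_ofPred_eq]
    rw [div_mul_eq_mul_div]
  have hj : 0 ≤ jb i ^ (-γ) := rpow_nonneg (jb_pos i).le _
  rw [e, cellWeight, ← ENNReal.ofReal_mul (by positivity)]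
  refine (h (a / H) (by positivity) ((div_le_one hH).2 (by linarith)) i).trans
    (ENNReal.ofReal_le_ofReal (mul_le_mul_of_nonneg_right ?_ hj))
  have h1 : (a / H) ^ (-(1 / (κ : ℝ))) ≤ 2 * a ^ (-(1 / (κ : ℝ))) := by
    rw [div_rpow ha.le hH.le, rpow_neg hH.le, div_inv_eq_mul, mul_comm]
    refine mul_le_mul_of_nonneg_right ?_ (by positivity)
    calc H ^ (1 / (κ : ℝ)) ≤ H ^ (1 : ℝ) :=
          rpow_le_rpow_of_exponent_le hH1 ((div_le_one (by positivity)).2 (by linarith))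
      _ ≤ 2 := by rw [rpow_one]; exact hH2
  calc _ ≤ C * (2 * a ^ (-(1 / (κ : ℝ)))) := mul_le_mul_of_nonneg_left h1 hC.le
    _ = _ := by ring

/-- Error bound in terms of the density `ε ^ (1 - α / κ)` of resonances and of the resonant
sums. -/
theorem exists_error_le_resSize {κ : ℕ} (hκ : 2 ≤ κ) {d : ℕ → ℝ} (hd : d κ = 1) {α : ℝ}
    (hα : α ∈ Set.Icc (0:ℝ) (κ : ℝ)) {T : ℝ} (hT : 0 < T) {ρ : ℝ → ℂ} (hρm : Measurable ρ)
    (hρ1 : Integrable ρ) (hρinf : eLpNorm ρ ⊤ volume ≠ ⊤) {μ₀ : ℝ → ℂ} (hμm : Measurable μ₀)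
    (hμ1 : Integrable (fun ξ : ℝ => (1 + |ξ| ^ κ) * ‖μ₀ ξ‖)) {γ : ℝ} (hγ0 : 0 ≤ γ)
    (hγ : γ ≤ 1 - 1 / (κ : ℝ)) :
    ∃ C : ℝ, 0 < C ∧ ∀ s, Params γ s → ∀ τ, 0 < τ → τ ≤ 1 → ∀ ε, 0 < ε → ε ≤ 1 →
      ∀ ψ, IsDuhamelSolution κ d ε α T ρ μ₀ ψ → ∃ L : ℕ, 1 ≤ L ∧ (L : ℝ)⁻¹ ≤ τ ∧ τ * L ≤ 2 * π ∧
        ∀ n : ℕ, (n : ℝ) * τ ≤ T →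
          ∫⁻ ξ, ‖ψ (n * τ) ξ - psiIter κ d ρ μ₀ ε α τ n ξ‖ₑ ≤
            ENNReal.ofReal (C * (ε ^ (1 - α / κ) * ε ^ α * τ +
              (ε ^ (1 - α / κ)) ^ 2 * (τ + resSize γ s L))) := by
  obtain ⟨c₀, hc₀, hvol⟩ := exists_volume_cell_le hκ hd hγ0 hγ
  have hκ' : (2 : ℝ) ≤ κ := by exact_mod_cast hκ
  set B := ∑ j ∈ Finset.range ((κ + 1) / 2), |d (κ - 2 * j)| with hB
  have hB0 : 0 ≤ B := Finset.sum_nonneg fun _ _ => abs_nonneg _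
  set R := ∫ x, ‖ρ x‖ with hR
  have hR0 : 0 ≤ R := integral_nonneg fun _ => norm_nonneg _
  set m := ∫ ξ, (1 + |ξ| ^ κ) * ‖μ₀ ξ‖ with hm
  have hm0 : 0 ≤ m := integral_nonneg fun _ => by positivity
  set X := 2 * m * exp (2 * R * T) with hX
  have hX0 : 0 ≤ X := by positivity
  set M := m + T * (R * X) with hM
  have hM0 : 0 ≤ M := by positivity
  set K := (eLpNorm ρ ⊤ volume).toReal with hK
  have hK0 : 0 ≤ K := ENNReal.toReal_nonneg
  set c := K * (2 * c₀) with hc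
  have hc0 : 0 ≤ c := by positivity
  set C₁ := 10 ^ 7 * defectConst T * (B + 2) * M with hC₁
  have hE := defectConst_nonneg hT.le
  have hC₁0 : 0 ≤ C₁ := by positivity
  have hw : ∀ ξ : ℝ, 1 ≤ 1 + |ξ| ^ κ := fun ξ => by
    have : 0 ≤ |ξ| ^ κ := by positivity
    linarith
  have hwm : Measurable fun ξ : ℝ => 1 + |ξ| ^ κ := by fun_prop
  have hmw : ∫⁻ ξ, ENNReal.ofReal ((1 + |ξ| ^ κ) * ‖μ₀ ξ‖) = ENNReal.ofReal m :=
    (ofReal_integral_eq_lintegral_ofReal hμ1 (.of_forall fun ξ => by positivity)).symm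
  have hmμ : ∫⁻ ξ, ‖μ₀ ξ‖ₑ ≤ ENNReal.ofReal m := by
    rw [← hmw]
    refine lintegral_mono fun ξ => ?_
    rw [← ofReal_norm]
    exact ENNReal.ofReal_le_ofReal (le_mul_of_one_le_left (norm_nonneg _) (hw ξ))
  have hμi : Integrable μ₀ :=
    ⟨hμm.aestronglyMeasurable, lt_of_le_of_lt hmμ ENNReal.ofReal_lt_top⟩
  refine ⟨C₁ * (c + c ^ 2 + c ^ 3 + c ^ 2 * R) * exp (R * T) + 1, by positivity, ?_⟩
  intro s prm τ hτ hτ1 ε hε hε1 ψ hψ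
  obtain ⟨h, L, G, hh⟩ := exists_grid hτ hτ1
  have hL := G.one_le_L
  have hLτ : (L : ℝ)⁻¹ ≤ τ := by
    have hp := G.period
    have hπ := Real.pi_gt_three
    rw [inv_le_iff_one_le_mul₀ (by positivity)]
    have : τ * h * L ≤ τ * 2 * L := by gcongr
    linarith
  refine ⟨L, hL, hLτ, G.tau_mul_L_le, fun n hn => ?_⟩
  obtain ⟨M', S⟩ := hψ.isKernelSolution hε hT hρm hρ1 hρinf hμm hμi
  have hVm := S.lintegral_majorant_le hm0 hX0 hmμ (fun z hz => S.mass_le hm0 hmμ hz)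
  have hV := S.integrable_majorant hVm
  have F := S.duhamelFlow hV
  set a := ε ^ α with ha
  have ha0 : 0 < a := rpow_pos_of_pos hε _
  have ha1 : a ≤ 1 := rpow_le_one hε.le hε1 hα.1
  set δ := ε ^ (1 - α / κ) with hδ
  have hδ0 : 0 < δ := rpow_pos_of_pos hε _
  have hδ1 : δ ≤ 1 := rpow_le_one hε.le hε1 (by
    have := (div_le_one (by positivity : (0:ℝ) < κ)).2 hα.2
    linarith)
  have hδa : ε * a ^ (-(1 / (κ : ℝ))) = δ := by
    rw [ha, hδ, ← rpow_mul hε.le, sub_eq_add_neg, rpow_add hε, rpow_one]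
    congr 2
    ring
  set D := c * δ with hD
  have hD0 : 0 ≤ D := by positivity
  have Q : CellKernel (fun ξ η => ‖scaledKernel ε ρ ξ η‖ₑ) (fun y => cell h (a * P κ d y))
      (cellWeight γ) (ENNReal.ofReal D) (ENNReal.ofReal R) := by
    have e : ENNReal.ofReal D = ENNReal.ofReal (ε * K) *
        ENNReal.ofReal (2 * c₀ * a ^ (-(1 / (κ : ℝ)))) := by
      rw [← ENNReal.ofReal_mul (by positivity), hD, hc, ← hδa]
      congr 1; ring
    rw [e]
    refine cellKernel_of_volume_le S.kern.meas.enorm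
      ((measurable_cell h).comp S.meas_A) (fun ξ η => ?_)
      (volume_cell_le hκ hc₀ hvol ha0 ha1 G.one_le hh) S.kern.mass
    rw [← ofReal_norm]
    exact ENNReal.ofReal_le_ofReal (S.kern.bound ξ η)
  set Λ := resSize γ s L with hΛ
  have hΛ0 : 0 ≤ Λ := resSize_nonneg γ s L
  have hdef : ∀ n : ℕ, (n : ℝ) * τ ≤ T →
      ∫⁻ ξ, ‖localDefect τ (fun y => a * P κ d y) (scaledKernel ε ρ)
        (flow T (fun y => a * P κ d y) (scaledKernel ε ρ) μ₀ ψ) n ξ‖ₑ ≤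
      ENNReal.ofReal (C₁ * (D * (a * τ) + D ^ 2 * (τ + Λ) + D ^ 3 * Λ + D ^ 2 * R * Λ)) := by
    intro n hn
    refine F.lintegral_localDefect_le G prm hh hD0 hR0 ha0.le ha1 hB0 hM0 Q hwm hw (fun y => ?_)
      ?_ hVm hn
    · rw [abs_mul, abs_of_pos ha0]
      exact mul_le_mul_of_nonneg_left (abs_P_le κ d y) ha0.le
    · have e : ∀ y, flow T (fun y => a * P κ d y) (scaledKernel ε ρ) μ₀ ψ 0 y = μ₀ y :=
        fun y => by simp [flow]
      simp only [e]
      rw [hmw]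
      exact ENNReal.ofReal_le_ofReal (le_add_of_nonneg_right (by positivity))
  have hfin := S.lintegral_error_le hV hτ.le hn (by positivity) hdef
  rw [psiIter_eq_kernelIter κ d hρinf μ₀ hε α τ n]
  refine hfin.trans (ENNReal.ofReal_le_ofReal ?_)
  set Z := δ * a * τ + δ ^ 2 * (τ + Λ) with hZ
  have hZ0 : 0 ≤ Z := by positivity
  have z1 : δ * (a * τ) ≤ Z := by
    have : 0 ≤ δ ^ 2 * (τ + Λ) := by positivity
    linarith
  have z2 : δ ^ 2 * (τ + Λ) ≤ Z := by
    have : 0 ≤ δ * a * τ := by positivity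
    linarith
  have z3 : δ ^ 2 * Λ ≤ Z := by
    have : 0 ≤ δ ^ 2 * τ := by positivity
    linarith
  have z4 : δ ^ 3 * Λ ≤ Z := by
    have : δ ^ 3 * Λ ≤ δ ^ 2 * Λ :=
      mul_le_mul_of_nonneg_right (pow_le_pow_of_le_one hδ0.le hδ1 (by norm_num)) hΛ0
    linarith
  have hmain : D * (a * τ) + D ^ 2 * (τ + Λ) + D ^ 3 * Λ + D ^ 2 * R * Λ ≤
      (c + c ^ 2 + c ^ 3 + c ^ 2 * R) * Z := by
    have y1 := mul_le_mul_of_nonneg_left z1 hc0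
    have y2 := mul_le_mul_of_nonneg_left z2 (by positivity : 0 ≤ c ^ 2)
    have y3 := mul_le_mul_of_nonneg_left z4 (by positivity : 0 ≤ c ^ 3)
    have y4 := mul_le_mul_of_nonneg_left z3 (by positivity : 0 ≤ c ^ 2 * R)
    rw [hD]
    linarith
  calc _ ≤ C₁ * ((c + c ^ 2 + c ^ 3 + c ^ 2 * R) * Z) * exp (R * T) := by gcongr
    _ = C₁ * (c + c ^ 2 + c ^ 3 + c ^ 2 * R) * exp (R * T) * Z := by ring
    _ ≤ _ := by gcongr; linarith

lemma params_two_thirds : Params (2 / 3) (1 / 6) := by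
  constructor <;> norm_num

lemma resSize_two_thirds_le {L : ℕ} {τ : ℝ} (h : (L : ℝ)⁻¹ ≤ τ) :
    resSize (2 / 3) (1 / 6) L ≤ 36 * τ := by
  have e : resSize (2 / 3) (1 / 6) L = 36 * (L : ℝ)⁻¹ := by
    unfold resSize
    rw [show (2 * (1 / 6) - 2 * (2 / 3) : ℝ) = -1 by norm_num, rpow_neg_one]
    ring
  rw [e]
  gcongr

lemma params_half {τ : ℝ} (hτ : 4 ≤ log (1 / τ)) : Params (1 / 2) (log (1 / τ))⁻¹ := by
  have h0 : 0 < (log (1 / τ))⁻¹ := inv_pos.2 (by linarith)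
  have h1 : (log (1 / τ))⁻¹ ≤ 1 / 4 := by
    rw [one_div (4 : ℝ)]; exact inv_anti₀ (by norm_num) hτ
  exact ⟨le_rfl, by norm_num, h0, h1, by linarith⟩

lemma resSize_half_le {L : ℕ} {τ : ℝ} (hτ0 : 0 < τ) (hτ : 4 ≤ log (1 / τ)) (hL : 1 ≤ L)
    (h : (L : ℝ)⁻¹ ≤ τ) (h' : τ * L ≤ 2 * π) :
    resSize (1 / 2) (log (1 / τ))⁻¹ L ≤ 56 * τ * log (1 / τ) ^ 2 := by
  set l := log (1 / τ) with hl
  have hl0 : 0 < l := by linarith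
  have hL0 : (0 : ℝ) < L := by exact_mod_cast hL
  have hπ := pi_lt_d2
  have hlog : log L ≤ log 7 + l := by
    rw [hl, ← log_mul (by norm_num) (by positivity)]
    refine log_le_log hL0 ?_
    rw [mul_one_div, le_div_iff₀ hτ0]
    linarith
  have h7 : log 7 ≤ 2 := by
    rw [log_le_iff_le_exp (by norm_num), show (2:ℝ) = 1 + 1 by norm_num, exp_add]
    nlinarith [exp_one_gt_d9]
  have hp : (L : ℝ) ^ (2 * l⁻¹) ≤ 56 := by
    rw [rpow_def_of_pos hL0]
    have h1 : log L * (2 * l⁻¹) ≤ 3 := by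
      rw [← div_eq_mul_inv, mul_div_assoc', div_le_iff₀ hl0]
      linarith
    calc exp (log L * (2 * l⁻¹)) ≤ exp 3 := exp_le_exp.2 h1
      _ = exp 1 ^ 3 := by rw [← exp_nat_mul]; norm_num
      _ ≤ 3 ^ 3 := by
        gcongr
        linarith [exp_one_lt_d9]
      _ ≤ 56 := by norm_num
  have e : resSize (1 / 2) l⁻¹ L = (L : ℝ) ^ (2 * l⁻¹) * (L : ℝ)⁻¹ * l ^ 2 := by
    unfold resSize
    rw [show 2 * l⁻¹ - 2 * (1 / 2) = 2 * l⁻¹ + -1 by ring, rpow_add hL0, rpow_neg_one]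
    field_simp
  rw [e]
  gcongr

/-- Error estimate for the exponential integrator without the additional moment
assumption on `μ̂₀` (Remark 2.5 of the paper):
`‖μ(nτ) − μⁿ‖ ≤ C τ ε^{1+(κ−1)α/κ}(1 + (τ/ε^{α/(κ−1)})^{((κ−1)/κ)²} log(1/ε))
+ C τ ε^{2−2α/κ} log(1/ε) ⋅ B_κ(ε,τ)`, with `B_κ = 1` for `κ ≥ 3` and
`B₂ = (log(1/ε)+log(1/τ))²`. -/
theorem exponential_integrator_error_no_moment (κ : ℕ) (hκ : 2 ≤ κ)
    (d : ℕ → ℝ) (hd : d κ = 1)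
    (α : ℝ) (hα : α ∈ Set.Icc (0:ℝ) (κ : ℝ)) (T : ℝ) (hT : 0 < T)
    (ρ : ℝ → ℂ) (hρm : Measurable ρ) (hρ1 : Integrable ρ)
    (hρinf : eLpNorm ρ ⊤ volume ≠ ⊤)
    (hρsymm : ∀ᵐ ξ : ℝ, ρ (-ξ) = starRingEnd ℂ (ρ ξ))
    (μ₀ : ℝ → ℂ) (hμm : Measurable μ₀)
    (hμ1 : Integrable (fun ξ : ℝ => (1 + |ξ| ^ κ) * ‖μ₀ ξ‖))
    (σ L₀ : ℝ) (hσ : 0 < σ) (hL₀ : 1 ≤ L₀)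
    (hρdecay : ∀ L : ℝ, L₀ ≤ L → (∫ ξ in {x : ℝ | L ≤ |x|}, ‖ρ ξ‖) ≤ L ^ (-σ))
    (hμdecay : ∀ L : ℝ, L₀ ≤ L →
      (∫ ξ in {x : ℝ | L ≤ |x|}, |ξ| ^ κ * ‖μ₀ ξ‖) ≤ L ^ (-σ))
    (hμinf : ∃ M : ℝ, ∀ᵐ ξ : ℝ, |ξ| ^ κ * ‖μ₀ ξ‖ ≤ M) :
    ∃ τ₀ : ℝ, 0 < τ₀ ∧ ∃ ε₀ : ℝ, ε₀ ∈ Set.Ioo (0:ℝ) 1 ∧ ∃ C : ℝ, 0 < C ∧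
      ∀ τ : ℝ, 0 < τ → τ < τ₀ → ∀ ε : ℝ, 0 < ε → ε < ε₀ →
        ∀ ψ : ℝ → ℝ → ℂ, IsDuhamelSolution κ d ε α T ρ μ₀ ψ →
          ∀ n : ℕ, (n : ℝ) * τ ≤ T →
            (∫⁻ ξ : ℝ, (‖ψ ((n : ℝ) * τ) ξ - psiIter κ d ρ μ₀ ε α τ n ξ‖₊ : ℝ≥0∞)) ≤
              ENNReal.ofReal
                (C * τ * ε ^ (1 + ((κ : ℝ) - 1) * α / κ) *
                    (1 + (τ / ε ^ (α / ((κ : ℝ) - 1))) ^ ((((κ : ℝ) - 1) / κ) ^ 2) *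
                      Real.log (1 / ε)) +
                  C * τ * ε ^ (2 - 2 * α / κ) * Real.log (1 / ε) *
                    (if κ = 2 then (Real.log (1 / ε) + Real.log (1 / τ)) ^ 2
                      else 1)) := by
  have hκ' : (2 : ℝ) ≤ κ := by exact_mod_cast hκ
  have hexp : ∀ ε : ℝ, 0 < ε → ε ^ (1 - α / κ) * ε ^ α = ε ^ (1 + ((κ : ℝ) - 1) * α / κ) ∧
      (ε ^ (1 - α / κ)) ^ 2 = ε ^ (2 - 2 * α / κ) := by
    intro ε hε
    constructor
    · rw [← rpow_add hε]
      congr 1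
      field_simp; ring
    · rw [← rpow_natCast, ← rpow_mul hε.le]
      congr 1
      push_cast; ring
  have hlogε : ∀ ε : ℝ, 0 < ε → ε < exp (-1) → 1 ≤ log (1 / ε) := by
    intro ε hε h
    rw [one_div, log_inv, le_neg]
    exact ((log_lt_log hε h).trans_eq (log_exp _)).le
  have hlogτ : ∀ τ : ℝ, 0 < τ → τ < exp (-4) → 4 ≤ log (1 / τ) := by
    intro τ hτ h
    rw [one_div, log_inv, le_neg]
    exact ((log_lt_log hτ h).trans_eq (log_exp _)).le
  have hred : ∃ C : ℝ, 0 < C ∧ ∀ τ, 0 < τ → τ < exp (-4) → ∀ ε, 0 < ε → ε < exp (-1) →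
      ∀ ψ, IsDuhamelSolution κ d ε α T ρ μ₀ ψ → ∀ n : ℕ, (n : ℝ) * τ ≤ T →
        ∫⁻ ξ, ‖ψ (n * τ) ξ - psiIter κ d ρ μ₀ ε α τ n ξ‖ₑ ≤
          ENNReal.ofReal (C * (ε ^ (1 - α / κ) * ε ^ α * τ + (ε ^ (1 - α / κ)) ^ 2 *
            (57 * τ * (if κ = 2 then (log (1 / ε) + log (1 / τ)) ^ 2 else 1)))) := by
    have hτ1 : ∀ τ, τ < exp (-4) → τ ≤ 1 := fun τ h => h.le.trans (exp_le_one_iff.2 (by norm_num))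
    have hε1 : ∀ ε, ε < exp (-1) → ε ≤ 1 := fun τ h => h.le.trans (exp_le_one_iff.2 (by norm_num))
    by_cases hk : κ = 2
    · obtain ⟨C, hC, h⟩ := exists_error_le_resSize hκ hd hα hT hρm hρ1 hρinf hμm hμ1
        (γ := 1 / 2) (by norm_num) (by rw [hk]; norm_num)
      refine ⟨C, hC, fun τ hτ hτ₀ ε hε hε₀ ψ hψ n hn => ?_⟩
      have hl := hlogτ τ hτ hτ₀
      have hle := hlogε ε hε hε₀
      obtain ⟨L, hL, hLτ, hτL, hb⟩ := h _ (params_half hl) τ hτ (hτ1 τ hτ₀) ε hε (hε1 ε hε₀) ψ hψ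
      refine (hb n hn).trans (ENNReal.ofReal_le_ofReal ?_)
      have hr := resSize_half_le hτ hl hL hLτ hτL
      have h1 : log (1 / τ) ^ 2 ≤ (log (1 / ε) + log (1 / τ)) ^ 2 := by
        gcongr
        linarith
      have h2 : 1 ≤ log (1 / τ) ^ 2 := by nlinarith
      rw [if_pos hk]
      have h3 : τ + resSize (1 / 2) (log (1 / τ))⁻¹ L ≤
          57 * τ * (log (1 / ε) + log (1 / τ)) ^ 2 := by
        nlinarith
      gcongr
    · have hk3 : (3 : ℝ) ≤ κ := by exact_mod_cast (show 3 ≤ κ by omega)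
      obtain ⟨C, hC, h⟩ := exists_error_le_resSize hκ hd hα hT hρm hρ1 hρinf hμm hμ1
        (γ := 2 / 3) (by norm_num) (by
          have : 1 / (κ : ℝ) ≤ 1 / 3 := one_div_le_one_div_of_le (by norm_num) hk3
          linarith)
      refine ⟨C, hC, fun τ hτ hτ₀ ε hε hε₀ ψ hψ n hn => ?_⟩
      obtain ⟨L, hL, hLτ, hτL, hb⟩ := h _ params_two_thirds τ hτ (hτ1 τ hτ₀) ε hε (hε1 ε hε₀) ψ hψ
      refine (hb n hn).trans (ENNReal.ofReal_le_ofReal ?_)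
      have hr := resSize_two_thirds_le hLτ
      rw [if_neg hk]
      have h3 : τ + resSize (2 / 3) (1 / 6) L ≤ 57 * τ * 1 := by linarith
      gcongr
  obtain ⟨C, hC, h⟩ := hred
  refine ⟨exp (-4), exp_pos _, exp (-1), ⟨exp_pos _, by rw [exp_lt_one_iff]; norm_num⟩, 57 * C,
    by positivity, fun τ hτ hτ₀ ε hε hε₀ ψ hψ n hn => ?_⟩
  refine (h τ hτ hτ₀ ε hε hε₀ ψ hψ n hn).trans (ENNReal.ofReal_le_ofReal ?_)
  have hle := hlogε ε hε hε₀
  obtain ⟨e1, e2⟩ := hexp ε hε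
  rw [e1, e2]
  set W : ℝ := if κ = 2 then (log (1 / ε) + log (1 / τ)) ^ 2 else 1 with hW
  have hW0 : 0 ≤ W := by
    rw [hW]; split_ifs <;> positivity
  set x := ε ^ (1 + ((κ : ℝ) - 1) * α / κ) with hx
  set y := ε ^ (2 - 2 * α / κ) with hy
  have hx0 : 0 < x := rpow_pos_of_pos hε _
  have hy0 : 0 < y := rpow_pos_of_pos hε _
  set q := (τ / ε ^ (α / ((κ : ℝ) - 1))) ^ ((((κ : ℝ) - 1) / κ) ^ 2) with hq
  have hq0 : 0 ≤ q := by positivity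
  have h1 : C * (x * τ) ≤ 57 * C * τ * x * (1 + q * log (1 / ε)) := by
    have : 0 ≤ 57 * C * τ * x * (q * log (1 / ε)) := by positivity
    have : 0 ≤ 56 * C * τ * x := by positivity
    linarith
  have h2 : 57 * C * τ * y * 1 * W ≤ 57 * C * τ * y * log (1 / ε) * W := by gcongr
  linarith
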